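/- arXiv:2510.26073 — 2 statements merged into one kernel-verified Lean document; each statement's English description precedes it below -/
import Mathlib

section
/- Let A and B be nontrivial left-orderable groups and G = A ∗ B their free product. Let w ∈ G be an element such that no conjugate of w lies in the image of the canonical injection A → G. Then the composition A → G → G/⟨⟨w⟩⟩ is injective, where ⟨⟨w⟩⟩ is the normal closure of w in G. -/
/-- A group is left-orderable if there is a strict total order on it invariant
under left multiplication. -/
def IsLeftOrderable (H : Type*) [Group H] : Prop :=
  ∃ lt : H → H → Prop, IsStrictTotalOrder H lt ∧ ∀ f g h : H, lt f g → lt (h * f) (h * g)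

section AuxiliaryResults

universe u v w

variable {A : Type u} {B : Type v} [Group A] [Group B]

section Turn
variable {Ω : Type*} [LinearOrder Ω]

/-- The number of changes of direction (`0`, `1` or `2`) forced on a path which leaves `x` in the
direction `s` and arrives at `y` in the direction `t`. -/
def turn (x : Ω) (s : Bool) (y : Ω) (t : Bool) : ℕ :=
  if s ≠ t then 1 else if (if s then x ≤ y else y ≤ x) then 0 else 2

theorem turn_le_two (x : Ω) (s : Bool) (y : Ω) (t : Bool) : turn x s y t ≤ 2 := by
  unfold turn; split_ifs <;> simp

theorem turn_triangle {x y u v : Ω} {s t e : Bool} (h : if e then u ≤ v else v ≤ u) :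
    turn x s y t ≤ turn x s u e + turn v e y t := by
  unfold turn; cases s <;> cases t <;> cases e <;> simp_all <;> grind

theorem turn_swap (x x' y y' : Ω) (s s' t t' : Bool) :
    turn x' s' y t + turn x s y' t' ≤ turn x s y t + turn x' s' y' t' + 2 := by
  unfold turn; cases s <;> cases t <;> cases s' <;> cases t' <;> simp <;> grind

theorem turn_insert (x h y : Ω) (s e t : Bool) :
    turn x s h e + turn h e y t ≤ turn x s y t + 2 := by
  unfold turn; cases s <;> cases t <;> cases e <;> simp <;> grind

theorem exists_turn_insert [DenselyOrdered Ω] [NoMinOrder Ω] [NoMaxOrder Ω] (x y : Ω)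
    (s t : Bool) : ∃ h e, turn x s y t + 2 ≤ turn x s h e + turn h e y t := by
  obtain ⟨l, hl⟩ := exists_lt x
  obtain ⟨g, hg⟩ := exists_gt x
  rcases lt_trichotomy x y with h | h | h
  · obtain ⟨m, hm, hm'⟩ := exists_between h
    cases s
    · refine ⟨if t then g else m, false, ?_⟩
      cases t <;> simp [turn] <;> grind
    · refine ⟨l, true, ?_⟩
      cases t <;> simp [turn] <;> grind
  · cases s
    · refine ⟨g, false, ?_⟩
      cases t <;> simp [turn] <;> grind
    · refine ⟨l, true, ?_⟩
      cases t <;> simp [turn] <;> grind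
  · obtain ⟨m, hm, hm'⟩ := exists_between h
    cases s
    · refine ⟨g, false, ?_⟩
      cases t <;> simp [turn] <;> grind
    · refine ⟨if t then m else l, true, ?_⟩
      cases t <;> simp [turn] <;> grind

theorem turn_map (f : Ω ≃o Ω) (x y : Ω) (s t : Bool) : turn (f x) s (f y) t = turn x s y t := by
  simp [turn]

theorem turn_self (x : Ω) (s t : Bool) : turn x s x t = if s = t then 0 else 1 := by
  cases s <;> cases t <;> simp [turn]

theorem turn_eq_two {x y : Ω} {s : Bool} (h : if s then y < x else x < y) :
    turn x s y s = 2 := by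
  cases s <;> simp_all [turn]
end Turn

/-- The letter `z` read in the first (`true`) or second (`false`) factor of the free product. -/
def evalLetter : Bool → A × B →* Monoid.Coprod A B
  | true => Monoid.Coprod.inl.comp (MonoidHom.fst A B)
  | false => Monoid.Coprod.inr.comp (MonoidHom.snd A B)

section NormalForm

/-- The two factors, put in a common universe. -/
abbrev Factor (A : Type u) (B : Type v) : Bool → Type (max u v)
  | true => ULift.{v} A
  | false => ULift.{u} B

instance (b : Bool) : Group (Factor A B b) :=
  match b with
  | true => inferInstanceAs (Group (ULift.{v} A))
  | false => inferInstanceAs (Group (ULift.{u} B))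

/-- The component of a letter which is read in the factor `b`. -/
def letterComponent : (b : Bool) → A × B → Factor A B b
  | true => fun z => ULift.up z.1
  | false => fun z => ULift.up z.2

/-- The comparison map from the binary to the indexed free product. -/
def toCoprodI : Monoid.Coprod A B →* Monoid.CoprodI (Factor A B) :=
  Monoid.Coprod.lift
    ((Monoid.CoprodI.of (M := Factor A B) (i := true)).comp
      (MulEquiv.ulift.symm.toMonoidHom : A →* ULift.{v} A))
    ((Monoid.CoprodI.of (M := Factor A B) (i := false)).comp
      (MulEquiv.ulift.symm.toMonoidHom : B →* ULift.{u} B))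

theorem toCoprodI_evalLetter (b : Bool) (z : A × B) :
    toCoprodI (evalLetter b z) =
      (Monoid.CoprodI.of (letterComponent b z) : Monoid.CoprodI (Factor A B)) := by
  cases b <;> simp [toCoprodI, evalLetter, letterComponent] <;> rfl

theorem evalLetter_eq_one_of_component {b : Bool} {z : A × B} (h : letterComponent b z = 1) :
    evalLetter b z = 1 := by
  cases b
  · have : z.2 = 1 := congrArg ULift.down h
    simp [evalLetter, this]
  · have : z.1 = 1 := congrArg ULift.down h
    simp [evalLetter, this]

/-- The normal form theorem: an alternating product of nontrivial letters is nontrivial. -/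
theorem prod_evalLetter_ne_one {l : List (Bool × (A × B))} (hl : l ≠ [])
    (hchain : l.IsChain fun x y => x.1 ≠ y.1) (hne : ∀ x ∈ l, evalLetter x.1 x.2 ≠ 1) :
    (l.map fun x => evalLetter x.1 x.2).prod ≠ 1 := by
  classical
  intro h
  let w : Monoid.CoprodI.Word (Factor A B) :=
    { toList := l.map fun x => ⟨x.1, letterComponent x.1 x.2⟩
      ne_one := by
        intro y hy
        obtain ⟨x, hx, rfl⟩ := List.mem_map.1 hy
        exact fun h => hne x hx (evalLetter_eq_one_of_component h)
      chain_ne := by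
        rw [List.isChain_map]
        exact hchain }
  have hw : w.prod = 1 := by
    rw [← map_one toCoprodI, ← h, map_list_prod]
    simp [Monoid.CoprodI.Word.prod, w, toCoprodI_evalLetter, Function.comp_def]
  have h1 : w = Monoid.CoprodI.Word.empty :=
    Monoid.CoprodI.Word.equiv.symm.injective (by
      change w.prod = Monoid.CoprodI.Word.empty.prod
      rw [hw, Monoid.CoprodI.Word.prod_empty])
  have h2 : w.toList = [] := by rw [h1]; rfl
  exact hl (List.map_eq_nil_iff.1 h2)

end NormalForm

/-- The factor containing the `k`-th letter of a relator. -/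
def parity (k : ℕ) : Bool := !k.bodd

/-- An action of the two factors on a linear order, together with heights which are permuted
cyclically by the letters of the relator with letters `x 0, …, x (p - 1)`. -/
structure RelatorAction (Ω : Type*) [LinearOrder Ω] (x : ℕ → A × B) (p : ℕ) where
  act : Bool → A × B →* (Ω ≃o Ω)
  act_eq_one : ∀ b z, evalLetter b z = 1 → act b z = 1
  height : Bool → ℕ → Ω
  act_height : ∀ k, act (parity (k + 1)) (x (k + 1)) (height (parity (k + 1)) (k + 1)) =
    height (parity (k + 1)) k
  height_add : ∀ b k, height b (k + p) = height b k
  height_lt_iff : ∀ i j, height true i < height true j ↔ height false i < height false j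
  height_ne : ∀ b i j, i < p → j < p → i ≠ j → height b i ≠ height b j

section Words

variable {ι Ω : Type*} [LinearOrder Ω] (act : Bool → A × B →* (Ω ≃o Ω)) (side : ι → Bool)

/-- The number of turns at the letter `z` between the tokens `t` and `t'`, when every token is
coloured by its two heights and a direction. -/
def tokenTurn (χ : ι → (Bool → Ω) × Bool) (t : ι) (z : A × B) (t' : ι) : ℕ :=
  turn (act (side t') z ((χ t').1 (side t'))) (χ t').2 ((χ t).1 (side t')) (!(χ t).2)

/-- The total number of turns along a list of letters and tokens starting at a token. -/
def turnSum (χ : ι → (Bool → Ω) × Bool) : ι → List ((A × B) × ι) → ℕ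
  | _, [] => 0
  | t, e :: l => tokenTurn act side χ t e.1 e.2 + turnSum χ e.2 l

/-- The last token met along a list. -/
def lastToken : ι → List ((A × B) × ι) → ι
  | t, [] => t
  | _, e :: l => lastToken e.2 l

/-- The product of the letters of a list, with group elements inserted at the tokens. -/
def tokenProd (ins : ι → Monoid.Coprod A B) (l : List ((A × B) × ι)) : Monoid.Coprod A B :=
  (l.map fun e => evalLetter (side e.2) e.1 * ins e.2).prod

variable {act side}

theorem turnSum_append (χ : ι → (Bool → Ω) × Bool) (t : ι) (l l' : List ((A × B) × ι)) :
    turnSum act side χ t (l ++ l') =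
      turnSum act side χ t l + turnSum act side χ (lastToken t l) l' := by
  induction l generalizing t with
  | nil => simp [turnSum, lastToken]
  | cons e l ih => simp [turnSum, lastToken, ih, add_assoc]

theorem lastToken_append (t : ι) (l l' : List ((A × B) × ι)) :
    lastToken t (l ++ l') = lastToken (lastToken t l) l' := by
  induction l generalizing t with
  | nil => rfl
  | cons e l ih => simp [lastToken, ih]

theorem lastToken_mem (t : ι) (l : List ((A × B) × ι)) :
    lastToken t l = t ∨ lastToken t l ∈ l.map Prod.snd := by
  induction l generalizing t with
  | nil => simp [lastToken]
  | cons e l ih => rcases ih e.2 with h | h <;> simp_all [lastToken]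

theorem turnSum_congr {χ χ' : ι → (Bool → Ω) × Bool} {t : ι} {l : List ((A × B) × ι)}
    (ht : χ t = χ' t) (h : ∀ u ∈ l.map Prod.snd, χ u = χ' u) :
    turnSum act side χ t l = turnSum act side χ' t l := by
  induction l generalizing t with
  | nil => rfl
  | cons e l ih =>
    simp only [List.map_cons, List.mem_cons, forall_eq_or_imp] at h
    simp [turnSum, tokenTurn, ht, h.1, ih h.1 h.2]

theorem tokenProd_append (ins : ι → Monoid.Coprod A B) (l l' : List ((A × B) × ι)) :
    tokenProd side ins (l ++ l') = tokenProd side ins l * tokenProd side ins l' := by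
  simp [tokenProd]

theorem tokenProd_cons (ins : ι → Monoid.Coprod A B) (e : (A × B) × ι)
    (l : List ((A × B) × ι)) :
    tokenProd side ins (e :: l) = evalLetter (side e.2) e.1 * ins e.2 * tokenProd side ins l := by
  simp [tokenProd]

theorem tokenProd_congr {ins ins' : ι → Monoid.Coprod A B} {l : List ((A × B) × ι)}
    (h : ∀ u ∈ l.map Prod.snd, ins u = ins' u) :
    tokenProd side ins l = tokenProd side ins' l := by
  induction l with
  | nil => rfl
  | cons e l ih =>
    simp only [List.map_cons, List.mem_cons, forall_eq_or_imp] at h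
    rw [tokenProd_cons, tokenProd_cons, h.1, ih h.2]

/-- Two tokens with opposite directions and correspondingly ordered heights which cap off a
trivial letter contribute two turns. -/
theorem tokenTurn_cap {χ : ι → (Bool → Ω) × Bool} {t u t' s : ι} {y z z' : A × B}
    (hz' : act (side t') z' = 1) (hts : side t = side s)
    (hD : (χ t').2 = !(χ t).2)
    (hlt : ∀ b, if (χ t).2 then (χ t').1 b < (χ t).1 b else (χ t).1 b < (χ t').1 b) :
    tokenTurn act side χ u (y * z) s + 2 ≤ tokenTurn act side χ u y t +
      (tokenTurn act side χ t z' t' + tokenTurn act side χ t' z s) := by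
  have h2 : tokenTurn act side χ t z' t' = 2 := by
    unfold tokenTurn
    rw [hz', hD]
    apply turn_eq_two
    have := hlt (side t')
    cases h : (χ t).2 <;> simp_all
  have h3 : tokenTurn act side χ u (y * z) s ≤
      tokenTurn act side χ u y t + tokenTurn act side χ t' z s := by
    unfold tokenTurn
    rw [map_mul, ← hts, add_comm, RelIso.mul_apply, ← turn_map (act (side t) y) (act (side t) z _),
      hD, Bool.not_not]
    apply turn_triangle
    have := hlt (side t)
    cases h : (χ t).2 <;> simp_all [le_of_lt]
  omega

/-- A pair of cancelling tokens can be coloured so as to contribute two turns. -/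
theorem exists_tokenTurn_insert [DecidableEq ι] [DenselyOrdered Ω] [NoMinOrder Ω] [NoMaxOrder Ω]
    (χ : ι → (Bool → Ω) × Bool) {t u t' s : ι} {y z z' : A × B} (hts : side t = side s)
    (htt' : t ≠ t') (hut : u ≠ t) (hut' : u ≠ t') (hst : s ≠ t) (hst' : s ≠ t') :
    ∃ c : (Bool → Ω) × Bool, ∀ χ₁, χ₁ = Function.update (Function.update χ t c) t' (c.1, !c.2) →
      tokenTurn act side χ u (y * z) s + 2 ≤ tokenTurn act side χ₁ u y t +
      (tokenTurn act side χ₁ t z' t' + tokenTurn act side χ₁ t' z s) := by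
  obtain ⟨h, e, he⟩ := exists_turn_insert (act (side s) (y * z) ((χ s).1 (side s)))
    ((χ u).1 (side s)) (χ s).2 (!(χ u).2)
  refine ⟨(fun _ => (act (side s) y)⁻¹ h, e), ?_⟩
  rintro χ₁ rfl
  have h1 : h = act (side s) y ((act (side s) y)⁻¹ h) := (RelIso.apply_inv_self _ _).symm
  have h2 := turn_map (act (side s) y) (act (side s) z ((χ s).1 (side s)))
    ((act (side s) y)⁻¹ h) (χ s).2 e
  rw [map_mul, RelIso.mul_apply] at he
  simp only [tokenTurn, Function.update_of_ne htt', Function.update_self,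
    Function.update_of_ne hut, Function.update_of_ne hut', Function.update_of_ne hst,
    Function.update_of_ne hst', Bool.not_not, hts, map_mul, RelIso.mul_apply]
  rw [RelIso.apply_inv_self] at h2 ⊢
  omega

section Shift

open Filter Topology

variable [TopologicalSpace Ω] [OrderTopology Ω]

/-- The heights close to `P` on the side prescribed by `D`. -/
def nearby (P : Bool → Ω) (D : Bool) : Filter (Bool → Ω) :=
  Filter.pi fun b => if D then 𝓝[<] (P b) else 𝓝[>] (P b)

theorem eventually_nearby {P : Bool → Ω} {D : Bool} (b : Bool) {p : Ω → Prop}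
    (h : ∀ᶠ y in if D then 𝓝[<] (P b) else 𝓝[>] (P b), p y) : ∀ᶠ c in nearby P D, p (c b) :=
  (tendsto_eval_pi (fun b => if D then 𝓝[<] (P b) else 𝓝[>] (P b)) b).eventually h

theorem eventually_nearby_lt (P : Bool → Ω) (D : Bool) :
    ∀ᶠ c in nearby P D, ∀ b, if D then c b < P b else P b < c b := by
  rw [Filter.eventually_all]
  intro b
  refine eventually_nearby b (p := fun y => if D then y < P b else P b < y) ?_
  cases D
  · exact (self_mem_nhdsWithin : Set.Ioi (P b) ∈ 𝓝[>] P b)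
  · exact (self_mem_nhdsWithin : Set.Iio (P b) ∈ 𝓝[<] P b)

theorem eventually_turn_right (P : Ω) (D : Bool) (X : Ω) (S : Bool) :
    ∀ᶠ y in if D then 𝓝[<] P else 𝓝[>] P, turn X S P (!D) ≤ turn X S y (!D) := by
  cases D
  · rcases le_or_gt X P with h | h
    · cases S <;> simp [turn, h]
    · filter_upwards [nhdsWithin_le_nhds (Iio_mem_nhds h)] with y (hy : y < X)
      cases S <;> simp [turn, not_le.2 hy, not_le.2 h]
  · rcases le_or_gt P X with h | h
    · cases S <;> simp [turn, h]
    · filter_upwards [nhdsWithin_le_nhds (Ioi_mem_nhds h)] with y (hy : X < y)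
      cases S <;> simp [turn, not_le.2 hy, not_le.2 h]

theorem eventually_turn_left (P : Ω) (D : Bool) (Y : Ω) (T : Bool) :
    ∀ᶠ y in if D then 𝓝[<] P else 𝓝[>] P, turn P D Y T ≤ turn y D Y T := by
  cases D
  · rcases le_or_gt Y P with h | h
    · cases T <;> simp [turn, h]
    · filter_upwards [nhdsWithin_le_nhds (Iio_mem_nhds h)] with y (hy : y < Y)
      cases T <;> simp [turn, not_le.2 hy, not_le.2 h]
  · rcases le_or_gt P Y with h | h
    · cases T <;> simp [turn, h]
    · filter_upwards [nhdsWithin_le_nhds (Ioi_mem_nhds h)] with y (hy : Y < y)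
      cases T <;> simp [turn, not_le.2 hy, not_le.2 h]

theorem eventually_tokenTurn_update [DecidableEq ι] (χ : ι → (Bool → Ω) × Bool) (a t : ι)
    (z : A × B) (t' : ι) :
    ∀ᶠ c in nearby (χ a).1 (χ a).2, tokenTurn act side χ t z t' ≤
      tokenTurn act side (Function.update χ a (c, (χ a).2)) t z t' := by
  by_cases ht : t = a <;> by_cases ht' : t' = a
  · refine Eventually.of_forall fun c => ?_
    cases h : (χ a).2 <;> simp [tokenTurn, ht, ht', h, turn]
  · subst ht
    simp only [tokenTurn, Function.update_self, Function.update_of_ne ht']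
    exact eventually_nearby (side t') (eventually_turn_right _ _ _ _)
  · subst ht'
    simp only [tokenTurn, Function.update_self, Function.update_of_ne ht]
    refine eventually_nearby (side t') (p := fun y => turn _ _ _ _ ≤ turn (act _ _ y) _ _ _) ?_
    filter_upwards [eventually_turn_left ((χ t').1 (side t')) (χ t').2
      ((act (side t') z)⁻¹ ((χ t).1 (side t'))) (!(χ t).2)] with y hy
    rw [← turn_map (act (side t') z), ← turn_map (act (side t') z) y,
      RelIso.apply_inv_self] at hy
    exact hy
  · simp [tokenTurn, Function.update_of_ne ht, Function.update_of_ne ht']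

theorem eventually_turnSum_update [DecidableEq ι] (χ : ι → (Bool → Ω) × Bool) (a t : ι)
    (l : List ((A × B) × ι)) :
    ∀ᶠ c in nearby (χ a).1 (χ a).2, turnSum act side χ t l ≤
      turnSum act side (Function.update χ a (c, (χ a).2)) t l := by
  induction l generalizing t with
  | nil => simp [turnSum]
  | cons e l ih =>
    filter_upwards [ih e.2, eventually_tokenTurn_update χ a t e.1 e.2] with c h1 h2
    exact add_le_add h2 h1

end Shift

/-- The heights of a token can be moved strictly in the direction it prescribes without
decreasing the number of turns. -/
theorem exists_turnSum_update [DecidableEq ι] [DenselyOrdered Ω] [NoMinOrder Ω] [NoMaxOrder Ω]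
    (χ : ι → (Bool → Ω) × Bool) (a t : ι) (l : List ((A × B) × ι)) :
    ∃ c : Bool → Ω, (∀ b, if (χ a).2 then c b < (χ a).1 b else (χ a).1 b < c b) ∧
      turnSum act side χ t l ≤ turnSum act side (Function.update χ a (c, (χ a).2)) t l := by
  let _ : TopologicalSpace Ω := Preorder.topology Ω
  have : OrderTopology Ω := ⟨rfl⟩
  have : (nearby (χ a).1 (χ a).2).NeBot := by
    unfold nearby
    cases (χ a).2 <;> simp only [Bool.false_eq_true, if_true, if_false] <;> infer_instance
  exact ((eventually_nearby_lt _ _).and (eventually_turnSum_update χ a t l)).exists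

end Words

section Core

variable {ι Ω : Type*} [LinearOrder Ω] {x : ℕ → A × B} {p : ℕ}

/-- A colouring is admissible at a token of a word when its partner in the word has equal heights
and opposite direction, and the heights are the prescribed ones if its partner is virtual. -/
structure IsAdmissibleAt (R : RelatorAction Ω x p) (V : Set ι) (pos : ι → ℕ) (M m : ℕ)
    (π : ι → ι) (ids : List ι) (χ : ι → (Bool → Ω) × Bool) (u : ι) : Prop where
  pair : π u ∈ ids → χ (π u) = ((χ u).1, !(χ u).2)
  height : π u ∈ V → ∀ b, (χ u).1 b = R.height b (pos (π u))
  dir_max : π u ∈ V → pos (π u) = M → (χ u).2 = true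
  dir_min : π u ∈ V → pos (π u) = m → (χ u).2 = false

/-- A colouring is admissible for a word when it is so at every token. -/
def IsAdmissible (R : RelatorAction Ω x p) (V : Set ι) (pos : ι → ℕ) (M m : ℕ)
    (π : ι → ι) (ids : List ι) (χ : ι → (Bool → Ω) × Bool) : Prop :=
  ∀ u ∈ ids, IsAdmissibleAt R V pos M m π ids χ u

/-- A closed word with paired tokens and few turns in every admissible colouring. -/
structure IsTightWord (R : RelatorAction Ω x p) (side : ι → Bool) (V : Set ι) (pos : ι → ℕ)
    (M m : ℕ) (E : ℕ → Bool → Monoid.Coprod A B) (T : Set (Monoid.Coprod A B))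
    (π : ι → ι) (h₀ : ι) (l : List ((A × B) × ι)) : Prop where
  nodup : (l.map Prod.snd).Nodup
  last_mem : h₀ ∈ l.map Prod.snd
  last : lastToken h₀ l = h₀
  head_virt : π h₀ ∈ V
  not_virt : ∀ u ∈ l.map Prod.snd, u ∉ V
  pair : ∀ u ∈ l.map Prod.snd, π u ∈ V ∨ π u ∈ l.map Prod.snd
  invol : ∀ u, π (π u) = u
  side_pair : ∀ u, side (π u) = !side u
  chain : (h₀ :: l.map Prod.snd).IsChain fun u v => side u ≠ side v
  tokenProd_eq_one : tokenProd side 1 l = 1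
  bound : ∀ χ, IsAdmissible R V pos M m π (l.map Prod.snd) χ →
    turnSum R.act side χ h₀ l ≤ l.length
  insert : ∀ v ∈ V, ∀ v' ∈ V, π v ∈ l.map Prod.snd → π v' ∈ l.map Prod.snd → pos v = pos v' →
    side v ≠ side v' → ∀ ins : ι → Monoid.Coprod A B, (∀ u, ins (π u) = (ins u)⁻¹) →
    (∀ u ∈ V, u ≠ v → u ≠ v' → ins u = 1) → ins v = E (pos v) (side v) →
    ins v' = E (pos v') (side v') → tokenProd side ins l ∈ T

variable {R : RelatorAction Ω x p} {side : ι → Bool} {V : Set ι} {pos : ι → ℕ} {M m : ℕ}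
  {E : ℕ → Bool → Monoid.Coprod A B} {T : Set (Monoid.Coprod A B)}

/-- Two adjacent tokens separated by a trivial letter and paired with virtual tokens lie over
different positions of the relator. -/
theorem IsTightWord.pos_ne {π : ι → ι} {h₀ : ι} {X Y : List ((A × B) × ι)} {t t' : ι}
    {z z' : A × B} (h : IsTightWord R side V pos M m E T π h₀ (X ++ (z, t) :: (z', t') :: Y))
    (hE : ∀ i b, E i (!b) = (E i b)⁻¹) (hT : 1 ∉ T)
    (hz' : evalLetter (side t') z' = 1) (ht : π t ∈ V) (ht' : π t' ∈ V) :
    pos (π t) ≠ pos (π t') := by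
  classical
  intro hpos
  have hnd := h.nodup
  simp only [List.map_append, List.map_cons, List.nodup_append, List.nodup_cons, List.mem_cons,
    not_or, forall_eq_or_imp, ne_eq] at hnd
  obtain ⟨-, ⟨⟨htt', htY⟩, htY', -⟩, hX⟩ := hnd
  have hmt : t ∈ (X ++ (z, t) :: (z', t') :: Y).map Prod.snd := by simp
  have hmt' : t' ∈ (X ++ (z, t) :: (z', t') :: Y).map Prod.snd := by simp
  have hside : side t ≠ side t' := by
    have := h.chain
    simp only [List.map_append, List.map_cons] at this
    rw [← List.cons_append, List.isChain_append_cons_cons] at this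
    exact this.2.1
  have htV := h.not_virt t hmt
  have htV' := h.not_virt t' hmt'
  have hinj : Function.Injective π := fun u v huv => by rw [← h.invol u, huv, h.invol]
  let f : ι → Monoid.Coprod A B := fun u =>
    if u = π t ∨ u = π t' then E (pos u) (side u) else 1
  have hf_ids : ∀ u ∉ V, f u = 1 := by
    intro u hu
    refine if_neg ?_
    rintro (rfl | rfl) <;> contradiction
  have hf_pair : ∀ u, u ≠ t → u ≠ t' → f (π u) = 1 := by
    intro u hu hu'
    refine if_neg ?_
    rintro (h | h)
    · exact hu (hinj h)
    · exact hu' (hinj h)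
  have hins := h.insert (π t) ht (π t') ht' (by rwa [h.invol]) (by rwa [h.invol]) hpos
    (by simpa [h.side_pair] using hside) (fun u => f u * (f (π u))⁻¹)
    (fun u => by simp [h.invol])
    (fun u hu h1 h2 => by
      have h3 : u ≠ t := fun h => htV (h ▸ hu)
      have h4 : u ≠ t' := fun h => htV' (h ▸ hu)
      simp [hf_pair u h3 h4, f, h1, h2])
    (by simp [h.invol, hf_ids t htV, f]) (by simp [h.invol, hf_ids t' htV', f])
  have h1 : ∀ l : List ((A × B) × ι), (∀ u ∈ l.map Prod.snd, u ≠ t ∧ u ≠ t' ∧ u ∉ V) →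
      tokenProd side (fun u => f u * (f (π u))⁻¹) l = tokenProd side 1 l := by
    intro l hl
    refine tokenProd_congr fun u hu => ?_
    obtain ⟨h1, h2, h3⟩ := hl u hu
    simp [hf_ids u h3, hf_pair u h1 h2]
  rw [tokenProd_append, tokenProd_cons, tokenProd_cons, h1 X, h1 Y] at hins
  · have h2 := h.tokenProd_eq_one
    rw [tokenProd_append, tokenProd_cons, tokenProd_cons] at h2
    have hs : side t' = !side t := by cases h : side t <;> cases h' : side t' <;> simp_all
    have h3 : f (π t) = (f (π t'))⁻¹ := by
      simp [f, ← hpos, h.side_pair, hs, hE]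
    simp only [hz', hf_ids t htV, hf_ids t' htV', h3, Pi.one_apply] at hins h2
    simp only [mul_assoc, one_mul, mul_one, inv_inv, mul_inv_cancel_left] at hins h2
    rw [h2] at hins
    exact hT hins
  · intro u hu
    refine ⟨?_, ?_, h.not_virt u (by
      simp only [List.map_append, List.map_cons, List.mem_append, List.mem_cons]; tauto)⟩
    · rintro rfl; exact htY hu
    · rintro rfl; exact htY' hu
  · intro u hu
    refine ⟨?_, ?_, h.not_virt u (by
      simp only [List.map_append, List.map_cons, List.mem_append, List.mem_cons]; tauto)⟩
    · exact (hX u hu).1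
    · exact (hX u hu).2.1

open Classical in
/-- The pairing obtained by joining `t` to `t'` and the partner of `t` to the partner of `t'`. -/
noncomputable def rejoin (π : ι → ι) (t t' : ι) (u : ι) : ι :=
  if u = t then t' else if u = t' then t else if u = π t then π t' else
  if u = π t' then π t else π u

theorem rejoin_partner {π : ι → ι} {t t' : ι} (hπ : ∀ u, π (π u) = u) (hne : ∀ u, π u ≠ u) :
    rejoin π t t' (π t) = π t' ∧ rejoin π t t' (π t') = π t := by
  unfold rejoin
  grind

theorem rejoin_of_ne {π : ι → ι} {t t' u : ι} (h1 : u ≠ t) (h2 : u ≠ t') (h3 : u ≠ π t)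
    (h4 : u ≠ π t') : rejoin π t t' u = π u := by
  simp [rejoin, *]

theorem rejoin_rejoin {π : ι → ι} {t t' : ι} (hπ : ∀ u, π (π u) = u) (hne : ∀ u, π u ≠ u)
    (u : ι) : rejoin π t t' (rejoin π t t' u) = u := by
  unfold rejoin
  grind

theorem turnSum_cap {act : Bool → A × B →* (Ω ≃o Ω)} {χ : ι → (Bool → Ω) × Bool}
    {h₀ t t' s : ι} {y z z' : A × B} {X Y : List ((A × B) × ι)}
    (hz' : act (side t') z' = 1) (hts : side t = side s) (hD : (χ t').2 = !(χ t).2)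
    (hlt : ∀ b, if (χ t).2 then (χ t').1 b < (χ t).1 b else (χ t).1 b < (χ t').1 b) :
    turnSum act side χ h₀ (X ++ (y * z, s) :: Y) + 2 ≤
      turnSum act side χ h₀ (X ++ (y, t) :: (z', t') :: (z, s) :: Y) := by
  have := tokenTurn_cap (act := act) (u := lastToken h₀ X) (y := y) (z := z) hz' hts hD hlt
  simp only [turnSum_append, turnSum]
  omega

/-- The indices `M` and `m` carry the largest and the smallest height. -/
structure IsExtremal (R : RelatorAction Ω x p) (M m : ℕ) : Prop where
  max_lt : M < p
  min_lt : m < p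
  le_max : ∀ i < p, ∀ b, R.height b i ≤ R.height b M
  min_le : ∀ i < p, ∀ b, R.height b m ≤ R.height b i

/-- The direction, compatible with the extremal heights, comparing two heights. -/
theorem IsExtremal.exists_dir (hR : IsExtremal R M m) {i j : ℕ} (hi : i < p) (hj : j < p)
    (hij : i ≠ j) : ∃ D : Bool,
      (∀ b, if D then R.height b j < R.height b i else R.height b i < R.height b j) ∧
      (i = M → D = true) ∧ (i = m → D = false) ∧ (j = M → D = false) ∧ (j = m → D = true) := by
  have key : ∀ b, R.height b j < R.height b i ↔ R.height true j < R.height true i := by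
    intro b
    cases b
    · exact (R.height_lt_iff j i).symm
    · rfl
  by_cases h : R.height true j < R.height true i
  · refine ⟨true, fun b => by simpa using (key b).2 h, fun _ => rfl, ?_, ?_, fun _ => rfl⟩
    · rintro rfl
      exact absurd h (not_lt.2 (hR.min_le j hj true))
    · rintro rfl
      exact absurd h (not_lt.2 (hR.le_max i hi true))
  · have h' : ∀ b, R.height b i < R.height b j := fun b =>
      lt_of_le_of_ne (not_lt.1 fun h1 => h ((key b).1 h1)) (R.height_ne b i j hi hj hij)
    refine ⟨false, fun b => by simpa using h' b, ?_, fun _ => rfl, fun _ => rfl, ?_⟩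
    · rintro rfl
      exact absurd (h' true) (not_lt.2 (hR.le_max j hj true))
    · rintro rfl
      exact absurd (h' true) (not_lt.2 (hR.min_le i hi true))

section Recolour

variable {π : ι → ι} {ids ids' : List ι}
  {h₀ t t' s : ι} {y z z' : A × B} {X Y : List ((A × B) × ι)} {χ χ' : ι → (Bool → Ω) × Bool}

theorem IsAdmissibleAt.of_pair {u : ι} (hV : π u ∉ V) (h : χ (π u) = ((χ u).1, !(χ u).2)) :
    IsAdmissibleAt R V pos M m π ids χ u :=
  ⟨fun _ => h, fun h => (hV h).elim, fun h => (hV h).elim, fun h => (hV h).elim⟩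

theorem IsAdmissibleAt.congr {π' : ι → ι} {u u' : ι}
    (h : IsAdmissibleAt R V pos M m π' ids' χ' u') (hπ : π u = π' u') (hχ : χ u = χ' u')
    (hmem : π u ∈ ids → π u ∈ ids' ∧ χ (π u) = χ' (π u)) :
    IsAdmissibleAt R V pos M m π ids χ u := by
  refine ⟨fun hu => ?_, fun hu => ?_, fun hu => ?_, fun hu => ?_⟩
  · obtain ⟨h1, h2⟩ := hmem hu
    rw [h2, hχ, hπ]
    exact h.pair (hπ ▸ h1)
  · rw [hχ, hπ]
    exact h.height (hπ ▸ hu)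
  · rw [hχ, hπ]
    exact h.dir_max (hπ ▸ hu)
  · rw [hχ, hπ]
    exact h.dir_min (hπ ▸ hu)

/-- Two tokens which are adjacent in a word with tokens `ids`, and which do not occur in the word
with tokens `ids'`. -/
structure IsCancellation (V : Set ι) (π : ι → ι) (ids ids' : List ι) (t t' : ι) : Prop where
  invol : ∀ u, π (π u) = u
  ne : ∀ u, π u ≠ u
  mem_iff : ∀ u, u ∈ ids ↔ u = t ∨ u = t' ∨ u ∈ ids'
  left_notMem : t ∉ ids'
  right_notMem : t' ∉ ids'
  left_ne_right : t ≠ t'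
  notMem_virt : ∀ u ∈ ids, u ∉ V

/-- Admissibility is only affected by a cancellation at the tokens involved. -/
theorem IsCancellation.isAdmissible (h : IsCancellation V π ids ids' t t')
    (hχ' : IsAdmissible R V pos M m (rejoin π t t') ids' χ')
    (hχ : ∀ u, u ≠ t → u ≠ t' → u ≠ π t → u ≠ π t' → χ u = χ' u)
    (h1 : IsAdmissibleAt R V pos M m π ids χ t)
    (h2 : IsAdmissibleAt R V pos M m π ids χ t')
    (h3 : π t ∈ ids' → IsAdmissibleAt R V pos M m π ids χ (π t))
    (h4 : π t' ∈ ids' → IsAdmissibleAt R V pos M m π ids χ (π t')) :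
    IsAdmissible R V pos M m π ids χ := by
  intro u hu
  by_cases hut : u = t
  · exact hut ▸ h1
  by_cases hut' : u = t'
  · exact hut' ▸ h2
  have hu' : u ∈ ids' := by
    have := (h.mem_iff u).1 hu
    tauto
  by_cases hua : u = π t
  · exact hua ▸ h3 (hua ▸ hu')
  by_cases hub : u = π t'
  · exact hub ▸ h4 (hub ▸ hu')
  have k1 : π u ≠ t := fun h' => hua (by rw [← h', h.invol])
  have k2 : π u ≠ t' := fun h' => hub (by rw [← h', h.invol])
  have k3 : π u ≠ π t := fun h' => hut (by rw [← h.invol u, h', h.invol])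
  have k4 : π u ≠ π t' := fun h' => hut' (by rw [← h.invol u, h', h.invol])
  refine (hχ' u hu').congr (rejoin_of_ne hut hut' hua hub).symm (hχ u hut hut' hua hub)
    fun hm => ⟨?_, hχ _ k1 k2 k3 k4⟩
  have := (h.mem_iff (π u)).1 hm
  tauto

variable [DenselyOrdered Ω] [NoMinOrder Ω] [NoMaxOrder Ω]

theorem IsCancellation.exists_recolour_of_pair (h : IsCancellation V π ids ids' t t')
    (hids' : ∀ u, u = h₀ ∨ u ∈ (X ++ (y * z, s) :: Y).map Prod.snd → u ∈ ids')
    (hts : side t = side s) (htπ : π t = t')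
    (hχ' : IsAdmissible R V pos M m (rejoin π t t') ids' χ') :
    ∃ χ, IsAdmissible R V pos M m π ids χ ∧
      turnSum R.act side χ' h₀ (X ++ (y * z, s) :: Y) + 2 ≤
        turnSum R.act side χ h₀ (X ++ (y, t) :: (z', t') :: (z, s) :: Y) := by
  classical
  have hpt' : π t' = t := by rw [← htπ, h.invol]
  have hne : ∀ u ∈ ids', u ≠ t ∧ u ≠ t' := fun u hu =>
    ⟨fun h' => h.left_notMem (h' ▸ hu), fun h' => h.right_notMem (h' ▸ hu)⟩
  have hs := hne s (hids' s (Or.inr (by simp)))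
  have hX : lastToken h₀ X ∈ ids' := by
    refine hids' _ ?_
    rcases lastToken_mem h₀ X with h | h
    · exact Or.inl h
    · exact Or.inr (by simp [h])
  obtain ⟨c, hc⟩ := exists_tokenTurn_insert (act := R.act) (side := side) χ' (u := lastToken h₀ X)
    (y := y) (z := z) (z' := z') hts h.left_ne_right (hne _ hX).1 (hne _ hX).2 hs.1 hs.2
  set χ := Function.update (Function.update χ' t c) t' (c.1, !c.2) with hχdef
  have hχt' : χ t' = (c.1, !c.2) := by simp [χ]
  have hχt : χ t = c := by simp [χ, h.left_ne_right]
  have hχ : ∀ u, u ≠ t → u ≠ t' → χ u = χ' u := fun u h1 h2 => by simp [χ, h1, h2]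
  refine ⟨χ, h.isAdmissible hχ' (fun u h1 h2 _ _ => hχ u h1 h2) ?_ ?_ ?_ ?_, ?_⟩
  · refine .of_pair ?_ (by rw [htπ, hχt, hχt'])
    rw [htπ]
    exact h.notMem_virt _ ((h.mem_iff _).2 (by simp))
  · refine .of_pair ?_ (by rw [hpt', hχt, hχt', Bool.not_not])
    rw [hpt']
    exact h.notMem_virt _ ((h.mem_iff _).2 (by simp))
  · exact fun h' => (h.right_notMem (htπ ▸ h')).elim
  · exact fun h' => (h.left_notMem (hpt' ▸ h')).elim
  · have h1 := hc χ rfl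
    have hc : ∀ u ∈ ids', χ u = χ' u := fun u hu => hχ u (hne u hu).1 (hne u hu).2
    have h2 : turnSum R.act side χ h₀ X = turnSum R.act side χ' h₀ X :=
      turnSum_congr (hc _ (hids' _ (Or.inl rfl))) fun u hu => hc _ (hids' _ (by
        rw [List.map_append, List.mem_append]; exact Or.inr (Or.inl hu)))
    have h3 : turnSum R.act side χ s Y = turnSum R.act side χ' s Y :=
      turnSum_congr (hc _ (hids' _ (Or.inr (by simp)))) fun u hu => hc _ (hids' _ (by
        rw [List.map_append, List.mem_append, List.map_cons, List.mem_cons]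
        exact Or.inr (Or.inr (Or.inr hu))))
    simp only [turnSum_append, turnSum, h2, h3]
    omega

theorem IsCancellation.exists_recolour_of_left (h : IsCancellation V π ids ids' t t')
    (hids' : ∀ u, u = h₀ ∨ u ∈ (X ++ (y * z, s) :: Y).map Prod.snd → u ∈ ids')
    (hts : side t = side s) (hz' : evalLetter (side t') z' = 1) (ha : π t ∈ ids')
    (hχ' : IsAdmissible R V pos M m (rejoin π t t') ids' χ') :
    ∃ χ, IsAdmissible R V pos M m π ids χ ∧
      turnSum R.act side χ' h₀ (X ++ (y * z, s) :: Y) + 2 ≤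
        turnSum R.act side χ h₀ (X ++ (y, t) :: (z', t') :: (z, s) :: Y) := by
  classical
  obtain ⟨c, hc, hle⟩ := exists_turnSum_update (act := R.act) (side := side) χ' (π t) h₀
    (X ++ (y * z, s) :: Y)
  obtain ⟨hab, hba⟩ := rejoin_partner (t := t) (t' := t') h.invol h.ne
  have hne : ∀ u ∈ ids', u ≠ t ∧ u ≠ t' := fun u hu =>
    ⟨fun h' => h.left_notMem (h' ▸ hu), fun h' => h.right_notMem (h' ▸ hu)⟩
  have hVt : ∀ u, u ∈ ids' → u ∉ V := fun u hu => h.notMem_virt u ((h.mem_iff u).2 (by tauto))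
  have hb : π t' ≠ t ∧ π t' ≠ t' ∧ π t' ≠ π t := ⟨fun h' => (hne _ ha).2 (by rw [← h', h.invol]),
    h.ne t', fun h' => h.left_ne_right (by rw [← h.invol t, ← h', h.invol])⟩
  let χ : ι → (Bool → Ω) × Bool := fun u =>
    if u = t then (c, !(χ' (π t)).2) else if u = t' then χ' (π t) else
      Function.update χ' (π t) (c, (χ' (π t)).2) u
  have hχt : χ t = (c, !(χ' (π t)).2) := by simp [χ]
  have hχt' : χ t' = χ' (π t) := by simp [χ, h.left_ne_right.symm]
  have hχu : ∀ u, u ≠ t → u ≠ t' →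
      χ u = Function.update χ' (π t) (c, (χ' (π t)).2) u := by
    intro u h1 h2
    simp [χ, h1, h2]
  have hχa : χ (π t) = (c, (χ' (π t)).2) := by
    rw [hχu _ (hne _ ha).1 (hne _ ha).2, Function.update_self]
  have hχ : ∀ u, u ≠ t → u ≠ t' → u ≠ π t → χ u = χ' u := by
    intro u h1 h2 h3
    rw [hχu u h1 h2, Function.update_of_ne h3]
  refine ⟨χ, h.isAdmissible hχ' (fun u h1 h2 h3 _ => hχ u h1 h2 h3) ?_ ?_ ?_ ?_, ?_⟩
  · exact .of_pair (hVt _ ha) (by rw [hχt, hχa, Bool.not_not])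
  · refine (hχ' _ ha).congr hab.symm hχt' fun hm => ⟨?_, hχ _ hb.1 hb.2.1 hb.2.2⟩
    have := (h.mem_iff _).1 hm
    tauto
  · intro _
    refine .of_pair ?_ (by rw [h.invol, hχt, hχa])
    rw [h.invol]
    exact h.notMem_virt _ ((h.mem_iff _).2 (by simp))
  · intro hm
    refine .of_pair ?_ ?_
    · rw [h.invol]
      exact h.notMem_virt _ ((h.mem_iff _).2 (by simp))
    · rw [h.invol, hχt', hχ _ hb.1 hb.2.1 hb.2.2, ← hba]
      exact (hχ' _ hm).pair (hba ▸ ha)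
  · refine le_trans ?_ (turnSum_cap (R.act_eq_one _ _ hz') hts ?_ ?_)
    · have hc : ∀ u ∈ ids', Function.update χ' (π t) (c, (χ' (π t)).2) u = χ u := fun u hu =>
        (hχu u (hne u hu).1 (hne u hu).2).symm
      exact Nat.add_le_add_right (hle.trans_eq (turnSum_congr (hc _ (hids' _ (Or.inl rfl)))
        fun u hu => hc u (hids' u (Or.inr hu)))) 2
    · simp [hχt, hχt']
    · intro b
      have := hc b
      rw [hχt, hχt']
      cases h : (χ' (π t)).2 <;> simp_all

theorem IsCancellation.exists_recolour_of_right (h : IsCancellation V π ids ids' t t')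
    (hids' : ∀ u, u = h₀ ∨ u ∈ (X ++ (y * z, s) :: Y).map Prod.snd → u ∈ ids')
    (hts : side t = side s) (hz' : evalLetter (side t') z' = 1) (hb : π t' ∈ ids')
    (hχ' : IsAdmissible R V pos M m (rejoin π t t') ids' χ') :
    ∃ χ, IsAdmissible R V pos M m π ids χ ∧
      turnSum R.act side χ' h₀ (X ++ (y * z, s) :: Y) + 2 ≤
        turnSum R.act side χ h₀ (X ++ (y, t) :: (z', t') :: (z, s) :: Y) := by
  classical
  obtain ⟨c, hc, hle⟩ := exists_turnSum_update (act := R.act) (side := side) χ' (π t') h₀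
    (X ++ (y * z, s) :: Y)
  obtain ⟨hab, hba⟩ := rejoin_partner (t := t) (t' := t') h.invol h.ne
  have hne : ∀ u ∈ ids', u ≠ t ∧ u ≠ t' := fun u hu =>
    ⟨fun h' => h.left_notMem (h' ▸ hu), fun h' => h.right_notMem (h' ▸ hu)⟩
  have hVt : ∀ u, u ∈ ids' → u ∉ V := fun u hu => h.notMem_virt u ((h.mem_iff u).2 (by tauto))
  have ha : π t ≠ t ∧ π t ≠ t' ∧ π t ≠ π t' := ⟨h.ne t,
    fun h' => (hne _ hb).1 (by rw [← h', h.invol]),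
    fun h' => h.left_ne_right (by rw [← h.invol t, h', h.invol])⟩
  let χ : ι → (Bool → Ω) × Bool := fun u =>
    if u = t then χ' (π t') else if u = t' then (c, !(χ' (π t')).2) else
      Function.update χ' (π t') (c, (χ' (π t')).2) u
  have hχt : χ t = χ' (π t') := by simp [χ]
  have hχt' : χ t' = (c, !(χ' (π t')).2) := by simp [χ, h.left_ne_right.symm]
  have hχu : ∀ u, u ≠ t → u ≠ t' →
      χ u = Function.update χ' (π t') (c, (χ' (π t')).2) u := by
    intro u h1 h2
    simp [χ, h1, h2]
  have hχb : χ (π t') = (c, (χ' (π t')).2) := by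
    rw [hχu _ (hne _ hb).1 (hne _ hb).2, Function.update_self]
  have hχ : ∀ u, u ≠ t → u ≠ t' → u ≠ π t' → χ u = χ' u := by
    intro u h1 h2 h3
    rw [hχu u h1 h2, Function.update_of_ne h3]
  refine ⟨χ, h.isAdmissible hχ' (fun u h1 h2 _ h3 => hχ u h1 h2 h3) ?_ ?_ ?_ ?_, ?_⟩
  · refine (hχ' _ hb).congr hba.symm hχt fun hm => ⟨?_, hχ _ ha.1 ha.2.1 ha.2.2⟩
    have := (h.mem_iff _).1 hm
    tauto
  · exact .of_pair (hVt _ hb) (by rw [hχt', hχb, Bool.not_not])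
  · intro hm
    refine .of_pair ?_ ?_
    · rw [h.invol]
      exact h.notMem_virt _ ((h.mem_iff _).2 (by simp))
    · rw [h.invol, hχt, hχ _ ha.1 ha.2.1 ha.2.2, ← hab]
      exact (hχ' _ hm).pair (hab ▸ hb)
  · intro _
    refine .of_pair ?_ (by rw [h.invol, hχt', hχb])
    rw [h.invol]
    exact h.notMem_virt _ ((h.mem_iff _).2 (by simp))
  · refine le_trans ?_ (turnSum_cap (R.act_eq_one _ _ hz') hts ?_ ?_)
    · have hc : ∀ u ∈ ids', Function.update χ' (π t') (c, (χ' (π t')).2) u = χ u := fun u hu =>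
        (hχu u (hne u hu).1 (hne u hu).2).symm
      exact Nat.add_le_add_right (hle.trans_eq (turnSum_congr (hc _ (hids' _ (Or.inl rfl)))
        fun u hu => hc u (hids' u (Or.inr hu)))) 2
    · simp [hχt, hχt']
    · intro b
      have := hc b
      rw [hχt, hχt']
      cases h : (χ' (π t')).2 <;> simp_all

theorem IsCancellation.exists_recolour_of_virt (h : IsCancellation V π ids ids' t t')
    (hR : IsExtremal R M m) (hpos : ∀ u ∈ V, pos u < p)
    (hids' : ∀ u, u = h₀ ∨ u ∈ (X ++ (y * z, s) :: Y).map Prod.snd → u ∈ ids')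
    (hts : side t = side s) (hz' : evalLetter (side t') z' = 1) (ha : π t ∈ V) (hb : π t' ∈ V)
    (hab : pos (π t) ≠ pos (π t')) (hχ' : IsAdmissible R V pos M m (rejoin π t t') ids' χ') :
    ∃ χ, IsAdmissible R V pos M m π ids χ ∧
      turnSum R.act side χ' h₀ (X ++ (y * z, s) :: Y) + 2 ≤
        turnSum R.act side χ h₀ (X ++ (y, t) :: (z', t') :: (z, s) :: Y) := by
  classical
  have hne : ∀ u ∈ ids', u ≠ t ∧ u ≠ t' := fun u hu =>
    ⟨fun h' => h.left_notMem (h' ▸ hu), fun h' => h.right_notMem (h' ▸ hu)⟩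
  have hVt : ∀ u ∈ V, u ∉ ids := fun u hu hu' => h.notMem_virt u hu' hu
  have hVt' : ∀ u ∈ V, u ∉ ids' := fun u hu hu' => hVt u hu ((h.mem_iff u).2 (by tauto))
  obtain ⟨D, hD, h1, h2, h3, h4⟩ := hR.exists_dir (hpos _ ha) (hpos _ hb) hab
  let χ : ι → (Bool → Ω) × Bool := fun u =>
    if u = t then (fun b => R.height b (pos (π t)), D) else
    if u = t' then (fun b => R.height b (pos (π t')), !D) else χ' u
  have hχt : χ t = (fun b => R.height b (pos (π t)), D) := by simp [χ]
  have hχt' : χ t' = (fun b => R.height b (pos (π t')), !D) := by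
    simp [χ, h.left_ne_right.symm]
  have hχ : ∀ u, u ≠ t → u ≠ t' → χ u = χ' u := by
    intro u h1 h2
    simp [χ, h1, h2]
  refine ⟨χ, h.isAdmissible hχ' (fun u h1 h2 _ _ => hχ u h1 h2) ?_ ?_ ?_ ?_, ?_⟩
  · exact ⟨fun h' => (hVt _ ha h').elim, fun _ b => by rw [hχt], fun _ h' => by rw [hχt, h1 h'],
      fun _ h' => by rw [hχt, h2 h']⟩
  · exact ⟨fun h' => (hVt _ hb h').elim, fun _ b => by rw [hχt'],
      fun _ h' => by rw [hχt', h3 h']; rfl, fun _ h' => by rw [hχt', h4 h']; rfl⟩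
  · exact fun h' => (hVt' _ ha h').elim
  · exact fun h' => (hVt' _ hb h').elim
  · refine le_trans ?_ (turnSum_cap (R.act_eq_one _ _ hz') hts ?_ ?_)
    · have hc : ∀ u ∈ ids', χ' u = χ u := fun u hu => (hχ u (hne u hu).1 (hne u hu).2).symm
      exact (Nat.add_le_add_right (turnSum_congr (hc _ (hids' _ (Or.inl rfl)))
        fun u hu => hc u (hids' u (Or.inr hu))).le 2)
    · simp [hχt, hχt']
    · intro b
      rw [hχt, hχt']
      exact hD b

end Recolour

set_option maxHeartbeats 1000000 in
/-- Cancelling two tokens separated by a trivial letter preserves tightness. -/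
theorem IsTightWord.cancel [DenselyOrdered Ω] [NoMinOrder Ω] [NoMaxOrder Ω] {π : ι → ι} {h₀ : ι}
    {X Y : List ((A × B) × ι)} {t t' s : ι} {y z z' : A × B} (hR : IsExtremal R M m)
    (hpos : ∀ u ∈ V, pos u < p) (hE : ∀ i b, E i (!b) = (E i b)⁻¹) (hT : 1 ∉ T)
    (h : IsTightWord R side V pos M m E T π h₀ (X ++ (y, t) :: (z', t') :: (z, s) :: Y))
    (hz' : evalLetter (side t') z' = 1) (ht : t ≠ h₀) (ht' : t' ≠ h₀) :
    IsTightWord R side V pos M m E T (rejoin π t t') h₀ (X ++ (y * z, s) :: Y) := by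
  classical
  have hne : ∀ u, π u ≠ u := fun u hu => by
    have := h.side_pair u
    rw [hu] at this
    exact (Bool.eq_not_self _).1 this
  have hnd := h.nodup
  simp only [List.map_append, List.map_cons, List.nodup_append, List.nodup_cons, List.mem_cons,
    not_or, forall_eq_or_imp, ne_eq] at hnd
  have hmem : ∀ u, u ∈ (X ++ (y, t) :: (z', t') :: (z, s) :: Y).map Prod.snd ↔
      u = t ∨ u = t' ∨ u ∈ (X ++ (y * z, s) :: Y).map Prod.snd := by
    intro u
    simp only [List.map_append, List.map_cons, List.mem_append, List.mem_cons]
    tauto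
  have hc : IsCancellation V π ((X ++ (y, t) :: (z', t') :: (z, s) :: Y).map Prod.snd)
      ((X ++ (y * z, s) :: Y).map Prod.snd) t t' := by
    refine ⟨h.invol, hne, hmem, ?_, ?_, ?_, h.not_virt⟩
    · simp only [List.map_append, List.map_cons, List.mem_append, List.mem_cons]
      grind
    · simp only [List.map_append, List.map_cons, List.mem_append, List.mem_cons]
      grind
    · exact hnd.2.1.1.1
  obtain ⟨hab, hba⟩ := rejoin_partner (t := t) (t' := t') h.invol hne
  have hh₀ : h₀ ∈ (X ++ (y * z, s) :: Y).map Prod.snd := by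
    exact (((hmem h₀).1 h.last_mem).resolve_left ht.symm).resolve_left ht'.symm
  have hrej : ∀ u, u ≠ t → u ≠ t' → (rejoin π t t' u = π u ∧ π u ≠ t ∧ π u ≠ t') ∨
      (u = π t ∧ rejoin π t t' u = π t') ∨ (u = π t' ∧ rejoin π t t' u = π t) := by
    intro u h1 h2
    by_cases h3 : u = π t
    · exact Or.inr (Or.inl ⟨h3, h3 ▸ hab⟩)
    by_cases h4 : u = π t'
    · exact Or.inr (Or.inr ⟨h4, h4 ▸ hba⟩)
    exact Or.inl ⟨rejoin_of_ne h1 h2 h3 h4, fun h' => h3 (by rw [← h', h.invol]),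
      fun h' => h4 (by rw [← h', h.invol])⟩
  have hch := h.chain
  have hcha : (h₀ :: X.map Prod.snd ++ [t]).IsChain (fun u v => side u ≠ side v) ∧
      side t ≠ side t' ∧ side t' ≠ side s ∧
      (s :: Y.map Prod.snd).IsChain (fun u v => side u ≠ side v) := by
    simp only [List.map_append, List.map_cons] at hch
    rw [← List.cons_append, List.isChain_append_cons_cons, List.isChain_cons_cons] at hch
    exact hch
  have hts : side t = side s := by
    rw [Bool.eq_not.2 hcha.2.1, Bool.eq_not.2 hcha.2.2.1.symm]
  have hidsne : ∀ u ∈ (X ++ (y * z, s) :: Y).map Prod.snd, u ≠ t ∧ u ≠ t' := fun u hu =>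
    ⟨fun h' => hc.left_notMem (h' ▸ hu), fun h' => hc.right_notMem (h' ▸ hu)⟩
  have hidsmem : ∀ u ∈ (X ++ (y * z, s) :: Y).map Prod.snd,
      u ∈ (X ++ (y, t) :: (z', t') :: (z, s) :: Y).map Prod.snd := fun u hu =>
    (hmem u).2 (Or.inr (Or.inr hu))
  have hmemt := (hmem t).2 (Or.inl rfl)
  have hmemt' := (hmem t').2 (Or.inr (Or.inl rfl))
  have hmem' : ∀ u, u ∈ (X ++ (y, t) :: (z', t') :: (z, s) :: Y).map Prod.snd → u ≠ t → u ≠ t' →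
      u ∈ (X ++ (y * z, s) :: Y).map Prod.snd := fun u hu h1 h2 =>
    (((hmem u).1 hu).resolve_left h1).resolve_left h2
  have hprod : ∀ ins : ι → Monoid.Coprod A B, ins t * ins t' = 1 →
      tokenProd side ins (X ++ (y, t) :: (z', t') :: (z, s) :: Y) =
        tokenProd side ins (X ++ (y * z, s) :: Y) := by
    intro ins hins
    simp only [tokenProd_append, tokenProd_cons, hz', hts, map_mul, one_mul]
    rw [mul_assoc (evalLetter (side s) y), ← mul_assoc (ins t) (ins t'), hins]
    simp only [mul_assoc, one_mul]
  refine ⟨?_, hh₀, ?_, ?_, fun u hu => h.not_virt u (hidsmem u hu), ?_,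
    rejoin_rejoin h.invol hne, ?_, ?_, ?_, ?_, ?_⟩
  · refine h.nodup.sublist ?_
    simp
  · simpa [lastToken_append, lastToken] using h.last
  · rcases hrej h₀ ht.symm ht'.symm with h1 | h1 | h1
    · rw [h1.1]
      exact h.head_virt
    · have := h.head_virt
      rw [h1.1, h.invol] at this
      exact (h.not_virt t hmemt this).elim
    · have := h.head_virt
      rw [h1.1, h.invol] at this
      exact (h.not_virt t' hmemt' this).elim
  · intro u hu
    rcases hrej u (hidsne u hu).1 (hidsne u hu).2 with h1 | h1 | h1
    · rw [h1.1]
      exact (h.pair u (hidsmem u hu)).imp_right fun h2 => hmem' _ h2 h1.2.1 h1.2.2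
    · rw [h1.2]
      exact (h.pair t' hmemt').imp_right fun h2 => hmem' _ h2
        (fun h' => (hidsne u hu).2 (by rw [h1.1, ← h', h.invol])) (hne t')
    · rw [h1.2]
      exact (h.pair t hmemt).imp_right fun h2 => hmem' _ h2 (hne t)
        (fun h' => (hidsne u hu).1 (by rw [h1.1, ← h', h.invol]))
  · have hs : side t' = !side t := Bool.eq_not.2 hcha.2.1.symm
    intro u
    by_cases h1 : u = t
    · simp [rejoin, h1, hs]
    by_cases h2 : u = t'
    · simp [rejoin, h2, hs, hc.left_ne_right.symm]
    rcases hrej u h1 h2 with h3 | h3 | h3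
    · rw [h3.1, h.side_pair]
    · rw [h3.2, h3.1, h.side_pair, h.side_pair, hs]
    · rw [h3.2, h3.1, h.side_pair, h.side_pair, hs, Bool.not_not]
  · rw [List.map_append, List.map_cons, ← List.cons_append, List.isChain_split]
    refine ⟨?_, hcha.2.2.2⟩
    have h1 := (List.isChain_map (R := (· ≠ ·)) side).2 hcha.1
    refine (List.isChain_map (R := (· ≠ ·)) side).1 ?_
    simpa [hts] using h1
  · rw [← hprod 1 (by simp)]
    exact h.tokenProd_eq_one
  · intro χ' hχ'
    have hids' : ∀ u, u = h₀ ∨ u ∈ (X ++ (y * z, s) :: Y).map Prod.snd →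
        u ∈ (X ++ (y * z, s) :: Y).map Prod.snd := by
      rintro u (rfl | hu)
      exacts [hh₀, hu]
    obtain ⟨χ, hχ, hle⟩ : ∃ χ, IsAdmissible R V pos M m π
        ((X ++ (y, t) :: (z', t') :: (z, s) :: Y).map Prod.snd) χ ∧
        turnSum R.act side χ' h₀ (X ++ (y * z, s) :: Y) + 2 ≤
          turnSum R.act side χ h₀ (X ++ (y, t) :: (z', t') :: (z, s) :: Y) := by
      by_cases hpair : π t = t'
      · exact hc.exists_recolour_of_pair hids' hts hpair hχ'
      by_cases ha : π t ∈ V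
      · by_cases hb : π t' ∈ V
        · exact hc.exists_recolour_of_virt hR hpos hids' hts hz' ha hb
            (h.pos_ne hE hT hz' ha hb) hχ'
        · refine hc.exists_recolour_of_right hids' hts hz' ?_ hχ'
          exact hmem' _ ((h.pair t' hmemt').resolve_left hb)
            (fun h' => hpair (by rw [← h', h.invol])) (hne t')
      · refine hc.exists_recolour_of_left hids' hts hz' ?_ hχ'
        exact hmem' _ ((h.pair t hmemt).resolve_left ha) (hne t) hpair
    have := h.bound χ hχ
    simp only [List.length_append, List.length_cons] at this ⊢
    omega
  · intro v hv v' hv' hvm hvm' hvv' hvs ins hins hins1 hinsv hinsv'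
    let ins' : ι → Monoid.Coprod A B := fun u =>
      if u = t then ins (π t') else if u = t' then ins (π t) else ins u
    have hVne : ∀ u ∈ V, u ≠ t ∧ u ≠ t' := fun u hu =>
      ⟨fun h' => h.not_virt t hmemt (h' ▸ hu), fun h' => h.not_virt t' hmemt' (h' ▸ hu)⟩
    have hins't : ins' t = ins (π t') := by simp [ins']
    have hins't' : ins' t' = ins (π t) := by simp [ins', hc.left_ne_right.symm]
    have hins'u : ∀ u, u ≠ t → u ≠ t' → ins' u = ins u := fun u h1 h2 => by simp [ins', h1, h2]
    have hinsab : ins (π t') = (ins (π t))⁻¹ := by rw [← hins, hab]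
    have hmemπ : ∀ u ∈ V, rejoin π t t' u ∈ (X ++ (y * z, s) :: Y).map Prod.snd →
        π u ∈ (X ++ (y, t) :: (z', t') :: (z, s) :: Y).map Prod.snd := by
      intro u hu hu'
      rcases hrej u (hVne u hu).1 (hVne u hu).2 with h1 | h1 | h1
      · exact h1.1 ▸ hidsmem _ hu'
      · rw [h1.1, h.invol]
        exact hmemt
      · rw [h1.1, h.invol]
        exact hmemt'
    have := h.insert v hv v' hv' (hmemπ v hv hvm) (hmemπ v' hv' hvm') hvv' hvs ins' ?_
      (fun u hu h1 h2 => by rw [hins'u u (hVne u hu).1 (hVne u hu).2, hins1 u hu h1 h2])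
      (by rw [hins'u v (hVne v hv).1 (hVne v hv).2, hinsv])
      (by rw [hins'u v' (hVne v' hv').1 (hVne v' hv').2, hinsv'])
    · rw [hprod ins' (by rw [hins't, hins't', hinsab, inv_mul_cancel])] at this
      rwa [tokenProd_congr fun u hu => hins'u u (hidsne u hu).1 (hidsne u hu).2] at this
    · have key : ∀ u, u ≠ t → u ≠ t' → ins' (π u) = (ins' u)⁻¹ := by
        intro u h1 h2
        rw [hins'u u h1 h2]
        rcases hrej u h1 h2 with h3 | h3 | h3
        · rw [hins'u _ h3.2.1 h3.2.2, ← h3.1, hins]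
        · rw [h3.1, h.invol, hins't, hinsab]
        · rw [h3.1, h.invol, hins't', hinsab, inv_inv]
      intro u
      by_cases hpair : π t = t'
      · have hpair' : π t' = t := by rw [← hpair, h.invol]
        by_cases h1 : u = t
        · rw [h1, hpair, hins't, hins't', hinsab, inv_inv]
        by_cases h2 : u = t'
        · rw [h2, hpair', hins't, hins't', hinsab]
        exact key u h1 h2
      · by_cases h1 : u = t
        · have := key (π t) (hne t) hpair
          rw [h.invol] at this
          rw [h1, this, inv_inv]
        by_cases h2 : u = t'
        · have := key (π t') (fun h' => hpair (by rw [← h', h.invol])) (hne t')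
          rw [h.invol] at this
          rw [h2, this, inv_inv]
        exact key u h1 h2

theorem tokenProd_one_ne_one {l : List ((A × B) × ι)} (hl : l ≠ [])
    (hchain : (l.map Prod.snd).IsChain fun u v => side u ≠ side v)
    (hne : ∀ e ∈ l, evalLetter (side e.2) e.1 ≠ 1) : tokenProd side 1 l ≠ 1 := by
  have := prod_evalLetter_ne_one (l := l.map fun e => (side e.2, e.1)) (by simpa using hl)
    (by rw [List.isChain_map] at hchain ⊢; exact hchain) (by
      intro y hy
      obtain ⟨e, he, rfl⟩ := List.mem_map.1 hy
      exact hne e he)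
  simpa [tokenProd, Function.comp_def] using this

theorem not_isTightWord_pair [DenselyOrdered Ω] [NoMinOrder Ω] [NoMaxOrder Ω] {π : ι → ι}
    {h₀ t : ι} {z z₀ : A × B} (hR : IsExtremal R M m) (hpos : ∀ u ∈ V, pos u < p)
    (hE : ∀ i b, E i (!b) = (E i b)⁻¹) (hT : 1 ∉ T) :
    ¬ IsTightWord R side V pos M m E T π h₀ [(z, t), (z₀, h₀)] := by
  classical
  intro h
  have hchain := h.chain
  have hth : side t ≠ side h₀ := (by simpa using hchain : _ ∧ side t ≠ side h₀).2
  have hprod := h.tokenProd_eq_one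
  obtain ⟨hz, hz₀⟩ : evalLetter (side t) z = 1 ∧ evalLetter (side h₀) z₀ = 1 := by
    by_contra hcon
    refine tokenProd_one_ne_one (by simp) (by simpa using hth) ?_ hprod
    simp only [tokenProd, List.map_cons, List.map_nil, List.prod_cons, List.prod_nil,
      Pi.one_apply, mul_one] at hprod
    have h1 : evalLetter (side t) z ≠ 1 := fun h1 => hcon ⟨h1, by simpa [h1] using hprod⟩
    have h2 : evalLetter (side h₀) z₀ ≠ 1 := fun h2 => hcon ⟨by simpa [h2] using hprod, h2⟩
    simp [h1, h2]
  have hne : t ≠ h₀ := fun h => hth (h ▸ rfl)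
  have htV : t ∉ V := h.not_virt t (by simp)
  have ha : π t ∈ V := by
    refine (h.pair t (by simp)).resolve_right fun h' => ?_
    simp only [List.map_cons, List.map_nil, List.mem_cons, List.not_mem_nil, or_false] at h'
    rcases h' with h' | h'
    · have := h.side_pair t
      rw [h'] at this
      exact (Bool.eq_not_self _).1 this
    · have := h.head_virt
      rw [← h', h.invol] at this
      exact htV this
  obtain ⟨D, hD, h1, h2, h3, h4⟩ := hR.exists_dir (hpos _ ha) (hpos _ h.head_virt)
    (h.pos_ne (X := []) (Y := []) hE hT hz₀ ha h.head_virt)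
  let χ : ι → (Bool → Ω) × Bool := fun u =>
    if u = t then (fun b => R.height b (pos (π t)), D) else
      (fun b => R.height b (pos (π h₀)), !D)
  have hχt : χ t = (fun b => R.height b (pos (π t)), D) := by simp [χ]
  have hχh : χ h₀ = (fun b => R.height b (pos (π h₀)), !D) := by simp [χ, hne.symm]
  have hVt : ∀ u ∈ V, u ∉ [(z, t), (z₀, h₀)].map Prod.snd := fun u hu hu' => h.not_virt u hu' hu
  have hb := h.bound χ (by
    intro u hu
    simp only [List.map_cons, List.map_nil, List.mem_cons, List.not_mem_nil, or_false] at hu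
    rcases hu with rfl | rfl
    · exact ⟨fun h' => (hVt _ ha h').elim, fun _ b => by rw [hχt],
        fun _ h' => by rw [hχt, h1 h'], fun _ h' => by rw [hχt, h2 h']⟩
    · exact ⟨fun h' => (hVt _ h.head_virt h').elim, fun _ b => by rw [hχh],
        fun _ h' => by rw [hχh, h3 h']; rfl, fun _ h' => by rw [hχh, h4 h']; rfl⟩)
  have e1 : tokenTurn R.act side χ h₀ z t = 2 := by
    unfold tokenTurn
    rw [R.act_eq_one _ _ hz, hχt, hχh, Bool.not_not]
    exact turn_eq_two (hD (side t))
  have e2 : tokenTurn R.act side χ t z₀ h₀ = 2 := by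
    unfold tokenTurn
    rw [R.act_eq_one _ _ hz₀, hχt, hχh]
    refine turn_eq_two ?_
    have := hD (side h₀)
    cases D <;> simpa using this
  simp [turnSum, e1, e2] at hb

/-- There are no tight words. -/
theorem not_isTightWord [DenselyOrdered Ω] [NoMinOrder Ω] [NoMaxOrder Ω] {π : ι → ι} {h₀ : ι}
    {l : List ((A × B) × ι)} (hR : IsExtremal R M m) (hpos : ∀ u ∈ V, pos u < p)
    (hE : ∀ i b, E i (!b) = (E i b)⁻¹) (hT : 1 ∉ T) :
    ¬ IsTightWord R side V pos M m E T π h₀ l := by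
  induction hn : l.length using Nat.strong_induction_on generalizing π l with
  | _ n ih =>
  subst hn
  intro h
  rcases List.eq_nil_or_concat' l with rfl | ⟨l', ⟨z₀, u₀⟩, rfl⟩
  · simpa using h.last_mem
  obtain rfl : u₀ = h₀ := by simpa [lastToken_append, lastToken] using h.last
  rcases l' with - | ⟨⟨z, t⟩, l'⟩
  · have := h.chain
    simp at this
  rcases eq_or_ne l' [] with rfl | hl'
  · exact not_isTightWord_pair hR hpos hE hT h
  by_cases htriv : ∃ e ∈ l', evalLetter (side e.2) e.1 = 1
  · obtain ⟨⟨z', t'⟩, hmem, hz'⟩ := htriv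
    obtain ⟨X', Y', rfl⟩ := List.append_of_mem hmem
    obtain ⟨X, ⟨y, a⟩, hX⟩ : ∃ X e, (z, t) :: X' = X ++ [e] := by
      rcases List.eq_nil_or_concat' ((z, t) :: X') with h | ⟨X, e, h⟩
      · simp at h
      · exact ⟨X, e, h⟩
    obtain ⟨⟨w, s⟩, Y, hY⟩ : ∃ e Y, Y' ++ [(z₀, u₀)] = e :: Y := by
      cases Y' with
      | nil => exact ⟨_, _, rfl⟩
      | cons e Y' => exact ⟨_, _, rfl⟩
    have hl : (z, t) :: (X' ++ (z', t') :: Y') ++ [(z₀, u₀)] =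
        X ++ (y, a) :: (z', t') :: (w, s) :: Y := by
      rw [← List.cons_append, hX]
      simp [hY]
    have hnd := h.nodup
    have ha : a ≠ u₀ := by
      have h1 : a ∈ ((z, t) :: X').map Prod.snd := by simp [hX]
      rintro rfl
      rw [← List.cons_append, List.append_assoc, List.map_append, List.nodup_append] at hnd
      exact hnd.2.2 a h1 a (by simp) rfl
    have ht' : t' ≠ u₀ := by
      rintro rfl
      rw [← List.cons_append, List.append_assoc, List.map_append, List.nodup_append,
        List.cons_append] at hnd
      exact (List.nodup_cons.1 hnd.2.1).1 (by simp)
    rw [hl] at h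
    refine ih _ ?_ rfl (h.cancel hR hpos hE hT hz' ha ht')
    rw [hl]
    simp
  · push Not at htriv
    have hchain := h.chain.tail
    have hprod := h.tokenProd_eq_one
    by_cases h1 : evalLetter (side t) z = 1 <;> by_cases h2 : evalLetter (side u₀) z₀ = 1
    · refine tokenProd_one_ne_one (side := side) hl' ?_ htriv ?_
      · simp only [List.tail_cons, List.map_append, List.map_cons] at hchain
        exact hchain.tail.left_of_append
      · simpa [tokenProd, h1, h2] using hprod
    · refine tokenProd_one_ne_one (side := side) (l := l' ++ [(z₀, u₀)]) (by simp) ?_ ?_ ?_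
      · simp only [List.tail_cons, List.map_append, List.map_cons] at hchain ⊢
        exact hchain.tail
      · intro e he
        rcases List.mem_append.1 he with he | he
        · exact htriv e he
        · simp only [List.mem_singleton] at he
          exact he ▸ h2
      · simpa [tokenProd, h1] using hprod
    · refine tokenProd_one_ne_one (side := side) (l := (z, t) :: l') (by simp) ?_ ?_ ?_
      · simp only [List.tail_cons, List.map_append, List.map_cons] at hchain ⊢
        exact hchain.left_of_append
      · intro e he
        rcases List.mem_cons.1 he with he | he
        · exact he ▸ h1
        · exact htriv e he
      · simpa [tokenProd, h2] using hprod
    · refine tokenProd_one_ne_one (side := side) (by simp) hchain ?_ hprod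
      intro e he
      rcases List.mem_append.1 he with he | he
      · rcases List.mem_cons.1 he with he | he
        · exact he ▸ h1
        · exact htriv e he
      · simp only [List.mem_singleton] at he
        exact he ▸ h2

end Core

section Profile

theorem sum_shift_of_periodic {σ : ℕ → ℤ} {p : ℕ} (hσ : ∀ k, σ (k + p) = σ k) (t : ℕ) :
    ∑ k ∈ Finset.range p, σ (t + k) = ∑ k ∈ Finset.range p, σ k := by
  induction t with
  | zero => simp
  | succ t ih =>
    have h1 := Finset.sum_range_succ (fun k => σ (t + k)) p
    have h2 := Finset.sum_range_succ' (fun k => σ (t + k)) p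
    rw [hσ] at h1
    simp only [add_zero] at h2
    rw [← ih]
    have h3 : ∑ k ∈ Finset.range p, σ (t + 1 + k) = ∑ k ∈ Finset.range p, σ (t + (k + 1)) :=
      Finset.sum_congr rfl fun k _ => by congr 1; ring
    linarith

theorem exists_reflected_walk {σ : ℕ → ℤ} {p : ℕ} (hp : 0 < p) (hσ : ∀ k, σ (k + p) = σ k)
    (hsum : 0 ≤ ∑ k ∈ Finset.range p, σ k) :
    ∃ q : ℕ → ℤ, (∀ k, q (k + p) = q k) ∧ ∀ k, q k = max 0 (q (k + 1) - σ (k + 1)) := by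
  let F : ℕ → ℕ → ℤ := fun t d => ∑ k ∈ Finset.range d, σ (t + 1 + k)
  have hne : (Finset.range (p + 1)).Nonempty := ⟨0, by simp⟩
  refine ⟨fun t => (Finset.range (p + 1)).sup' hne fun d => -F t d, fun k => ?_, fun t => ?_⟩
  · refine Finset.sup'_congr hne rfl fun d _ => ?_
    simp only [F]
    congr 1
    refine Finset.sum_congr rfl fun j _ => ?_
    rw [show k + p + 1 + j = k + 1 + j + p by ring, hσ]
  · have hF : ∀ d, F t (d + 1) = σ (t + 1) + F (t + 1) d := fun d => by
      simp only [F, Finset.sum_range_succ', add_zero]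
      rw [add_comm]
      congr 1
      exact Finset.sum_congr rfl fun k _ => by congr 1; ring
    have hle : ∀ t d, d ≤ p → -F t d ≤ (Finset.range (p + 1)).sup' hne fun d => -F t d :=
      fun t d hd => Finset.le_sup' (fun d => -F t d) (by simp; omega)
    have hFp : 0 ≤ F (t + 1) p := by
      simp only [F]; rw [sum_shift_of_periodic hσ]; exact hsum
    apply le_antisymm
    · refine Finset.sup'_le hne _ fun d hd => ?_
      rcases d with _ | d
      · simp [F]
      · refine le_max_of_le_right ?_
        rw [hF]
        have := hle (t + 1) d (by simp at hd; omega)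
        linarith
    · refine max_le (by simpa [F] using hle t 0 (by omega)) ?_
      obtain ⟨d, hd, hd'⟩ := Finset.exists_mem_eq_sup' hne fun d => -F (t + 1) d
      change (Finset.range (p + 1)).sup' hne (fun d => -F (t + 1) d) - σ (t + 1) ≤
        (Finset.range (p + 1)).sup' hne fun d => -F t d
      rw [hd']
      rcases Nat.lt_or_ge d p with h | h
      · have := hle t (d + 1) (by omega)
        rw [hF] at this
        linarith
      · obtain rfl : d = p := by simp at hd; omega
        have := hle t 1 (by omega)
        have h1 : F t 1 = σ (t + 1) := by simp [F]
        linarith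

theorem parity_succ (k : ℕ) : parity (k + 1) = !parity k := by simp [parity]

theorem parity_add_even {p : ℕ} (hp : Even p) (k : ℕ) : parity (k + p) = parity k := by
  obtain ⟨r, rfl⟩ := hp
  simp [parity]

/-- Levels for the letters of a cyclic word with prescribed signs: consecutive levels differ by
one, and the direction of a step is determined by the sign and by the half line it ends in. -/
theorem exists_levels {σ : ℕ → ℤ} {p : ℕ} (hp : 0 < p) (hpe : Even p)
    (hσ : ∀ k, σ (k + p) = σ k) (hσ1 : ∀ k, σ k = 1 ∨ σ k = -1)
    (hsum : 0 ≤ ∑ k ∈ Finset.range p, σ k) :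
    ∃ n : ℕ → ℤ, (∀ k, n (k + p) = n k) ∧ (∀ k, Even (n k) ↔ parity k = true) ∧
      ∀ k, (n (k + 1) = n k + 1 ∧ (n (k + 1) ≤ 0 ↔ σ (k + 1) = -1)) ∨
        (n (k + 1) = n k - 1 ∧ (n (k + 1) ≤ 0 ↔ σ (k + 1) = 1)) := by
  obtain ⟨q, hq, hq'⟩ := exists_reflected_walk hp hσ hsum
  refine ⟨fun t => if (Even (q t) ↔ parity t = true) then -q t else 1 + q t, fun k => ?_,
    fun k => ?_, fun k => ?_⟩
  · simp only [hq, parity_add_even hpe]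
  · dsimp only
    split_ifs with h
    · rwa [even_neg]
    · rw [Int.even_add]
      simp only [Int.not_even_one, false_iff]
      tauto
  · have h0 : q k = 0 ∧ q (k + 1) - σ (k + 1) ≤ 0 ∨
        q k = q (k + 1) - σ (k + 1) ∧ 0 ≤ q (k + 1) - σ (k + 1) := by
      rw [hq' k]
      grind
    have h1 : 0 ≤ q (k + 1) := hq' (k + 1) ▸ le_max_left _ _
    have hnot : ∀ b : Bool, ((!b) = true) ↔ ¬ (b = true) := by simp
    simp only [parity_succ, Int.even_iff, hnot]
    generalize q k = a at *
    generalize q (k + 1) = c at *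
    have hs := hσ1 (k + 1)
    generalize σ (k + 1) = s at *
    clear hnot hσ hσ1 hq hq' hsum
    by_cases hb : parity k = true <;>
      simp only [hb, not_true_eq_false, iff_true, iff_false] <;>
      rcases hs with rfl | rfl <;> norm_num at * <;> split_ifs <;> grind
end Profile

section Lexicographic

theorem mulLeftStrictMono_lexProd {P Q : Type*} [Group P] [Group Q] [LinearOrder P]
    [LinearOrder Q] [MulLeftStrictMono P] [MulLeftStrictMono Q] :
    MulLeftStrictMono (P ×ₗ Q) := by
  constructor
  intro m a b h
  rw [Prod.Lex.lt_iff] at h ⊢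
  rcases h with h | ⟨h, h'⟩
  · exact Or.inl (mul_lt_mul_right h (ofLex m).1)
  · exact Or.inr ⟨congrArg ((ofLex m).1 * ·) h, mul_lt_mul_right h' (ofLex m).2⟩

theorem lexPi_lt_iff {X : Type*} [LinearOrder X] (a b : ℕ → X) :
    toLex a < toLex b ↔
      a 0 < b 0 ∨ a 0 = b 0 ∧ toLex (fun i => a (i + 1)) < toLex fun i => b (i + 1) := by
  constructor
  · rintro ⟨i, hi, hlt⟩
    rcases i with _ | i
    · exact Or.inl hlt
    · exact Or.inr ⟨hi 0 (Nat.succ_pos i), i, fun j hj => hi (j + 1) (Nat.succ_lt_succ hj), hlt⟩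
  · rintro (h | ⟨h, i, hi, hlt⟩)
    · exact ⟨0, fun j hj => absurd hj (Nat.not_lt_zero j), h⟩
    · refine ⟨i + 1, fun j hj => ?_, hlt⟩
      rcases j with _ | j
      · exact h
      · exact hi j (Nat.lt_of_succ_lt_succ hj)

variable {N L R K : Type*} [LinearOrder N] [LinearOrder L] [LinearOrder R] [Group K] [Group L]
  [MulLeftStrictMono L]

/-- The action on a lexicographic product which multiplies the second coordinate by an element
depending on the first coordinate. -/
def fibreAct (φ : N → K →* L) : K →* (N ×ₗ (L ×ₗ R) ≃o N ×ₗ (L ×ₗ R)) where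
  toFun k :=
    StrictMono.orderIsoOfRightInverse
      (fun z => toLex ((ofLex z).1, toLex (φ (ofLex z).1 k * (ofLex (ofLex z).2).1,
        (ofLex (ofLex z).2).2)))
      (by
        intro z z' h
        rw [Prod.Lex.lt_iff] at h ⊢
        rcases h with h | ⟨h, h'⟩
        · exact Or.inl h
        · refine Or.inr ⟨h, ?_⟩
          rw [Prod.Lex.lt_iff] at h' ⊢
          rcases h' with h' | ⟨h', h''⟩
          · left
            change φ (ofLex z).1 k * _ < φ (ofLex z').1 k * _
            rw [h]
            exact mul_lt_mul_right h' _
          · right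
            refine ⟨?_, h''⟩
            change φ (ofLex z).1 k * _ = φ (ofLex z').1 k * _
            rw [h, h'])
      (fun z => toLex ((ofLex z).1, toLex (φ (ofLex z).1 k⁻¹ * (ofLex (ofLex z).2).1,
        (ofLex (ofLex z).2).2)))
      (by
        intro z
        change toLex ((ofLex z).1, toLex (φ (ofLex z).1 k * (φ (ofLex z).1 k⁻¹ *
          (ofLex (ofLex z).2).1), (ofLex (ofLex z).2).2)) = z
        rw [← mul_assoc, ← map_mul, mul_inv_cancel, map_one, one_mul]
        rfl)
  map_one' := by
    ext z
    change toLex ((ofLex z).1, toLex (φ (ofLex z).1 1 * (ofLex (ofLex z).2).1,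
      (ofLex (ofLex z).2).2)) = z
    rw [map_one, one_mul]
    rfl
  map_mul' k k' := by
    ext z
    change toLex ((ofLex z).1, toLex (φ (ofLex z).1 (k * k') * (ofLex (ofLex z).2).1,
      (ofLex (ofLex z).2).2)) = toLex ((ofLex z).1, toLex (φ (ofLex z).1 k *
        (φ (ofLex z).1 k' * (ofLex (ofLex z).2).1), (ofLex (ofLex z).2).2))
    rw [map_mul, mul_assoc]

theorem fibreAct_apply (φ : N → K →* L) (k : K) (n : N) (l : L) (r : R) :
    fibreAct φ k (toLex (n, toLex (l, r))) = toLex (n, toLex (φ n k * l, r)) := rfl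

end Lexicographic

section Heights
variable {L : Type*} [LinearOrder L]

/-- The itinerary of a cyclic word from a given letter on. -/
def itinerary (n : ℕ → ℤ) (l : ℕ → L) (i : ℕ) : Lex (ℕ → ℤ ×ₗ L) :=
  toLex fun t => toLex (3 * n (i + t) + n (i + t + 1), l (i + t + 1))

/-- The height over the `i`-th letter, seen from the first or the second factor. -/
def levelHeight [Group L] (n : ℕ → ℤ) (l : ℕ → L) (b : Bool) (i : ℕ) :
    ℤ ×ₗ (L ×ₗ (Lex (ℕ → ℤ ×ₗ L) ×ₗ ℚ)) :=
  if parity i = b then toLex (n i, toLex (1, toLex (itinerary n l i, 0)))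
  else toLex (n (i + 1), toLex (l (i + 1), toLex (itinerary n l (i + 1), 0)))

theorem itinerary_lt_iff (n : ℕ → ℤ) (l : ℕ → L) (i j : ℕ) :
    itinerary n l i < itinerary n l j ↔
      3 * n i + n (i + 1) < 3 * n j + n (j + 1) ∨ 3 * n i + n (i + 1) = 3 * n j + n (j + 1) ∧
        (l (i + 1) < l (j + 1) ∨
          l (i + 1) = l (j + 1) ∧ itinerary n l (i + 1) < itinerary n l (j + 1)) := by
  have h : ∀ i, itinerary n l (i + 1) =
      toLex fun t => toLex (3 * n (i + (t + 1)) + n (i + (t + 1) + 1), l (i + (t + 1) + 1)) :=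
    fun i => by
      unfold itinerary
      congr 1
      funext t
      rw [show i + 1 + t = i + (t + 1) by ring]
  rw [h, h]
  unfold itinerary
  rw [lexPi_lt_iff, Prod.Lex.toLex_lt_toLex, toLex_inj, Prod.mk.injEq]
  simp only [add_zero]
  tauto

variable [Group L] {n : ℕ → ℤ} {l : ℕ → L}

theorem levelHeight_lt_iff (hpar : ∀ k, Even (n k) ↔ parity k = true)
    (hstep : ∀ k, (n (k + 1) = n k + 1 ∧ l (k + 1) < 1) ∨ (n (k + 1) = n k - 1 ∧ 1 < l (k + 1)))
    (b : Bool) (i j : ℕ) :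
    levelHeight n l b i < levelHeight n l b j ↔ itinerary n l i < itinerary n l j := by
  have hij := itinerary_lt_iff n l i j
  have pi := hpar i
  have pj := hpar j
  have si := hstep i
  have sj := hstep j
  unfold levelHeight
  rw [Int.even_iff] at pi pj
  split_ifs with h1 h2 h2 <;>
    simp only [Prod.Lex.toLex_lt_toLex, lt_irrefl, and_false, or_false, false_or, true_and]
  · have : n i % 2 = n j % 2 := by
      rw [h1] at pi; rw [h2] at pj; rcases b <;> simp at pi pj <;> omega
    grind
  · have : n i % 2 ≠ n j % 2 := by
      rw [h1] at pi
      rcases b <;> simp at h2 <;> simp [h2] at pi pj <;> omega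
    grind
  · have : n i % 2 ≠ n j % 2 := by
      rw [h2] at pj
      rcases b <;> simp at h1 <;> simp [h1] at pi pj <;> omega
    grind
  · have : n i % 2 = n j % 2 := by
      rcases b <;> simp at h1 h2 <;> simp [h1, h2] at pi pj <;> omega
    grind

theorem eq_of_itinerary_eq
    (hstep : ∀ k, (n (k + 1) = n k + 1 ∧ l (k + 1) < 1) ∨ (n (k + 1) = n k - 1 ∧ 1 < l (k + 1)))
    {i j : ℕ} (h : itinerary n l i = itinerary n l j) (t : ℕ) :
    n (i + t + 1) = n (j + t + 1) ∧ l (i + t + 1) = l (j + t + 1) := by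
  have h1 := congrFun (congrArg ofLex h) t
  unfold itinerary at h1
  simp only [ofLex_toLex, toLex_inj, Prod.mk.injEq] at h1
  have si := hstep (i + t)
  have sj := hstep (j + t)
  refine ⟨?_, h1.2⟩
  have := h1.1
  omega
end Heights

section Configuration

/-- The sign of a nontrivial element of an ordered group. -/
noncomputable def orderSign {K : Type*} [Group K] [LinearOrder K] (g : K) : ℤ :=
  if 1 < g then 1 else -1

theorem exists_relatorAction {K : Type w} [Group K] [LinearOrder K] [MulLeftStrictMono K]
    (inc : Bool → A × B →* K) (hinc : ∀ b z, evalLetter b z = 1 → inc b z = 1)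
    {x : ℕ → A × B} {p : ℕ} (hp : 0 < p) (hpe : Even p) (hx : ∀ k, x (k + p) = x k)
    (hne : ∀ k, inc (parity k) (x k) ≠ 1)
    (hinj : ∀ i j, parity i = parity j → inc (parity i) (x i) = inc (parity j) (x j) → x i = x j)
    (hprim : ∀ d, 0 < d → d < p → ∃ t, x (t + d) ≠ x t)
    (hsum : 0 ≤ ∑ k ∈ Finset.range p, orderSign (inc (parity k) (x k))) :
    ∃ (L : Type w) (_ : LinearOrder L),
      Nonempty (RelatorAction (ℤ ×ₗ (L ×ₗ (Lex (ℕ → ℤ ×ₗ L) ×ₗ ℚ))) x p) := by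
  obtain ⟨n, hn, hpar, hstep⟩ := exists_levels (σ := fun k => orderSign (inc (parity k) (x k)))
    hp hpe (fun k => by simp only [hx, parity_add_even hpe])
    (fun k => by simp only [orderSign]; split_ifs <;> simp) hsum
  have : MulLeftStrictMono (K ×ₗ Kᵒᵈ) := mulLeftStrictMono_lexProd
  let slot : ℤ → K →* K ×ₗ Kᵒᵈ := fun m =>
    { toFun := fun k => if m ≤ 0 then toLex (k, 1) else toLex (1, OrderDual.toDual k)
      map_one' := by split_ifs <;> rfl
      map_mul' := fun k k' => by
        split_ifs
        · exact congrArg toLex (Prod.ext rfl (one_mul (1 : Kᵒᵈ)).symm)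
        · exact congrArg toLex (Prod.ext (one_mul (1 : K)).symm rfl) }
  have slot_inj : ∀ m k k', slot m k = slot m k' → k = k' := fun m k k' h => by
    change (if m ≤ 0 then toLex (k, (1 : Kᵒᵈ)) else toLex (1, OrderDual.toDual k)) =
      (if m ≤ 0 then toLex (k', (1 : Kᵒᵈ)) else toLex (1, OrderDual.toDual k')) at h
    split_ifs at h
    · exact congrArg (fun z => (ofLex z).1) h
    · exact congrArg (fun z => (ofLex z).2) h
  let l : ℕ → K ×ₗ Kᵒᵈ := fun k => slot (n k) (inc (parity k) (x k))
  have hl : ∀ k, l (k + p) = l k := fun k => by simp only [l, hn, hx, parity_add_even hpe]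
  have hlpos : ∀ k, n k ≤ 0 → (l k < 1 ↔ inc (parity k) (x k) < 1) ∧
      (1 < l k ↔ 1 < inc (parity k) (x k)) := fun k hk => by
    have h1 : l k = toLex (inc (parity k) (x k), 1) := if_pos hk
    have h2 : (1 : K ×ₗ Kᵒᵈ) = toLex (1, 1) := rfl
    rw [h1, h2]
    simp [Prod.Lex.toLex_lt_toLex]
  have hlneg : ∀ k, ¬ n k ≤ 0 → (l k < 1 ↔ 1 < inc (parity k) (x k)) ∧
      (1 < l k ↔ inc (parity k) (x k) < 1) := fun k hk => by
    have h1 : l k = toLex (1, OrderDual.toDual (inc (parity k) (x k))) := if_neg hk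
    have h2 : (1 : K ×ₗ Kᵒᵈ) = toLex (1, OrderDual.toDual 1) := rfl
    rw [h1, h2]
    simp only [Prod.Lex.toLex_lt_toLex, lt_irrefl, false_or, true_and]
    exact ⟨Iff.rfl, Iff.rfl⟩
  have hstep' : ∀ k, (n (k + 1) = n k + 1 ∧ l (k + 1) < 1) ∨
      (n (k + 1) = n k - 1 ∧ 1 < l (k + 1)) := fun k => by
    have h1 : ∀ g : K, orderSign g = 1 ↔ 1 < g := fun g => by
      unfold orderSign; split_ifs with h <;> simp [h]
    have h2 : ∀ g : K, orderSign g = -1 ↔ g ≤ 1 := fun g => by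
      unfold orderSign; split_ifs with h
      · simpa using h
      · simpa using not_lt.mp h
    have h3 := hne (k + 1)
    rcases hstep k with ⟨h, h'⟩ | ⟨h, h'⟩
    · refine Or.inl ⟨h, ?_⟩
      rw [h2] at h'
      by_cases hk : n (k + 1) ≤ 0
      · exact (hlpos _ hk).1.mpr (lt_of_le_of_ne (h'.mp hk) h3)
      · exact (hlneg _ hk).1.mpr (not_le.mp fun h => hk (h'.mpr h))
    · refine Or.inr ⟨h, ?_⟩
      rw [h1] at h'
      by_cases hk : n (k + 1) ≤ 0
      · exact (hlpos _ hk).2.mpr (h'.mp hk)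
      · exact (hlneg _ hk).2.mpr (lt_of_le_of_ne (not_lt.mp fun h => hk (h'.mpr h)) h3)
  have hlt := levelHeight_lt_iff hpar hstep'
  have hit : ∀ i, itinerary n l (i + p) = itinerary n l i := fun i => by
    unfold itinerary
    congr 1
    funext t
    rw [show i + p + t + 1 = i + t + 1 + p by ring, show i + p + t = i + t + p by ring, hn, hn, hl]
  have hne' : ∀ i j, i < j → j < p → itinerary n l i ≠ itinerary n l j := fun i j hij hj h => by
    obtain ⟨t, ht⟩ := hprim (j - i) (by omega) (by omega)
    have key : ∀ t, x (j + t + 1) = x (i + t + 1) := fun t => by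
      obtain ⟨h1, h2⟩ := eq_of_itinerary_eq hstep' h t
      have h3 : parity (i + t + 1) = parity (j + t + 1) := by
        have h4 := hpar (i + t + 1)
        rw [h1, hpar] at h4
        exact (Bool.eq_iff_iff.mpr h4).symm
      refine (hinj _ _ h3 (slot_inj (n (i + t + 1)) _ _ ?_)).symm
      simp only [l] at h2
      rw [h2, h1]
    have hmul : ∀ m k, x (k + m * p) = x k := fun m k => by
      induction m with
      | zero => simp
      | succ m ih => rw [show k + (m + 1) * p = k + m * p + p by ring, hx, ih]
    have hle : i + 1 ≤ (i + 1) * p := Nat.le_mul_of_pos_right _ hp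
    apply ht
    rw [← hmul (i + 1) t, ← hmul (i + 1) (t + (j - i))]
    have := key (t + (i + 1) * p - (i + 1))
    rwa [show i + (t + (i + 1) * p - (i + 1)) + 1 = t + (i + 1) * p by omega,
      show j + (t + (i + 1) * p - (i + 1)) + 1 = t + (j - i) + (i + 1) * p by omega] at this
  refine ⟨K ×ₗ Kᵒᵈ, inferInstance, ⟨⟨fun b => (fibreAct slot).comp (inc b), fun b z h => ?_,
    levelHeight n l, fun k => ?_, fun b k => ?_, fun i j => ?_, fun b i j hi hj hij h => ?_⟩⟩⟩
  · rw [MonoidHom.comp_apply, hinc b z h, map_one]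
  · have h1 : levelHeight n l (parity (k + 1)) (k + 1) =
        toLex (n (k + 1), toLex (1, toLex (itinerary n l (k + 1), 0))) := if_pos rfl
    have h2 : levelHeight n l (parity (k + 1)) k =
        toLex (n (k + 1), toLex (l (k + 1), toLex (itinerary n l (k + 1), 0))) :=
      if_neg (by rw [parity_succ]; cases parity k <;> simp)
    rw [h1, h2, MonoidHom.comp_apply, fibreAct_apply, mul_one]
  · unfold levelHeight
    rw [show k + p + 1 = k + 1 + p by ring, parity_add_even hpe, hn, hn, hl, hit, hit]
  · rw [hlt, hlt]
  · have h1 : itinerary n l i = itinerary n l j :=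
      le_antisymm (not_lt.mp fun h' => ((hlt b j i).mpr h').ne' h)
        (not_lt.mp fun h' => ((hlt b i j).mpr h').ne h)
    rcases lt_or_gt_of_ne hij with h' | h'
    · exact hne' i j h' hj h1
    · exact hne' j i h' hi h1.symm

end Configuration

section Extremal

theorem IsLeftOrderable.exists_linearOrder {H : Type*} [Group H] (h : IsLeftOrderable H) :
    ∃ _ : LinearOrder H, MulLeftStrictMono H := by
  classical
  obtain ⟨lt, hlt, hmul⟩ := h
  let inst : LinearOrder H := linearOrderOfSTO lt
  exact ⟨inst, ⟨fun f g h hgh => hmul g h f hgh⟩⟩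

theorem RelatorAction.exists_isExtremal {Ω : Type*} [LinearOrder Ω] {x : ℕ → A × B} {p : ℕ}
    (R : RelatorAction Ω x p) (hp : 0 < p) : ∃ M m, IsExtremal R M m := by
  have hne : (Finset.range p).Nonempty := ⟨0, by simpa using hp⟩
  obtain ⟨M, hM, hM'⟩ := Finset.exists_max_image (Finset.range p) (R.height true) hne
  obtain ⟨m, hm, hm'⟩ := Finset.exists_min_image (Finset.range p) (R.height true) hne
  have key : ∀ b i j, R.height true i ≤ R.height true j → R.height b i ≤ R.height b j := by
    intro b i j h
    cases b
    · exact not_lt.mp fun h' => not_lt.mpr h ((R.height_lt_iff j i).mpr h')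
    · exact h
  exact ⟨M, m, Finset.mem_range.mp hM, Finset.mem_range.mp hm,
    fun i hi b => key b i M (hM' i (Finset.mem_range.mpr hi)),
    fun i hi b => key b m i (hm' i (Finset.mem_range.mpr hi))⟩

theorem orderSign_toDual {K : Type*} [Group K] [LinearOrder K] {g : K} (hg : g ≠ 1) :
    orderSign (OrderDual.toDual g) = -orderSign g := by
  have h : (1 < OrderDual.toDual g) ↔ g < 1 := Iff.rfl
  unfold orderSign
  rcases lt_or_gt_of_ne hg with h' | h'
  · rw [if_pos (h.mpr h'), if_neg h'.not_gt, neg_neg]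
  · rw [if_neg fun h'' => h'.not_gt (h.mp h''), if_pos h']

theorem exists_relatorAction_isExtremal (hA : IsLeftOrderable A) (hB : IsLeftOrderable B)
    {x : ℕ → A × B} {p : ℕ} (hp : 0 < p) (hpe : Even p) (hx : ∀ k, x (k + p) = x k)
    (hne : ∀ k, evalLetter (parity k) (x k) ≠ 1) (hone : ∀ k, evalLetter (!parity k) (x k) = 1)
    (hprim : ∀ d, 0 < d → d < p → ∃ t, x (t + d) ≠ x t) :
    ∃ (Ω : Type (max u v)) (_ : LinearOrder Ω) (_ : DenselyOrdered Ω) (_ : NoMinOrder Ω)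
      (_ : NoMaxOrder Ω) (R : RelatorAction Ω x p) (M m : ℕ), IsExtremal R M m := by
  obtain ⟨_, _⟩ := hA.exists_linearOrder
  obtain ⟨_, _⟩ := hB.exists_linearOrder
  have : MulLeftStrictMono (A ×ₗ B) := mulLeftStrictMono_lexProd
  let inc : Bool → A × B →* A ×ₗ B := fun b =>
    { toFun := fun z => if b then toLex (z.1, 1) else toLex (1, z.2)
      map_one' := by split_ifs <;> rfl
      map_mul' := fun z z' => by
        split_ifs
        · exact congrArg toLex (Prod.ext rfl (one_mul (1 : B)).symm)
        · exact congrArg toLex (Prod.ext (one_mul (1 : A)).symm rfl) }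
  have hinc_true : ∀ z, inc true z = toLex (z.1, 1) := fun z => rfl
  have hinc_false : ∀ z, inc false z = toLex (1, z.2) := fun z => rfl
  have heval_true : ∀ z : A × B, evalLetter true z = 1 ↔ z.1 = 1 := fun z =>
    map_eq_one_iff Monoid.Coprod.inl Monoid.Coprod.inl_injective
  have heval_false : ∀ z : A × B, evalLetter false z = 1 ↔ z.2 = 1 := fun z =>
    map_eq_one_iff Monoid.Coprod.inr Monoid.Coprod.inr_injective
  have hinc : ∀ b z, evalLetter b z = 1 ↔ inc b z = 1 := by
    have h1 : (1 : A ×ₗ B) = toLex (1, 1) := rfl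
    intro b z
    cases b
    · rw [heval_false, hinc_false, h1, toLex_inj, Prod.mk.injEq]; simp
    · rw [heval_true, hinc_true, h1, toLex_inj, Prod.mk.injEq]; simp
  have hne' : ∀ k, inc (parity k) (x k) ≠ 1 := fun k h => hne k ((hinc _ _).mpr h)
  have hinj : ∀ i j, parity i = parity j → inc (parity i) (x i) = inc (parity j) (x j) →
      x i = x j := by
    intro i j hij h
    have hi := hone i
    have hj := hone j
    rw [hij] at h hi
    cases hb : parity j <;> rw [hb] at h hi hj
    · rw [hinc_false, hinc_false, toLex_inj, Prod.mk.injEq] at h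
      exact Prod.ext (((heval_true _).mp hi).trans ((heval_true _).mp hj).symm) h.2
    · rw [hinc_true, hinc_true, toLex_inj, Prod.mk.injEq] at h
      exact Prod.ext h.1 (((heval_false _).mp hi).trans ((heval_false _).mp hj).symm)
  suffices h : ∃ (L : Type (max u v)) (_ : LinearOrder L),
      Nonempty (RelatorAction (ℤ ×ₗ (L ×ₗ (Lex (ℕ → ℤ ×ₗ L) ×ₗ ℚ))) x p) by
    obtain ⟨L, _, ⟨R⟩⟩ := h
    have : Nonempty L := ⟨(ofLex (ofLex (R.height true 0)).2).1⟩
    exact ⟨_, _, inferInstance, inferInstance, inferInstance, R, R.exists_isExtremal hp⟩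
  rcases le_total 0 (∑ k ∈ Finset.range p, orderSign (inc (parity k) (x k))) with hsum | hsum
  · exact exists_relatorAction inc (fun b z => (hinc b z).mp) hp hpe hx hne' hinj hprim hsum
  · let inc' : Bool → A × B →* (A ×ₗ B)ᵒᵈ := fun b =>
      { toFun := fun z => OrderDual.toDual (inc b z)
        map_one' := map_one (inc b)
        map_mul' := map_mul (inc b) }
    refine exists_relatorAction inc' (fun b z => (hinc b z).mp) hp hpe hx hne' hinj hprim ?_
    have : ∀ k, orderSign (inc' (parity k) (x k)) = -orderSign (inc (parity k) (x k)) :=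
      fun k => orderSign_toDual (hne' k)
    simp only [this, Finset.sum_neg_distrib]
    linarith
end Extremal

section OpenWords

variable {ι Ω : Type*} [LinearOrder Ω] (act : Bool → A × B →* (Ω ≃o Ω)) (side : ι → Bool)

/-- The number of turns of an open word (tokens preceded by letters, and a final letter) when its
final letter is joined to its initial letter. -/
def cyclicTurns (χ : ι → (Bool → Ω) × Bool) : List ((A × B) × ι) × (A × B) → ℕ
  | ([], _) => 0
  | ((z, t) :: l, z') => turnSum act side χ t (l ++ [(z' * z, t)])

/-- The value of an open word whose final letter is read in the factor `s`. -/
def wordVal (ins : ι → Monoid.Coprod A B) (s : Bool) (P : List ((A × B) × ι) × (A × B)) :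
    Monoid.Coprod A B :=
  tokenProd side ins P.1 * evalLetter s P.2

/-- The sides of the tokens alternate, starting with `s`. -/
def IsAlternating : Bool → List ι → Prop
  | _, [] => True
  | s, t :: l => side t = s ∧ IsAlternating (!s) l

/-- Concatenation of open words. -/
def glue : List ((A × B) × ι) × (A × B) → List ((A × B) × ι) × (A × B) →
    List ((A × B) × ι) × (A × B)
  | P, ([], z) => (P.1, P.2 * z)
  | P, ((z, t) :: l, z') => (P.1 ++ (P.2 * z, t) :: l, z')

/-- Conjugation of an open word by the letter `y`, with tokens `t` and `t'` next to `y`. -/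
def wrap (y : A × B) (t t' : ι) (P : List ((A × B) × ι) × (A × B)) :
    List ((A × B) × ι) × (A × B) :=
  ((y, t) :: P.1 ++ [(P.2, t')], y⁻¹)

variable {act side}

theorem IsAlternating.append {s : Bool} {l l' : List ι} (h : IsAlternating side s l)
    (hl : Even l.length) (h' : IsAlternating side s l') : IsAlternating side s (l ++ l') := by
  induction hn : l.length using Nat.strong_induction_on generalizing l with
  | _ n ih =>
  match l, h, hl with
  | [], _, _ => exact h'
  | [_], _, hl => simp at hl
  | a :: b :: l, h, hl =>
    refine ⟨h.1, h.2.1, ?_⟩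
    have h3 := h.2.2
    rw [Bool.not_not] at h3 ⊢
    refine ih l.length (by simp at hn; omega) h3 ?_ rfl
    simpa [Nat.even_add] using hl

theorem IsAlternating.isChain {s : Bool} {l : List ι} (h : IsAlternating side s l) :
    l.IsChain fun u v => side u ≠ side v := by
  induction l generalizing s with
  | nil => exact .nil
  | cons a l ih =>
    rcases l with _ | ⟨b, l⟩
    · exact .singleton a
    · refine .cons_cons ?_ (ih h.2)
      rw [h.1, h.2.1]
      simp

theorem map_snd_glue (P Q : List ((A × B) × ι) × (A × B)) :
    (glue P Q).1.map Prod.snd = P.1.map Prod.snd ++ Q.1.map Prod.snd := by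
  obtain ⟨_ | ⟨⟨z, t⟩, l⟩, z'⟩ := Q <;> simp [glue]

theorem map_snd_wrap (y : A × B) (t t' : ι) (P : List ((A × B) × ι) × (A × B)) :
    (wrap y t t' P).1.map Prod.snd = t :: P.1.map Prod.snd ++ [t'] := by
  simp [wrap]

theorem length_glue (P Q : List ((A × B) × ι) × (A × B)) :
    (glue P Q).1.length = P.1.length + Q.1.length := by
  simpa using congrArg List.length (map_snd_glue P Q)

theorem length_wrap (y : A × B) (t t' : ι) (P : List ((A × B) × ι) × (A × B)) :
    (wrap y t t' P).1.length = P.1.length + 2 := by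
  simp [wrap]

theorem wordVal_glue (ins : ι → Monoid.Coprod A B) {s : Bool}
    {P Q : List ((A × B) × ι) × (A × B)} (hQ : IsAlternating side s (Q.1.map Prod.snd)) :
    wordVal side ins s (glue P Q) = wordVal side ins s P * wordVal side ins s Q := by
  obtain ⟨_ | ⟨⟨z, t⟩, l⟩, z'⟩ := Q
  · simp [wordVal, glue, mul_assoc, tokenProd]
  · have : side t = s := hQ.1
    simp [wordVal, glue, tokenProd_append, tokenProd_cons, this, mul_assoc]

theorem wordVal_wrap (ins : ι → Monoid.Coprod A B) {y : A × B} {t t' : ι}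
    (h : side t' = !side t) (hins : ins t' = (ins t)⁻¹) (P : List ((A × B) × ι) × (A × B)) :
    wordVal side ins (side t) (wrap y t t' P) =
      evalLetter (side t) y * ins t * wordVal side ins (!side t) P *
        (evalLetter (side t) y * ins t)⁻¹ := by
  simp [wordVal, wrap, h, hins, mul_assoc, tokenProd]

theorem tokenTurn_mul (χ : ι → (Bool → Ω) × Bool) (t t' : ι) (z z' : A × B) :
    tokenTurn act side χ t (z * z') t' =
      turn (act (side t') z' ((χ t').1 (side t'))) (χ t').2
        (act (side t') z⁻¹ ((χ t).1 (side t'))) (!(χ t).2) := by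
  rw [tokenTurn, ← turn_map (act (side t') z⁻¹), ← RelIso.mul_apply, ← map_mul,
    inv_mul_cancel_left]

theorem cyclicTurns_cons (χ : ι → (Bool → Ω) × Bool) (z z' : A × B) (t : ι)
    (l : List ((A × B) × ι)) :
    cyclicTurns act side χ ((z, t) :: l, z') =
      turnSum act side χ t l + tokenTurn act side χ (lastToken t l) (z' * z) t := by
  simp [cyclicTurns, turnSum_append, turnSum]

theorem cyclicTurns_glue_le (χ : ι → (Bool → Ω) × Bool) {s : Bool}
    {P Q : List ((A × B) × ι) × (A × B)} (hP : IsAlternating side s (P.1.map Prod.snd))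
    (hQ : IsAlternating side s (Q.1.map Prod.snd)) :
    cyclicTurns act side χ (glue P Q) ≤
      cyclicTurns act side χ P + cyclicTurns act side χ Q + 2 := by
  obtain ⟨_ | ⟨⟨z₁, t₁⟩, l₁⟩, z₁'⟩ := P <;> obtain ⟨_ | ⟨⟨z, t⟩, l⟩, z'⟩ := Q
  · simp [glue, cyclicTurns]
  · simp only [glue, List.nil_append, cyclicTurns_cons]
    have h := turn_le_two (act (side t) (z' * (z₁' * z)) ((χ t).1 (side t))) (χ t).2
      ((χ (lastToken t l)).1 (side t)) (!(χ (lastToken t l)).2)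
    simp only [tokenTurn] at h ⊢
    omega
  · simp only [glue, cyclicTurns_cons]
    have h := turn_le_two (act (side t₁) (z₁' * z' * z₁) ((χ t₁).1 (side t₁))) (χ t₁).2
      ((χ (lastToken t₁ l₁)).1 (side t₁)) (!(χ (lastToken t₁ l₁)).2)
    simp only [tokenTurn] at h ⊢
    omega
  · simp only [glue, List.cons_append, cyclicTurns_cons, turnSum_append, turnSum,
      lastToken_append, lastToken, tokenTurn_mul]
    have h1 : side t₁ = s := hP.1
    have h2 : side t = s := hQ.1
    rw [h1, h2]
    have := turn_swap (act s z₁ ((χ t₁).1 s)) (act s z ((χ t).1 s))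
      (act s z₁'⁻¹ ((χ (lastToken t₁ l₁)).1 s)) (act s z'⁻¹ ((χ (lastToken t l)).1 s))
      (χ t₁).2 (χ t).2 (!(χ (lastToken t₁ l₁)).2) (!(χ (lastToken t l)).2)
    omega

theorem cyclicTurns_wrap_le {χ : ι → (Bool → Ω) × Bool} {y : A × B} {t t' : ι}
    (h : side t' = !side t) (hχ : χ t' = ((χ t).1, !(χ t).2))
    {P : List ((A × B) × ι) × (A × B)} (hP : IsAlternating side (!side t) (P.1.map Prod.snd)) :
    cyclicTurns act side χ (wrap y t t' P) ≤ cyclicTurns act side χ P + 2 := by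
  obtain ⟨_ | ⟨⟨z₁, t₁⟩, l₁⟩, z₁'⟩ := P
  · simp only [wrap, cyclicTurns, List.nil_append, List.cons_append, turnSum, tokenTurn, hχ,
      inv_mul_cancel, map_one, RelIso.one_apply, turn_self]
    have h := turn_le_two (act (side t') z₁' ((χ t).1 (side t'))) (!(χ t).2)
      ((χ t).1 (side t')) (!(χ t).2)
    simpa using h
  · simp only [wrap, List.cons_append, cyclicTurns_cons, turnSum_append, turnSum,
      lastToken_append, lastToken, tokenTurn_mul, add_zero]
    have h1 : side t₁ = side t' := hP.1.trans h.symm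
    have h2 := turn_insert (act (side t') z₁ ((χ t₁).1 (side t'))) ((χ t).1 (side t'))
      (act (side t') z₁'⁻¹ ((χ (lastToken t₁ l₁)).1 (side t'))) (χ t₁).2 (!(χ t).2)
      (!(χ (lastToken t₁ l₁)).2)
    have h3 : tokenTurn act side χ t z₁ t₁ = turn (act (side t') z₁ ((χ t₁).1 (side t')))
        (χ t₁).2 ((χ t).1 (side t')) (!(χ t).2) := by rw [tokenTurn, h1]
    have h4 : tokenTurn act side χ (lastToken t₁ l₁) z₁' t' = turn ((χ t).1 (side t')) (!(χ t).2)
        (act (side t') z₁'⁻¹ ((χ (lastToken t₁ l₁)).1 (side t')))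
        (!(χ (lastToken t₁ l₁)).2) := by
      have := tokenTurn_mul (act := act) (side := side) χ (lastToken t₁ l₁) t' z₁' 1
      rw [mul_one] at this
      rw [this, hχ, map_one, RelIso.one_apply]
    rw [h3, h4, h1, hχ, inv_inv, turn_self]
    simp only [Bool.not_not, if_true]
    omega

end OpenWords

section DiagramTokens

/-- The tokens of the words read off a product of conjugates of a relator and its inverse. -/
inductive Token : Type
  /-- position `i` of the copy `k` of the relator (`ε = true`) or of its inverse -/
  | cell (ε : Bool) (k i : ℕ) : Token
  /-- the partner of a position of a copy of the relator -/
  | virt (ε : Bool) (k i : ℕ) : Token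
  /-- position `j` of the element conjugating the copy `k` of the relator -/
  | up (k j : ℕ) : Token
  /-- position `j` of the inverse of the element conjugating the copy `k` of the relator -/
  | down (k j : ℕ) : Token

namespace Token

/-- The factor following a token. -/
def side : Token → Bool
  | cell ε _ i => if ε then parity i else !parity i
  | virt ε _ i => if ε then !parity i else parity i
  | up _ j => parity j
  | down _ j => !parity j

/-- The partner of a token. -/
def partner : Token → Token
  | cell ε k i => virt ε k i
  | virt ε k i => cell ε k i
  | up k j => down k j
  | down k j => up k j

/-- The copy of the relator a token belongs to. -/
def index : Token → ℕ
  | cell _ k _ => k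
  | virt _ k _ => k
  | up k _ => k
  | down k _ => k

/-- The position of a token. -/
def position : Token → ℕ
  | cell _ _ i => i
  | virt _ _ i => i
  | up _ j => j
  | down _ j => j

/-- The virtual tokens of a relator of length `p`. -/
def virtual (p : ℕ) : Set Token :=
  {t | ∃ ε k i, i < p ∧ t = virt ε k i}

theorem partner_partner (t : Token) : partner (partner t) = t := by cases t <;> rfl

theorem side_partner (t : Token) : side (partner t) = !side t := by
  cases t <;> simp [side, partner]
  all_goals split_ifs <;> simp

end Token

open Token

variable (x : ℕ → A × B)

/-- The product of the first `i` letters of the alternating word with letters `x`. -/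
def prefixProd : ℕ → Monoid.Coprod A B
  | 0 => 1
  | i + 1 => prefixProd i * evalLetter (parity i) (x i)

/-- The letters following position `i` in a positive copy of the relator. -/
def posLetters (k : ℕ) : ℕ → ℕ → List ((A × B) × Token)
  | _, 0 => []
  | i, n + 1 => (x (i + 1), cell true k (i + 1)) :: posLetters k (i + 1) n

/-- The letters following position `n` in a negative copy of the relator. -/
def negLetters (k : ℕ) : ℕ → List ((A × B) × Token)
  | 0 => []
  | n + 1 => ((x (n + 1))⁻¹, cell false k n) :: negLetters k n

/-- The word of a copy of the relator of length `n + 1` or of its inverse. -/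
def cellWord (n k : ℕ) : Bool → List ((A × B) × Token) × (A × B)
  | true => ((x 0, cell true k 0) :: posLetters x k 0 n, 1)
  | false => ((1, cell false k n) :: negLetters x k n, (x 0)⁻¹)

variable {x}

theorem prefixProd_mul_posLetters {k i₀ : ℕ} {ins : Token → Monoid.Coprod A B}
    {i n : ℕ} (h : ∀ j ≤ i + n, j ≠ i₀ → ins (cell true k j) = 1) :
    prefixProd x (i + 1) * tokenProd side ins (posLetters x k i n) =
      (if i < i₀ ∧ i₀ ≤ i + n then prefixProd x (i₀ + 1) * ins (cell true k i₀) *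
        (prefixProd x (i₀ + 1))⁻¹ else 1) * prefixProd x (i + n + 1) := by
  induction n generalizing i with
  | zero =>
    rw [if_neg (by omega)]
    simp [posLetters, tokenProd]
  | succ n ih =>
    have ih' := ih (i := i + 1) fun j hj => h j (by omega)
    have h1 : prefixProd x (i + 1 + 1) =
      prefixProd x (i + 1) * evalLetter (parity (i + 1)) (x (i + 1)) := rfl
    rw [show i + 1 + n + 1 = i + (n + 1) + 1 by ring] at ih'
    simp only [posLetters, tokenProd_cons, side, if_true]
    by_cases hi : i + 1 = i₀
    · rw [if_neg (by omega), one_mul] at ih'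
      rw [if_pos (by omega), ← ih', ← hi, h1]
      group
    · rw [h _ (by omega) hi, mul_one, ← mul_assoc, ← h1, ih']
      congr 1
      apply if_congr _ rfl rfl
      omega

theorem prefixProd_mul_negLetters {k i₀ : ℕ} {ins : Token → Monoid.Coprod A B}
    {n : ℕ} (h : ∀ j < n, j ≠ i₀ → ins (cell false k j) = 1) :
    tokenProd side ins (negLetters x k n) * (evalLetter true (x 0))⁻¹ =
      (prefixProd x (n + 1))⁻¹ * (if i₀ < n then prefixProd x (i₀ + 1) * ins (cell false k i₀) *
        (prefixProd x (i₀ + 1))⁻¹ else 1) := by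
  induction n with
  | zero => simp [negLetters, tokenProd, prefixProd, parity]
  | succ n ih =>
    have h1 : prefixProd x (n + 1 + 1) =
      prefixProd x (n + 1) * evalLetter (parity (n + 1)) (x (n + 1)) := rfl
    have h2 : side (cell false k n) = parity (n + 1) := by simp [side, parity_succ]
    simp only [negLetters, tokenProd_cons, h2]
    rw [mul_assoc, ih fun j hj => h j (by omega), h1, map_inv]
    by_cases hi : n = i₀
    · subst hi
      rw [if_neg (by omega), if_pos (by omega)]
      group
    · rw [h _ n.lt_succ_self hi, if_congr (show i₀ < n + 1 ↔ i₀ < n by omega) rfl rfl]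
      group

/-- The value of a copy of the relator in which one element is inserted. -/
theorem wordVal_cellWord {n k i₀ : ℕ} {ins : Token → Monoid.Coprod A B} {ε : Bool}
    (hn : Even (n + 1)) (h : ∀ i ≤ n, i ≠ i₀ → ins (cell ε k i) = 1) (hi₀ : i₀ ≤ n) :
    wordVal side ins true (cellWord x n k ε) =
      if ε then prefixProd x (i₀ + 1) * ins (cell ε k i₀) * (prefixProd x (i₀ + 1))⁻¹ *
        prefixProd x (n + 1)
      else (prefixProd x (n + 1))⁻¹ *
        (prefixProd x (i₀ + 1) * ins (cell ε k i₀) * (prefixProd x (i₀ + 1))⁻¹) := by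
  have h0 : prefixProd x (0 + 1) = evalLetter true (x 0) := by simp [prefixProd, parity]
  cases ε
  · have h2 : side (cell false k n) = true := by
      have := parity_add_even hn 0
      rw [zero_add, parity_succ] at this
      simpa [side, parity] using this
    have h3 := prefixProd_mul_negLetters (x := x) (n := n) fun j hj => h j hj.le
    simp only [cellWord, wordVal, tokenProd_cons, h2, map_one, map_inv, one_mul]
    rw [mul_assoc, h3]
    by_cases hi : n = i₀
    · subst hi
      simp
      group
    · rw [h _ le_rfl hi, if_pos (by omega)]
      simp
  · have h3 := prefixProd_mul_posLetters (x := x) (i := 0) (n := n) fun j hj => h j (by omega)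
    simp only [cellWord, wordVal, tokenProd_cons, side, if_true, map_one, mul_one]
    rw [show parity 0 = true from rfl, ← h0]
    simp only [zero_add] at h3 ⊢
    by_cases hi : 0 = i₀
    · subst hi
      rw [if_neg (by omega), one_mul] at h3
      rw [← h3]
      group
    · rw [h _ (Nat.zero_le _) hi, mul_one, h3, if_pos (by omega)]

theorem isAlternating_posLetters (k i n : ℕ) :
    IsAlternating side (parity (i + 1)) ((posLetters x k i n).map Prod.snd) := by
  induction n generalizing i with
  | zero => trivial
  | succ n ih => exact ⟨rfl, by simpa [parity_succ] using ih (i + 1)⟩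

theorem isAlternating_negLetters (k n : ℕ) :
    IsAlternating side (parity n) ((negLetters x k n).map Prod.snd) := by
  induction n with
  | zero => trivial
  | succ n ih =>
    refine ⟨by simp [side, parity_succ], ?_⟩
    rw [parity_succ, Bool.not_not]
    exact ih

theorem isAlternating_cellWord {n : ℕ} (hn : Even (n + 1)) (k : ℕ) (ε : Bool) :
    IsAlternating side true ((cellWord x n k ε).1.map Prod.snd) := by
  cases ε
  · have h2 : parity n = false := by
      have := parity_add_even hn 0
      rw [zero_add, parity_succ] at this
      simpa [parity] using this
    refine ⟨by simp [side, h2], ?_⟩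
    have := isAlternating_negLetters (x := x) k n
    rwa [h2] at this
  · exact ⟨rfl, isAlternating_posLetters k 0 n⟩

theorem map_snd_posLetters (k i n : ℕ) :
    (posLetters x k i n).map Prod.snd = (List.range' (i + 1) n).map (cell true k) := by
  induction n generalizing i with
  | zero => rfl
  | succ n ih => simp [posLetters, List.range'_succ, ih]

theorem map_snd_negLetters (k n : ℕ) :
    (negLetters x k n).map Prod.snd = (List.range n).reverse.map (cell false k) := by
  induction n with
  | zero => rfl
  | succ n ih => simp [negLetters, List.range_succ, ih]

theorem mem_cellWord {n k : ℕ} {ε : Bool} {t : Token} :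
    t ∈ (cellWord x n k ε).1.map Prod.snd ↔ ∃ i ≤ n, t = cell ε k i := by
  cases ε
  · simp only [cellWord, List.map_cons, map_snd_negLetters, List.mem_cons, List.mem_map,
      List.mem_reverse, List.mem_range]
    constructor
    · rintro (rfl | ⟨i, hi, rfl⟩)
      · exact ⟨n, le_rfl, rfl⟩
      · exact ⟨i, hi.le, rfl⟩
    · rintro ⟨i, hi, rfl⟩
      rcases hi.eq_or_lt with rfl | hi
      · exact Or.inl rfl
      · exact Or.inr ⟨i, hi, rfl⟩
  · simp only [cellWord, List.map_cons, map_snd_posLetters, List.mem_cons, List.mem_map,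
      List.mem_range'_1]
    constructor
    · rintro (rfl | ⟨i, hi, rfl⟩)
      · exact ⟨0, Nat.zero_le _, rfl⟩
      · exact ⟨i, by omega, rfl⟩
    · rintro ⟨i, hi, rfl⟩
      rcases Nat.eq_zero_or_pos i with rfl | hi'
      · exact Or.inl rfl
      · exact Or.inr ⟨i, by omega, rfl⟩

theorem nodup_cellWord (n k : ℕ) (ε : Bool) : ((cellWord x n k ε).1.map Prod.snd).Nodup := by
  have hinj : Function.Injective (cell ε k) := fun i j h => by injection h
  cases ε
  · simp only [cellWord, List.map_cons, map_snd_negLetters]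
    rw [← List.map_cons (f := cell false k)]
    refine List.Nodup.map hinj (List.nodup_cons.mpr ⟨by simp, ?_⟩)
    exact List.nodup_reverse.mpr List.nodup_range
  · simp only [cellWord, List.map_cons, map_snd_posLetters]
    rw [← List.map_cons (f := cell true k)]
    exact List.Nodup.map hinj (List.nodup_cons.mpr ⟨by simp, List.nodup_range'⟩)

theorem length_cellWord (n k : ℕ) (ε : Bool) : (cellWord x n k ε).1.length = n + 1 := by
  rw [← List.length_map (f := Prod.snd)]
  cases ε <;> simp [cellWord, map_snd_posLetters, map_snd_negLetters]

end DiagramTokens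

section CellTurns

open Token

theorem sum_stationary_le {D : ℕ → Bool} {n : ℕ} (h : ∃ i ≤ n, ∃ j ≤ n, D i ≠ D j) :
    (∑ k ∈ Finset.range n, if D k = D (k + 1) then 1 else 0) +
      (if D n = D 0 then 1 else 0) + 2 ≤ n + 1 := by
  have h1 : ∀ m, (∑ k ∈ Finset.range m, if D k = D (k + 1) then 1 else 0) +
      (∑ k ∈ Finset.range m, if D k = D (k + 1) then 0 else 1) = m := fun m => by
    rw [← Finset.sum_add_distrib]
    conv_rhs => rw [← Finset.card_range m, Finset.card_eq_sum_ones]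
    exact Finset.sum_congr rfl fun k _ => by split_ifs <;> rfl
  have h2 : ∀ m, (∑ k ∈ Finset.range m, if D k = D (k + 1) then 0 else 1) % 2 =
      if D m = D 0 then 0 else 1 := fun m => by
    induction m with
    | zero => simp
    | succ m ih =>
      rw [Finset.sum_range_succ, Nat.add_mod, ih]
      cases D m <;> cases D (m + 1) <;> cases D 0 <;> rfl
  have h3 : (∑ k ∈ Finset.range n, if D k = D (k + 1) then 0 else 1) ≠ 0 := fun h0 => by
    rw [Finset.sum_eq_zero_iff] at h0
    have h4 : ∀ i ≤ n, D i = D 0 := fun i hi => by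
      induction i with
      | zero => rfl
      | succ i ih =>
        have := h0 i (Finset.mem_range.mpr hi)
        rw [← ih (by omega)]
        by_contra h5
        rw [if_neg fun h6 => h5 h6.symm] at this
        exact one_ne_zero this
    obtain ⟨i, hi, j, hj, hij⟩ := h
    exact hij ((h4 i hi).trans (h4 j hj).symm)
  have h4 := h1 n
  have h5 := h2 n
  split_ifs at h5 ⊢ <;> omega

variable {Ω : Type*} [LinearOrder Ω] {x : ℕ → A × B} {p : ℕ} {R : RelatorAction Ω x p}
  {χ : Token → (Bool → Ω) × Bool}

theorem turnSum_posLetters {k : ℕ} {D : ℕ → Bool} {i n : ℕ}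
    (h : ∀ j, i ≤ j → j ≤ i + n → χ (cell true k j) = ((fun b => R.height b j), D j)) :
    turnSum R.act side χ (cell true k i) (posLetters x k i n) =
      ∑ j ∈ Finset.range n, if D (i + j) = D (i + (j + 1)) then 1 else 0 := by
  induction n generalizing i with
  | zero => rfl
  | succ n ih =>
    rw [posLetters, turnSum, ih fun j hj hj' => h j (by omega) (by omega),
      Finset.sum_range_succ', add_comm]
    congr 1
    · exact Finset.sum_congr rfl fun j _ => by
        rw [show i + 1 + j = i + (j + 1) by ring, show i + 1 + (j + 1) = i + (j + 1 + 1) by ring]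
    · rw [tokenTurn, h i le_rfl (by omega), h (i + 1) (by omega) (by omega)]
      simp only [side, if_true, R.act_height, turn_self, zero_add, add_zero]
      cases D i <;> cases D (i + 1) <;> rfl

theorem turnSum_negLetters {k : ℕ} {D : ℕ → Bool} {n : ℕ}
    (h : ∀ j ≤ n, χ (cell false k j) = ((fun b => R.height b j), D j)) :
    turnSum R.act side χ (cell false k n) (negLetters x k n) =
      ∑ j ∈ Finset.range n, if D j = D (j + 1) then 1 else 0 := by
  induction n with
  | zero => rfl
  | succ n ih =>
    rw [negLetters, turnSum, ih fun j hj => h j (by omega), Finset.sum_range_succ, add_comm]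
    congr 1
    have h1 : R.act (parity (n + 1)) (x (n + 1))⁻¹ (R.height (parity (n + 1)) n) =
        R.height (parity (n + 1)) (n + 1) := by
      rw [← R.act_height, ← RelIso.mul_apply, ← map_mul, inv_mul_cancel, map_one,
        RelIso.one_apply]
    have h2 : side (cell false k n) = parity (n + 1) := by simp [side, parity_succ]
    rw [tokenTurn, h n (by omega), h (n + 1) le_rfl, h2]
    simp only [h1, turn_self]
    cases D n <;> cases D (n + 1) <;> rfl

theorem lastToken_posLetters (k i n : ℕ) :
    lastToken (cell true k i) (posLetters x k i n) = cell true k (i + n) := by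
  induction n generalizing i with
  | zero => rfl
  | succ n ih => rw [posLetters, lastToken, ih, show i + 1 + n = i + (n + 1) by ring]

theorem lastToken_negLetters (k n : ℕ) :
    lastToken (cell false k n) (negLetters x k n) = cell false k 0 := by
  induction n with
  | zero => rfl
  | succ n ih => rw [negLetters, lastToken, ih]

theorem cyclicTurns_cellWord_le {n k : ℕ} {ε : Bool} (R : RelatorAction Ω x (n + 1))
    (hn : Even (n + 1)) (hx : x (n + 1) = x 0) {D : ℕ → Bool}
    (h : ∀ j ≤ n, χ (cell ε k j) = ((fun b => R.height b j), D j))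
    (hD : ∃ i ≤ n, ∃ j ≤ n, D i ≠ D j) :
    cyclicTurns R.act side χ (cellWord x n k ε) + 2 ≤ n + 1 := by
  refine le_trans (le_of_eq ?_) (sum_stationary_le hD)
  have hpar : parity (n + 1) = true := by simpa [parity] using parity_add_even hn 0
  have hheight : ∀ b, R.height b (n + 1) = R.height b 0 := fun b => by
    simpa using R.height_add b 0
  have hact := R.act_height n
  rw [hpar, hheight, hx] at hact
  congr 1
  cases ε
  · rw [cellWord, cyclicTurns_cons, turnSum_negLetters h, lastToken_negLetters]
    congr 1
    have h1 : R.act true (x 0)⁻¹ (R.height true n) = R.height true 0 := by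
      rw [← hact, ← RelIso.mul_apply, ← map_mul, inv_mul_cancel, map_one, RelIso.one_apply]
    have h2 : side (cell false k n) = true := by
      rw [parity_succ] at hpar
      simpa [side] using hpar
    rw [tokenTurn, h n le_rfl, h 0 (Nat.zero_le n), h2, mul_one]
    simp only [h1, turn_self]
    cases D n <;> cases D 0 <;> rfl
  · rw [cellWord, cyclicTurns_cons, turnSum_posLetters (D := D) fun j _ hj => h j (by omega),
      lastToken_posLetters]
    simp only [zero_add]
    congr 1
    rw [tokenTurn, h n le_rfl, h 0 (Nat.zero_le n), one_mul]
    have h2 : side (cell true k 0) = true := rfl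
    simp only [h2, hact, turn_self]
    cases D n <;> cases D 0 <;> rfl

end CellTurns

section Diagrams

open Token

/-- The alternating product of letters starting in the factor `b`. -/
def altProd : Bool → List (A × B) → Monoid.Coprod A B
  | _, [] => 1
  | b, z :: l => evalLetter b z * altProd (!b) l

/-- Conjugation of an open word by the letters `u`. -/
def conjWord (k : ℕ) : ℕ → List (A × B) → List ((A × B) × Token) × (A × B) →
    List ((A × B) × Token) × (A × B)
  | _, [], P => P
  | j, y :: u, P => wrap y (up k j) (down k j) (conjWord k (j + 1) u P)

/-- The element by which `conjWord` conjugates. -/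
def conjVal (ins : Token → Monoid.Coprod A B) (k : ℕ) : ℕ → List (A × B) → Monoid.Coprod A B
  | _, [] => 1
  | j, y :: u => evalLetter (parity j) y * ins (up k j) * conjVal ins k (j + 1) u

theorem conjVal_one (k j : ℕ) (u : List (A × B)) :
    conjVal 1 k j u = altProd (parity j) u := by
  induction u generalizing j with
  | nil => rfl
  | cons y u ih => simp [conjVal, altProd, ih, parity_succ]

theorem length_conjWord (k j : ℕ) (u : List (A × B)) (P : List ((A × B) × Token) × (A × B)) :
    (conjWord k j u P).1.length = P.1.length + 2 * u.length := by
  induction u generalizing j with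
  | nil => rfl
  | cons y u ih => rw [conjWord, length_wrap, ih, List.length_cons]; ring

theorem isAlternating_conjWord (k j : ℕ) (u : List (A × B))
    {P : List ((A × B) × Token) × (A × B)} (hP : Even P.1.length)
    (h : IsAlternating side (parity (j + u.length)) (P.1.map Prod.snd)) :
    IsAlternating side (parity j) ((conjWord k j u P).1.map Prod.snd) := by
  induction u generalizing j with
  | nil => exact h
  | cons y u ih =>
    rw [conjWord, map_snd_wrap]
    refine ⟨rfl, ?_⟩
    rw [← parity_succ]
    refine (ih (j + 1) ?_).append ?_ ⟨?_, trivial⟩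
    · rwa [show j + 1 + u.length = j + (u.length + 1) by ring]
    · rw [List.length_map, length_conjWord]
      exact hP.add (even_two_mul _)
    · simp [side, parity_succ]

theorem wordVal_conjWord {ins : Token → Monoid.Coprod A B}
    (hins : ∀ t, ins (partner t) = (ins t)⁻¹) (k j : ℕ) (u : List (A × B))
    (P : List ((A × B) × Token) × (A × B)) :
    wordVal side ins (parity j) (conjWord k j u P) =
      conjVal ins k j u * wordVal side ins (parity (j + u.length)) P * (conjVal ins k j u)⁻¹ := by
  induction u generalizing j with
  | nil => simp [conjVal, conjWord]
  | cons y u ih =>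
    have h := wordVal_wrap (side := side) ins (y := y) (t := up k j) (t' := down k j) rfl
      (hins (up k j)) (conjWord k (j + 1) u P)
    change wordVal side ins (parity j) _ = evalLetter (parity j) y * ins (up k j) *
      wordVal side ins (!parity j) _ * _ at h
    rw [← parity_succ, ih, show j + 1 + u.length = j + (y :: u).length by simp; ring] at h
    rw [conjWord, h, conjVal]
    change _ * (evalLetter (parity j) y * ins (up k j))⁻¹ = _
    group

theorem mem_conjWord {k j : ℕ} {u : List (A × B)} {P : List ((A × B) × Token) × (A × B)}
    {t : Token} : t ∈ (conjWord k j u P).1.map Prod.snd ↔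
      t ∈ P.1.map Prod.snd ∨ ∃ i, j ≤ i ∧ i < j + u.length ∧ (t = up k i ∨ t = down k i) := by
  induction u generalizing j with
  | nil =>
    rw [conjWord]
    refine ⟨Or.inl, ?_⟩
    rintro (h | ⟨i, hi, hi', -⟩)
    · exact h
    · simp at hi'; omega
  | cons y u ih =>
    rw [conjWord, map_snd_wrap, List.mem_append, List.mem_cons, ih, List.mem_singleton]
    constructor
    · rintro ((rfl | h | ⟨i, hi, hi', h⟩) | rfl)
      · exact Or.inr ⟨j, le_rfl, by simp, Or.inl rfl⟩
      · exact Or.inl h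
      · exact Or.inr ⟨i, by omega, by simp; omega, h⟩
      · exact Or.inr ⟨j, le_rfl, by simp, Or.inr rfl⟩
    · rintro (h | ⟨i, hi, hi', h⟩)
      · exact Or.inl (Or.inr (Or.inl h))
      · rcases hi.eq_or_lt with rfl | hi
        · rcases h with rfl | rfl
          · exact Or.inl (Or.inl rfl)
          · exact Or.inr rfl
        · exact Or.inl (Or.inr (Or.inr ⟨i, hi, by simp at hi'; omega, h⟩))

theorem nodup_conjWord {k j : ℕ} {u : List (A × B)} {P : List ((A × B) × Token) × (A × B)}
    (hP : (P.1.map Prod.snd).Nodup)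
    (h : ∀ i, up k i ∉ P.1.map Prod.snd ∧ down k i ∉ P.1.map Prod.snd) :
    ((conjWord k j u P).1.map Prod.snd).Nodup := by
  induction u generalizing j with
  | nil => exact hP
  | cons y u ih =>
    have h1 : up k j ∉ (conjWord k (j + 1) u P).1.map Prod.snd := by
      rw [mem_conjWord]
      rintro (h' | ⟨i, hi, -, h' | h'⟩)
      · exact (h j).1 h'
      · injection h'; omega
      · cases h'
    have h2 : down k j ∉ (conjWord k (j + 1) u P).1.map Prod.snd := by
      rw [mem_conjWord]
      rintro (h' | ⟨i, hi, -, h' | h'⟩)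
      · exact (h j).2 h'
      · cases h'
      · injection h'; omega
    rw [conjWord, map_snd_wrap, List.nodup_append]
    refine ⟨List.nodup_cons.mpr ⟨h1, ih⟩, List.nodup_singleton _, ?_⟩
    rintro s hs t ht rfl
    rw [List.mem_singleton] at ht
    subst ht
    rcases List.mem_cons.mp hs with h' | h'
    · cases h'
    · exact h2 h'

theorem cyclicTurns_conjWord_le {Ω : Type*} [LinearOrder Ω] {act : Bool → A × B →* (Ω ≃o Ω)}
    {χ : Token → (Bool → Ω) × Bool} {k j : ℕ} {u : List (A × B)}
    {P : List ((A × B) × Token) × (A × B)} (hP : Even P.1.length)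
    (h : IsAlternating side (parity (j + u.length)) (P.1.map Prod.snd))
    (hχ : ∀ i, up k i ∈ (conjWord k j u P).1.map Prod.snd →
      χ (down k i) = ((χ (up k i)).1, !(χ (up k i)).2)) :
    cyclicTurns act side χ (conjWord k j u P) ≤ cyclicTurns act side χ P + 2 * u.length := by
  induction u generalizing j with
  | nil => exact le_rfl
  | cons y u ih =>
    have h' : IsAlternating side (parity (j + 1 + u.length)) (P.1.map Prod.snd) := by
      rwa [show j + 1 + u.length = j + (u.length + 1) by ring]
    have h1 := isAlternating_conjWord k (j + 1) u hP h'
    rw [conjWord, map_snd_wrap] at hχ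
    have h2 := cyclicTurns_wrap_le (act := act) (side := side) (χ := χ) (y := y) (t := up k j)
      (t' := down k j) rfl (hχ j (by simp)) (P := conjWord k (j + 1) u P)
      (by rw [parity_succ] at h1; exact h1)
    have h3 := ih h' fun i hi => hχ i (by simp [hi])
    rw [conjWord, List.length_cons]
    omega

variable (x : ℕ → A × B) (n : ℕ) (c : List (A × B)) (a : A × B)

/-- The open word of a product of conjugates of the relator and of `a⁻¹`, the latter conjugated
by the letters `c`. -/
def diagram : ℕ → List (Bool × List (A × B)) → List ((A × B) × Token) × (A × B)
  | k, [] => conjWord k 0 c ([], a⁻¹)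
  | k, b :: bs => glue (conjWord k 0 b.2 (cellWord x n k b.1)) (diagram (k + 1) bs)

variable {x n c a}

theorem parity_of_even {m : ℕ} (h : Even m) : parity m = true := by
  simpa [parity] using parity_add_even h 0

theorem isAlternating_block (hn : Even (n + 1)) (k : ℕ) {b : Bool × List (A × B)}
    (hb : Even b.2.length) : IsAlternating side true
      ((conjWord k 0 b.2 (cellWord x n k b.1)).1.map Prod.snd) := by
  refine isAlternating_conjWord k 0 b.2 (by rwa [length_cellWord]) ?_
  rw [zero_add, parity_of_even hb]
  exact isAlternating_cellWord hn k b.1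

theorem isAlternating_diagram (hn : Even (n + 1)) (k : ℕ) {bs : List (Bool × List (A × B))}
    (hbs : ∀ b ∈ bs, Even b.2.length) :
    IsAlternating side true ((diagram x n c a k bs).1.map Prod.snd) := by
  induction bs generalizing k with
  | nil => exact isAlternating_conjWord k 0 c Even.zero trivial
  | cons b bs ih =>
    rw [diagram, map_snd_glue]
    refine (isAlternating_block hn k (hbs b (by simp))).append ?_
      (ih (k + 1) fun b' hb' => hbs b' (by simp [hb']))
    rw [List.length_map, length_conjWord, length_cellWord]
    exact hn.add (even_two_mul _)

theorem mem_diagram {k : ℕ} {bs : List (Bool × List (A × B))} {t : Token}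
    (ht : t ∈ (diagram x n c a k bs).1.map Prod.snd) :
    (∃ m b, bs[m]? = some b ∧ ∃ i ≤ n, t = cell b.1 (k + m) i) ∨
      ∃ m i, k ≤ m ∧ (t = up m i ∨ t = down m i) := by
  induction bs generalizing k with
  | nil =>
    rcases mem_conjWord.mp ht with h | ⟨i, -, -, h⟩
    · simp at h
    · exact Or.inr ⟨k, i, le_rfl, h⟩
  | cons b bs ih =>
    rw [diagram, map_snd_glue, List.mem_append, mem_conjWord, mem_cellWord] at ht
    rcases ht with (⟨i, hi, rfl⟩ | ⟨i, -, -, h⟩) | h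
    · exact Or.inl ⟨0, b, rfl, i, hi, rfl⟩
    · exact Or.inr ⟨k, i, le_rfl, h⟩
    · rcases ih h with ⟨m, b', hb', i, hi, rfl⟩ | ⟨m, i, hm, h⟩
      · exact Or.inl ⟨m + 1, b', by simpa using hb', i, hi, by
          rw [show k + 1 + m = k + (m + 1) by ring]⟩
      · exact Or.inr ⟨m, i, by omega, h⟩

theorem up_mem_diagram_iff {k m i : ℕ} {bs : List (Bool × List (A × B))} :
    up m i ∈ (diagram x n c a k bs).1.map Prod.snd ↔
      down m i ∈ (diagram x n c a k bs).1.map Prod.snd := by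
  induction bs generalizing k with
  | nil => simp [diagram, mem_conjWord]
  | cons b bs ih =>
    rw [diagram, map_snd_glue, List.mem_append, List.mem_append, ih, mem_conjWord, mem_conjWord,
      mem_cellWord, mem_cellWord]
    simp

theorem le_index_of_mem_diagram {k : ℕ} {bs : List (Bool × List (A × B))} {t : Token}
    (ht : t ∈ (diagram x n c a k bs).1.map Prod.snd) : k ≤ t.index := by
  rcases mem_diagram ht with ⟨m, b, -, i, -, rfl⟩ | ⟨m, i, hm, rfl | rfl⟩
  · exact Nat.le_add_right k m
  · exact hm
  · exact hm

theorem nodup_diagram (k : ℕ) (bs : List (Bool × List (A × B))) :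
    ((diagram x n c a k bs).1.map Prod.snd).Nodup := by
  induction bs generalizing k with
  | nil => exact nodup_conjWord List.nodup_nil (by simp)
  | cons b bs ih =>
    rw [diagram, map_snd_glue, List.nodup_append]
    refine ⟨nodup_conjWord (nodup_cellWord n k b.1) (by simp [mem_cellWord]), ih (k + 1), ?_⟩
    rintro t ht _ ht' rfl
    have h1 := le_index_of_mem_diagram ht'
    rw [mem_conjWord, mem_cellWord] at ht
    rcases ht with ⟨i, -, rfl⟩ | ⟨i, -, -, rfl | rfl⟩ <;> simp [index] at h1

theorem wordVal_diagram_nil {ins : Token → Monoid.Coprod A B}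
    (hins : ∀ t, ins (partner t) = (ins t)⁻¹) (hc : Even c.length) (k : ℕ) :
    wordVal side ins true (diagram x n c a k []) =
      conjVal ins k 0 c * (evalLetter true a)⁻¹ * (conjVal ins k 0 c)⁻¹ := by
  have h := wordVal_conjWord hins k 0 c ([], a⁻¹)
  rw [zero_add, parity_of_even hc] at h
  rw [diagram]
  refine Eq.trans h ?_
  simp [wordVal, tokenProd]

theorem wordVal_diagram_cons {ins : Token → Monoid.Coprod A B}
    (hins : ∀ t, ins (partner t) = (ins t)⁻¹) (hn : Even (n + 1)) (k : ℕ)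
    {b : Bool × List (A × B)} {bs : List (Bool × List (A × B))}
    (hbs : ∀ b' ∈ b :: bs, Even b'.2.length) :
    wordVal side ins true (diagram x n c a k (b :: bs)) =
      conjVal ins k 0 b.2 * wordVal side ins true (cellWord x n k b.1) *
        (conjVal ins k 0 b.2)⁻¹ * wordVal side ins true (diagram x n c a (k + 1) bs) := by
  rw [diagram, wordVal_glue ins
    (isAlternating_diagram hn (k + 1) fun b' hb' => hbs b' (by simp [hb']))]
  have h := wordVal_conjWord hins k 0 b.2 (cellWord x n k b.1)
  rw [zero_add, parity_of_even (hbs b (by simp))] at h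
  exact congrArg (· * _) h

theorem cyclicTurns_diagram_le {Ω : Type*} [LinearOrder Ω] {R : RelatorAction Ω x (n + 1)}
    {M m : ℕ} {χ : Token → (Bool → Ω) × Bool} (hn : Even (n + 1)) (hx : x (n + 1) = x 0)
    (hM : M ≤ n) (hm : m ≤ n) {k : ℕ}
    {bs : List (Bool × List (A × B))} (hbs : ∀ b ∈ bs, Even b.2.length)
    (hχ : IsAdmissible R (virtual (n + 1)) position M m partner
      ((diagram x n c a k bs).1.map Prod.snd) χ) :
    cyclicTurns R.act side χ (diagram x n c a k bs) ≤ (diagram x n c a k bs).1.length := by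
  induction bs generalizing k with
  | nil =>
    rw [diagram, length_conjWord]
    refine (cyclicTurns_conjWord_le (P := ([], a⁻¹)) Even.zero trivial fun i hi => ?_).trans
      (by simp [cyclicTurns])
    exact (hχ _ hi).pair (up_mem_diagram_iff (bs := []).mp hi)
  | cons b bs ih =>
    have hbs' : ∀ b' ∈ bs, Even b'.2.length := fun b' hb' => hbs b' (by simp [hb'])
    have hb := hbs b (by simp)
    have hids := map_snd_glue (conjWord k 0 b.2 (cellWord x n k b.1)) (diagram x n c a (k + 1) bs)
    have h1 := ih hbs' fun t ht => by
      have h2 := hχ t (by rw [diagram, hids]; exact List.mem_append_right _ ht)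
      exact ⟨fun h => h2.pair (by rw [diagram, hids]; exact List.mem_append_right _ h),
        h2.height, h2.dir_max, h2.dir_min⟩
    have hcell : ∀ i ≤ n, IsAdmissibleAt R (virtual (n + 1)) position M m partner
        ((diagram x n c a k (b :: bs)).1.map Prod.snd) χ (cell b.1 k i) := fun i hi => hχ _ <| by
      rw [diagram, hids]
      exact List.mem_append_left _ (mem_conjWord.mpr (Or.inl (mem_cellWord.mpr ⟨i, hi, rfl⟩)))
    have hvirt : ∀ i ≤ n, partner (cell b.1 k i) ∈ virtual (n + 1) := fun i hi =>
      ⟨b.1, k, i, Nat.lt_succ_of_le hi, rfl⟩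
    have h2 := cyclicTurns_cellWord_le (k := k) (ε := b.1) (χ := χ) R hn hx
      (D := fun i => (χ (cell b.1 k i)).2)
      (fun i hi => Prod.ext (funext fun s => (hcell i hi).height (hvirt i hi) s) rfl)
      ⟨M, hM, m, hm, by
        rw [(hcell M hM).dir_max (hvirt M hM) rfl, (hcell m hm).dir_min (hvirt m hm) rfl]
        simp⟩
    have h3 := cyclicTurns_conjWord_le (act := R.act) (χ := χ) (k := k) (j := 0) (u := b.2)
      (P := cellWord x n k b.1) (by rwa [length_cellWord])
      (by rw [zero_add, parity_of_even hb]; exact isAlternating_cellWord hn k b.1)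
      fun i hi => by
        have h4 : up k i ∈ (diagram x n c a k (b :: bs)).1.map Prod.snd := by
          rw [diagram, hids]
          exact List.mem_append_left _ hi
        exact (hχ _ h4).pair (up_mem_diagram_iff.mp h4)
    have h4 := cyclicTurns_glue_le (act := R.act) χ (isAlternating_block (x := x) hn k hb)
      (isAlternating_diagram (x := x) (c := c) (a := a) hn (k + 1) hbs')
    rw [diagram, length_glue, length_conjWord, length_cellWord]
    omega

end Diagrams

section ConjProd

variable {G : Type*} [Group G]

/-- A product of conjugates of `r` and `r⁻¹`. -/
def conjProd (r : G) (L : List (G × Bool)) : G :=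
  (L.map fun q => q.1 * (if q.2 then r else r⁻¹) * q.1⁻¹).prod

theorem conjProd_cons (r : G) (q : G × Bool) (L : List (G × Bool)) :
    conjProd r (q :: L) = q.1 * (if q.2 then r else r⁻¹) * q.1⁻¹ * conjProd r L := by
  simp [conjProd]

theorem conj_conjProd (r h : G) (L : List (G × Bool)) :
    h * conjProd r L * h⁻¹ = conjProd r (L.map fun q => (h * q.1, q.2)) := by
  induction L with
  | nil => simp [conjProd]
  | cons q L ih =>
    rw [List.map_cons, conjProd_cons, conjProd_cons, ← ih]
    group

theorem exists_eq_conjProd {r g : G} (h : g ∈ Subgroup.normalClosure {r}) :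
    ∃ L, g = conjProd r L := by
  induction h using Subgroup.closure_induction with
  | mem y hy =>
    obtain ⟨s, hs, hsy⟩ := Group.mem_conjugatesOfSet_iff.mp hy
    rw [Set.mem_singleton_iff] at hs
    subst hs
    obtain ⟨c, rfl⟩ := isConj_iff.mp hsy
    exact ⟨[(c, true)], by simp [conjProd]⟩
  | one => exact ⟨[], rfl⟩
  | mul y z _ _ hy hz =>
    obtain ⟨L, rfl⟩ := hy
    obtain ⟨L', rfl⟩ := hz
    exact ⟨L ++ L', by simp [conjProd]⟩
  | inv y _ hy =>
    obtain ⟨L, rfl⟩ := hy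
    refine ⟨(L.map fun q => (q.1, !q.2)).reverse, ?_⟩
    rw [conjProd, conjProd, List.prod_inv_reverse, List.map_reverse, List.map_map, List.map_map]
    congr 3
    funext q
    cases h : q.2 <;> simp [h, mul_assoc]

end ConjProd

theorem altProd_append (b : Bool) {l : List (A × B)} (l' : List (A × B)) (hl : Even l.length) :
    altProd b (l ++ l') = altProd b l * altProd b l' := by
  induction hn : l.length using Nat.strong_induction_on generalizing l with
  | _ n ih =>
  match l, hl with
  | [], _ => simp [altProd]
  | [_], hl => simp at hl
  | y :: z :: l, hl =>
    have := ih l.length (by simp at hn; omega) (by simpa [Nat.even_add] using hl) rfl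
    simp [altProd, this, mul_assoc]

theorem exists_eq_altProd (g : Monoid.Coprod A B) :
    ∃ l : List (A × B), Even l.length ∧ g = altProd true l := by
  induction g using Monoid.Coprod.induction_on with
  | inl a => exact ⟨[(a, 1), 1], by simp, by simp [altProd, evalLetter]⟩
  | inr b => exact ⟨[1, (1, b)], by simp, by simp [altProd, evalLetter]⟩
  | mul g h hg hh =>
    obtain ⟨l, hl, rfl⟩ := hg
    obtain ⟨l', hl', rfl⟩ := hh
    exact ⟨l ++ l', by rw [List.length_append]; exact hl.add hl', (altProd_append _ _ hl).symm⟩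

section InitialWord

open Token

variable {x : ℕ → A × B} {n : ℕ} {c : List (A × B)} {a : A × B}

theorem wordVal_diagram_one (hn : Even (n + 1)) (hc : Even c.length) (k : ℕ)
    {bs : List (Bool × List (A × B))} (hbs : ∀ b ∈ bs, Even b.2.length) :
    wordVal side 1 true (diagram x n c a k bs) =
      conjProd (prefixProd x (n + 1)) (bs.map fun b => (altProd true b.2, b.1)) *
        (altProd true c * (evalLetter true a)⁻¹ * (altProd true c)⁻¹) := by
  induction bs generalizing k with
  | nil =>
    rw [wordVal_diagram_nil (fun _ => inv_one.symm) hc, conjVal_one]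
    simp [conjProd, show parity 0 = true from rfl]
  | cons b bs ih =>
    rw [wordVal_diagram_cons (fun _ => inv_one.symm) hn k hbs, conjVal_one,
      ih (k + 1) fun b' hb' => hbs b' (by simp [hb']), List.map_cons, conjProd_cons,
      wordVal_cellWord (i₀ := 0) hn (fun _ _ _ => rfl) (Nat.zero_le _)]
    simp [show parity 0 = true from rfl, mul_assoc]

theorem exists_wordVal_diagram {ins : Token → Monoid.Coprod A B}
    (hins : ∀ t, ins (partner t) = (ins t)⁻¹) (hn : Even (n + 1)) (hc : Even c.length)
    (F : Finset ℕ) (k : ℕ) {bs : List (Bool × List (A × B))}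
    (hbs : ∀ b ∈ bs, Even b.2.length)
    (hbad : ∀ m b, bs[m]? = some b → k + m ∈ F →
      wordVal side ins true (cellWord x n (k + m) b.1) = 1)
    (hgood : ∀ m b, bs[m]? = some b → k + m ∉ F →
      wordVal side ins true (cellWord x n (k + m) b.1) =
        if b.1 then prefixProd x (n + 1) else (prefixProd x (n + 1))⁻¹) :
    ∃ L d, L.length + ((Finset.range bs.length).filter fun m => k + m ∈ F).card = bs.length ∧
      wordVal side ins true (diagram x n c a k bs) =
        conjProd (prefixProd x (n + 1)) L * (d * (evalLetter true a)⁻¹ * d⁻¹) := by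
  simp only [Finset.card_filter]
  induction bs generalizing k with
  | nil =>
    exact ⟨[], conjVal ins k 0 c, by simp, by simp [wordVal_diagram_nil hins hc, conjProd]⟩
  | cons b bs ih =>
    have hsucc : ∀ m, k + 1 + m = k + (m + 1) := fun m => by ring
    obtain ⟨L, d, hL, h⟩ := ih (k + 1) (fun b' hb' => hbs b' (by simp [hb']))
      (fun m b' hb' hm => by
        rw [hsucc] at hm ⊢
        exact hbad (m + 1) b' (by simpa using hb') hm)
      (fun m b' hb' hm => by
        rw [hsucc] at hm ⊢
        exact hgood (m + 1) b' (by simpa using hb') hm)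
    simp only [hsucc] at hL
    rw [wordVal_diagram_cons hins hn k hbs, h, List.length_cons, Finset.sum_range_succ']
    by_cases hk : k ∈ F
    · refine ⟨L, d, by rw [add_zero]; simp only [hk, if_true]; omega, ?_⟩
      have := hbad 0 b rfl hk
      rw [add_zero] at this
      simp [this]
    · refine ⟨(conjVal ins k 0 b.2, b.1) :: L, d, by
        rw [add_zero]; simp only [hk, if_false, List.length_cons]; omega, ?_⟩
      have := hgood 0 b rfl hk
      rw [add_zero] at this
      rw [this, conjProd_cons]
      simp only [mul_assoc]

/-- The element which, inserted after position `i` of the relator, cancels it. -/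
def cancelling (x : ℕ → A × B) (n i : ℕ) (b : Bool) : Monoid.Coprod A B :=
  if b = parity i then (prefixProd x (i + 1))⁻¹ * (prefixProd x (n + 1))⁻¹ * prefixProd x (i + 1)
  else (prefixProd x (i + 1))⁻¹ * prefixProd x (n + 1) * prefixProd x (i + 1)

theorem cancelling_not (i : ℕ) (b : Bool) : cancelling x n i (!b) = (cancelling x n i b)⁻¹ := by
  unfold cancelling
  cases b <;> cases parity i <;> simp [mul_assoc]

theorem wordVal_cellWord_of_ins_virt {ins : Token → Monoid.Coprod A B}
    (hins : ∀ t, ins (partner t) = (ins t)⁻¹) (hn : Even (n + 1)) {ε : Bool} {k i₀ : ℕ}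
    (hi₀ : i₀ ≤ n) (h : ∀ i ≤ n, i ≠ i₀ → ins (virt ε k i) = 1)
    (h₀ : ins (virt ε k i₀) = cancelling x n i₀ (side (virt ε k i₀))) :
    wordVal side ins true (cellWord x n k ε) = 1 := by
  have hcell : ∀ i, ins (cell ε k i) = (ins (virt ε k i))⁻¹ := fun i => hins (virt ε k i)
  rw [wordVal_cellWord hn (fun i hi hi' => by rw [hcell, h i hi hi', inv_one]) hi₀, hcell, h₀]
  cases ε <;> simp [cancelling, side, mul_assoc]

theorem wordVal_cellWord_of_ins_virt_eq_one {ins : Token → Monoid.Coprod A B}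
    (hins : ∀ t, ins (partner t) = (ins t)⁻¹) (hn : Even (n + 1)) {ε : Bool} {k : ℕ}
    (h : ∀ i ≤ n, ins (virt ε k i) = 1) :
    wordVal side ins true (cellWord x n k ε) =
      if ε then prefixProd x (n + 1) else (prefixProd x (n + 1))⁻¹ := by
  have hcell : ∀ i ≤ n, ins (cell ε k i) = 1 := fun i hi => by
    rw [← inv_one, ← h i hi]; exact hins (virt ε k i)
  rw [wordVal_cellWord hn (fun i hi _ => hcell i hi) (Nat.zero_le n), hcell 0 (Nat.zero_le n)]
  simp

theorem cell_mem_diagram {k m i : ℕ} {ε : Bool} {bs : List (Bool × List (A × B))}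
    (h : cell ε m i ∈ (diagram x n c a k bs).1.map Prod.snd) :
    ∃ j b, bs[j]? = some b ∧ m = k + j ∧ ε = b.1 ∧ i ≤ n := by
  rcases mem_diagram h with ⟨j, b, hb, i', hi', h⟩ | ⟨_, _, -, h | h⟩
  · injection h with h1 h2 h3
    exact ⟨j, b, hb, h2, h1, h3 ▸ hi'⟩
  · cases h
  · cases h

theorem exists_wordVal_diagram_of_insert {ins : Token → Monoid.Coprod A B}
    (hins : ∀ t, ins (partner t) = (ins t)⁻¹) (hn : Even (n + 1)) (hc : Even c.length)
    {bs : List (Bool × List (A × B))} (hbs : ∀ b ∈ bs, Even b.2.length) {v v' : Token}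
    (hv : v ∈ virtual (n + 1)) (hv' : v' ∈ virtual (n + 1))
    (hmem : partner v ∈ (diagram x n c a 0 bs).1.map Prod.snd)
    (hmem' : partner v' ∈ (diagram x n c a 0 bs).1.map Prod.snd)
    (hpos : position v = position v') (hside : side v ≠ side v')
    (hone : ∀ t ∈ virtual (n + 1), t ≠ v → t ≠ v' → ins t = 1)
    (hinsv : ins v = cancelling x n (position v) (side v))
    (hinsv' : ins v' = cancelling x n (position v') (side v')) :
    ∃ L d, L.length + 2 ≤ bs.length ∧ wordVal side ins true (diagram x n c a 0 bs) =
      conjProd (prefixProd x (n + 1)) L * (d * (evalLetter true a)⁻¹ * d⁻¹) := by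
  obtain ⟨ε, k, i, hi, rfl⟩ := hv
  obtain ⟨ε', k', i', hi', rfl⟩ := hv'
  obtain rfl : i = i' := hpos
  obtain ⟨j, b, hb, hj, rfl, -⟩ := cell_mem_diagram hmem
  obtain ⟨j', b', hb', hj', rfl, -⟩ := cell_mem_diagram hmem'
  rw [zero_add] at hj hj'
  subst hj hj'
  have hkk : k ≠ k' := by
    rintro rfl
    rw [hb, Option.some_inj] at hb'
    exact hside (by rw [hb'])
  have hi : i ≤ n := Nat.le_of_lt_succ hi
  have hvirt : ∀ {ε m j}, j ≤ n → (m = k → j ≠ i) → (m = k' → j ≠ i) → ins (virt ε m j) = 1 :=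
    fun hj h h' => hone _ ⟨_, _, _, Nat.lt_succ_of_le hj, rfl⟩
      (fun h1 => by injection h1 with _ h2 h3; exact h h2 h3)
      (fun h1 => by injection h1 with _ h2 h3; exact h' h2 h3)
  obtain ⟨L, d, hL, h⟩ := exists_wordVal_diagram (x := x) (a := a) hins hn hc {k, k'} 0 hbs
    (fun m e he hm => by
      rw [zero_add] at hm ⊢
      rcases Finset.mem_insert.mp hm with rfl | hm
      · rw [hb, Option.some_inj] at he
        subst he
        exact wordVal_cellWord_of_ins_virt hins hn hi
          (fun j hj hji => hvirt hj (fun _ => hji) fun _ => hji) hinsv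
      · rw [Finset.mem_singleton] at hm
        subst hm
        rw [hb', Option.some_inj] at he
        subst he
        exact wordVal_cellWord_of_ins_virt hins hn hi
          (fun j hj hji => hvirt hj (fun _ => hji) fun _ => hji) hinsv')
    (fun m e _ hm => by
      rw [zero_add] at hm ⊢
      simp only [Finset.mem_insert, Finset.mem_singleton, not_or] at hm
      exact wordVal_cellWord_of_ins_virt_eq_one hins hn fun j hj =>
        hvirt hj (fun h => absurd h hm.1) fun h => absurd h hm.2)
  refine ⟨L, d, ?_, h⟩
  have h2 : ({k, k'} : Finset ℕ) ⊆
      (Finset.range bs.length).filter fun m => 0 + m ∈ ({k, k'} : Finset ℕ) := by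
    have hk := (List.getElem?_eq_some_iff.mp hb).1
    have hk' := (List.getElem?_eq_some_iff.mp hb').1
    intro m hm
    simp only [Finset.mem_filter, Finset.mem_range, zero_add]
    refine ⟨?_, hm⟩
    simp only [Finset.mem_insert, Finset.mem_singleton] at hm
    rcases hm with rfl | rfl <;> assumption
  have h3 := Finset.card_le_card h2
  rw [Finset.card_pair hkk] at h3
  omega

end InitialWord

section InitialTightWord

open Token

variable {x : ℕ → A × B} {n : ℕ} {c : List (A × B)} {a : A × B}

theorem even_length_diagram (hn : Even (n + 1)) (k : ℕ) (bs : List (Bool × List (A × B))) :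
    Even (diagram x n c a k bs).1.length := by
  induction bs generalizing k with
  | nil => rw [diagram, length_conjWord]; simp
  | cons b bs ih =>
    rw [diagram, length_glue, length_conjWord, length_cellWord]
    exact (hn.add (even_two_mul _)).add (ih (k + 1))

theorem exists_glue_cellWord_eq (k : ℕ) (ε : Bool) (Q : List ((A × B) × Token) × (A × B)) :
    ∃ z, ∃ i ≤ n, ∃ e z', glue (cellWord x n k ε) Q = ((z, cell ε k i) :: e, z') := by
  rcases Q with ⟨_ | _, _⟩ <;> cases ε
  exacts [⟨_, n, le_rfl, _, _, rfl⟩, ⟨_, 0, Nat.zero_le _, _, _, rfl⟩, ⟨_, n, le_rfl, _, _, rfl⟩,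
    ⟨_, 0, Nat.zero_le _, _, _, rfl⟩]

/-- A product of conjugates of the relator and of `a⁻¹` which is trivial gives a tight word. -/
theorem exists_isTightWord {Ω : Type*} [LinearOrder Ω] {R : RelatorAction Ω x (n + 1)}
    {M m : ℕ} (hn : Even (n + 1)) (hx : x (n + 1) = x 0) (hM : M ≤ n) (hm : m ≤ n)
    (hc : Even c.length) {ε : Bool} {bs : List (Bool × List (A × B))}
    (hbs : ∀ b ∈ bs, Even b.2.length)
    (hone : wordVal side 1 true (diagram x n c a 0 ((ε, []) :: bs)) = 1) :
    ∃ h₀ l, IsTightWord R side (virtual (n + 1)) position M m (cancelling x n)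
      {g | ∃ L d, L.length + 2 ≤ bs.length + 1 ∧
        g = conjProd (prefixProd x (n + 1)) L * (d * (evalLetter true a)⁻¹ * d⁻¹)}
      partner h₀ l := by
  have hbs' : ∀ b ∈ (ε, []) :: bs, Even b.2.length := by
    simpa using hbs
  obtain ⟨z, i, hi, e, z', hP⟩ : ∃ z, ∃ i ≤ n, ∃ e z',
      diagram x n c a 0 ((ε, []) :: bs) = ((z, cell ε 0 i) :: e, z') :=
    exists_glue_cellWord_eq 0 ε _
  set t := cell ε 0 i with ht
  have hlen := even_length_diagram (x := x) (c := c) (a := a) hn 0 ((ε, []) :: bs)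
  have halt := isAlternating_diagram (x := x) (c := c) (a := a) hn 0 hbs'
  have hnd := nodup_diagram (x := x) (n := n) (c := c) (a := a) 0 ((ε, []) :: bs)
  have hside : side t = true := by rw [hP] at halt; exact halt.1
  have hval : ∀ ins : Token → Monoid.Coprod A B, tokenProd side ins (e ++ [(z' * z, t)]) =
      (evalLetter true z * ins t)⁻¹ *
        wordVal side ins true (diagram x n c a 0 ((ε, []) :: bs)) *
        (evalLetter true z * ins t) := fun ins => by
    rw [hP, wordVal, tokenProd_append, tokenProd_cons, tokenProd_cons, hside, map_mul]
    simp [tokenProd, mul_assoc]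
  have hids : ∀ s, s ∈ (e ++ [(z' * z, t)]).map Prod.snd ↔
      s ∈ (diagram x n c a 0 ((ε, []) :: bs)).1.map Prod.snd := fun s => by
    rw [hP]
    simp only [List.map_append, List.map_cons, List.map_nil, List.mem_append, List.mem_cons,
      List.not_mem_nil, or_false]
    exact or_comm
  refine ⟨t, e ++ [(z' * z, t)], ?_, by simp, by simp [lastToken_append, lastToken], ?_, ?_, ?_,
    partner_partner, side_partner, ?_, ?_, ?_, ?_⟩
  · rw [hP] at hnd
    rw [List.map_append]
    exact List.nodup_append_comm.mp hnd
  · exact ⟨ε, 0, i, Nat.lt_succ_of_le hi, rfl⟩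
  · rintro s hs ⟨ε', k, j, -, rfl⟩
    rw [hids] at hs
    rcases mem_diagram hs with ⟨_, _, -, _, -, h⟩ | ⟨_, _, -, h | h⟩ <;> cases h
  · intro s hs
    rw [hids] at hs ⊢
    rcases mem_diagram hs with ⟨k, b, -, j, hj, rfl⟩ | ⟨k, j, -, rfl | rfl⟩
    · exact Or.inl ⟨b.1, 0 + k, j, Nat.lt_succ_of_le hj, rfl⟩
    · exact Or.inr (up_mem_diagram_iff.mp hs)
    · exact Or.inr (up_mem_diagram_iff.mpr hs)
  · have h := (halt.append (by rwa [List.length_map]) (l' := [t]) ⟨hside, trivial⟩).isChain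
    rw [hP] at h
    simpa using h
  · rw [hval, hone]
    simp
  · intro χ hχ
    have h := cyclicTurns_diagram_le (R := R) (χ := χ) (c := c) (a := a) hn hx hM hm hbs'
      fun s hs => by
        have h2 := hχ s ((hids s).mpr hs)
        exact ⟨fun h => h2.pair ((hids _).mpr h), h2.height, h2.dir_max, h2.dir_min⟩
    rw [hP] at h
    simpa [cyclicTurns] using h
  · intro v hv v' hv' hmem hmem' hpos hvv' ins hins hoth hv1 hv2
    rw [hids] at hmem hmem'
    obtain ⟨L, d, hL, h⟩ := exists_wordVal_diagram_of_insert hins hn hc hbs' hv hv' hmem hmem'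
      hpos hvv' hoth hv1 hv2
    rw [hval, h]
    set g := evalLetter true z * ins t
    refine ⟨L.map fun q => (g⁻¹ * q.1, q.2), g⁻¹ * d, by simpa using hL, ?_⟩
    rw [← conj_conjProd]
    group

theorem eq_one_of_inl_mem_normalClosure (hA : IsLeftOrderable A) (hB : IsLeftOrderable B)
    (hn : Even (n + 1)) (hx : ∀ k, x (k + (n + 1)) = x k)
    (hne : ∀ k, evalLetter (parity k) (x k) ≠ 1) (hone : ∀ k, evalLetter (!parity k) (x k) = 1)
    (hprim : ∀ d, 0 < d → d < n + 1 → ∃ t, x (t + d) ≠ x t) {a : A}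
    (ha : Monoid.Coprod.inl a ∈ Subgroup.normalClosure {prefixProd x (n + 1)}) : a = 1 := by
  by_contra hne1
  obtain ⟨L, hL, hmin⟩ : ∃ L, Monoid.Coprod.inl a = conjProd (prefixProd x (n + 1)) L ∧
      ∀ L', Monoid.Coprod.inl a = conjProd (prefixProd x (n + 1)) L' → L.length ≤ L'.length := by
    obtain ⟨L, hL⟩ := exists_eq_conjProd ha
    have := exists_minimal_of_wellFoundedLT
      (fun k => ∃ L, L.length = k ∧ Monoid.Coprod.inl a = conjProd (prefixProd x (n + 1)) L)
      ⟨_, L, rfl, hL⟩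
    obtain ⟨k, ⟨L, rfl, hL⟩, hk⟩ := this
    refine ⟨L, hL, fun L' hL' => ?_⟩
    by_contra hlt
    exact hlt (hk ⟨L', rfl, hL'⟩ (not_le.mp hlt).le)
  rcases L with _ | ⟨⟨u, ε⟩, L⟩
  · exact hne1 (Monoid.Coprod.inl_injective (by rw [hL, map_one]; rfl))
  obtain ⟨Ω, _, _, _, _, R, M, m, hR⟩ :=
    exists_relatorAction_isExtremal hA hB n.succ_pos hn hx hne hone hprim
  choose w hweven hw using exists_eq_altProd (A := A) (B := B)
  have hbs : ∀ b ∈ L.map fun q => (q.2, w (u⁻¹ * q.1)), Even b.2.length := by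
    intro b hb
    obtain ⟨q, -, rfl⟩ := List.mem_map.mp hb
    exact hweven _
  obtain ⟨h₀, l, hl⟩ := exists_isTightWord (R := R) (M := M) (m := m) (a := (a, 1)) (ε := ε) hn
    (by simpa using hx 0) (Nat.le_of_lt_succ hR.max_lt) (Nat.le_of_lt_succ hR.min_lt)
    (hweven u⁻¹) hbs (by
      rw [wordVal_diagram_one hn (hweven _) 0 (by simpa using hbs), List.map_cons, List.map_map,
        ← hw]
      have h1 := conj_conjProd (prefixProd x (n + 1)) u⁻¹ ((u, ε) :: L)
      rw [← hL, List.map_cons] at h1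
      have h2 : conjProd (prefixProd x (n + 1)) ((altProd true (ε, ([] : List (A × B))).2, ε) ::
          L.map ((fun b => (altProd true b.2, b.1)) ∘ fun q => (q.2, w (u⁻¹ * q.1)))) =
          u⁻¹ * Monoid.Coprod.inl a * u⁻¹⁻¹ := by
        rw [h1]
        congr 2
        · simp [altProd]
        · exact List.map_congr_left fun q _ => by simp [← hw]
      refine (congrArg (· * _) h2).trans ?_
      simp only [evalLetter, inv_inv]
      simp [mul_assoc])
  refine not_isTightWord hR (V := virtual (n + 1)) ?_ cancelling_not ?_ hl
  · rintro _ ⟨_, _, _, hi, rfl⟩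
    exact hi
  · rintro ⟨L', d, hlen, h⟩
    have h1 : Monoid.Coprod.inl a = conjProd (prefixProd x (n + 1))
        (L'.map fun q => (d⁻¹ * q.1, q.2)) := by
      rw [← conj_conjProd, eq_mul_inv_of_mul_eq h.symm]
      simp [evalLetter, mul_assoc]
    have := hmin _ h1
    simp at this hlen
    omega

end InitialTightWord

section Reduction

/-- The element spelled by a list of pairs of letters. -/
def pairProd (q : List (A × B)) : Monoid.Coprod A B :=
  (q.map fun z => evalLetter true z * evalLetter false z).prod

theorem pairProd_append (q q' : List (A × B)) :
    pairProd (q ++ q') = pairProd q * pairProd q' := by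
  simp [pairProd]

theorem pairProd_cons (z : A × B) (q : List (A × B)) :
    pairProd (z :: q) = evalLetter true z * evalLetter false z * pairProd q := by
  simp [pairProd]

theorem exists_eq_pairProd (g : Monoid.Coprod A B) : ∃ q : List (A × B), g = pairProd q := by
  induction g using Monoid.Coprod.induction_on with
  | inl a => exact ⟨[(a, 1)], by simp [pairProd, evalLetter]⟩
  | inr b => exact ⟨[(1, b)], by simp [pairProd, evalLetter]⟩
  | mul g h hg hh =>
    obtain ⟨q, rfl⟩ := hg
    obtain ⟨q', rfl⟩ := hh
    exact ⟨q ++ q', (pairProd_append _ _).symm⟩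

theorem exists_shorter_of_trivial {X Y : List (A × B)} {z : A × B} (hXY : Y ++ X ≠ [])
    (hz : z.1 = 1 ∨ z.2 = 1) : ∃ (h : Monoid.Coprod A B) (q : List (A × B)),
      q.length < (X ++ z :: Y).length ∧ pairProd (X ++ z :: Y) = h * pairProd q * h⁻¹ := by
  have hlen : (X ++ z :: Y).length = (Y ++ X).length + 1 := by simp; omega
  have hconj : pairProd (X ++ z :: Y) =
      pairProd X * (evalLetter true z * evalLetter false z * pairProd (Y ++ X)) *
        (pairProd X)⁻¹ := by
    simp [pairProd_append, pairProd_cons, mul_assoc]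
  rw [hlen, hconj]
  rcases hz with hz | hz
  · rw [← List.dropLast_append_getLast hXY]
    set W := (Y ++ X).dropLast
    set z' := (Y ++ X).getLast hXY
    refine ⟨pairProd X * evalLetter false z, W ++ [(z'.1, z'.2 * z.2)], by simp, ?_⟩
    simp [hz, pairProd, evalLetter, mul_assoc]
  · obtain ⟨z', W, hW⟩ := List.exists_cons_of_ne_nil hXY
    rw [hW]
    refine ⟨pairProd X, (z.1 * z'.1, z'.2) :: W, by simp, ?_⟩
    simp [hz, pairProd, evalLetter, mul_assoc]

theorem pairProd_map_range_mul {y : ℕ → A × B} {e : ℕ} (hy : ∀ j, y (j + e) = y j) (m : ℕ) :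
    pairProd ((List.range (e * m)).map y) = pairProd ((List.range e).map y) ^ m := by
  induction m with
  | zero => simp [pairProd]
  | succ m ih =>
    have hy' : ∀ j, y (e * m + j) = y j := fun j => by
      rw [add_comm, mul_comm]
      clear ih
      induction m with
      | zero => simp
      | succ m ih => rw [Nat.succ_mul, ← add_assoc, hy, ih]
    rw [Nat.mul_succ, List.range_add, List.map_append, pairProd_append, ih, pow_succ, List.map_map]
    congr 3
    exact funext hy'

/-- The letters of the word spelled by the pairs `y`. -/
def letters (y : ℕ → A × B) (k : ℕ) : A × B :=
  if parity k then ((y (k / 2)).1, 1) else (1, (y (k / 2)).2)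

theorem parity_two_mul (j : ℕ) : parity (2 * j) = true := by simp [parity]

theorem letters_two_mul (y : ℕ → A × B) (j : ℕ) : letters y (2 * j) = ((y j).1, 1) := by
  simp [letters, parity_two_mul]

theorem letters_two_mul_add_one (y : ℕ → A × B) (j : ℕ) :
    letters y (2 * j + 1) = (1, (y j).2) := by
  have : (2 * j + 1) / 2 = j := by omega
  simp [letters, parity_succ, parity_two_mul, this]

theorem prefixProd_letters (y : ℕ → A × B) (j : ℕ) :
    prefixProd (letters y) (2 * j) = pairProd ((List.range j).map y) := by
  induction j with
  | zero => rfl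
  | succ j ih =>
    rw [List.range_succ, List.map_append, pairProd_append, ← ih]
    change prefixProd (letters y) (2 * j) * evalLetter (parity (2 * j)) (letters y (2 * j)) *
      evalLetter (parity (2 * j + 1)) (letters y (2 * j + 1)) = _
    rw [letters_two_mul, letters_two_mul_add_one, parity_succ, parity_two_mul]
    simp [pairProd, evalLetter, mul_assoc]

theorem exists_dvd_period {α : Type*} {y : ℕ → α} {s e : ℕ} (hs : ∀ j, y (j + s) = y j)
    (he0 : 0 < e) (hes : e < s) (he : ∀ j, y (j + e) = y j) :
    ∃ d m, d < s ∧ d * m = s ∧ ∀ j, y (j + d) = y j := by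
  classical
  have hex : ∃ d, 0 < d ∧ ∀ j, y (j + d) = y j := ⟨e, he0, he⟩
  obtain ⟨hd0, hd⟩ := Nat.find_spec hex
  have hle : Nat.find hex ≤ e := Nat.find_min' hex ⟨he0, he⟩
  set d := Nat.find hex with hd_def
  refine ⟨d, s / d, by omega, Nat.mul_div_cancel' (Nat.dvd_of_mod_eq_zero ?_), hd⟩
  by_contra hmod
  have hmul : ∀ m j, y (j + d * m) = y j := fun m => by
    induction m with
    | zero => simp
    | succ m ih => intro j; rw [Nat.mul_succ, ← add_assoc, hd, ih]
  have := Nat.find_min' hex (m := s % d) ⟨Nat.pos_of_ne_zero hmod, fun j => by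
    rw [← hmul (s / d), add_assoc, Nat.mod_add_div, hs]⟩
  exact (Nat.mod_lt s hd0).not_ge this

theorem eq_one_of_inl_mem_normalClosure_pairProd (hA : IsLeftOrderable A)
    (hB : IsLeftOrderable B) {y : ℕ → A × B} {s : ℕ} (hs : 0 < s) (hy : ∀ j, y (j + s) = y j)
    (hne : ∀ j, (y j).1 ≠ 1 ∧ (y j).2 ≠ 1)
    (hprim : ∀ e, 0 < e → e < s → ∃ j, y (j + e) ≠ y j) {a : A}
    (ha : Monoid.Coprod.inl a ∈ Subgroup.normalClosure {pairProd ((List.range s).map y)}) :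
    a = 1 := by
  obtain ⟨n, hn⟩ : ∃ n, 2 * s = n + 1 := ⟨2 * s - 1, by omega⟩
  have hcases : ∀ k, (∃ j, k = 2 * j) ∨ ∃ j, k = 2 * j + 1 := fun k => by
    rcases Nat.even_or_odd' k with ⟨j, h | h⟩
    exacts [Or.inl ⟨j, h⟩, Or.inr ⟨j, h⟩]
  refine eq_one_of_inl_mem_normalClosure (x := letters y) (n := n) hA hB (hn ▸ even_two_mul s)
    (fun k => ?_) (fun k => ?_) (fun k => ?_) (fun d hd hdn => ?_) ?_
  · rw [← hn]
    rcases hcases k with ⟨j, rfl | rfl⟩ | ⟨j, rfl⟩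
    · rw [← mul_add, letters_two_mul, letters_two_mul, hy]
    · rw [show 2 * j + 1 + 2 * s = 2 * (j + s) + 1 by ring, letters_two_mul_add_one,
        letters_two_mul_add_one, hy]
  · rcases hcases k with ⟨j, rfl⟩ | ⟨j, rfl⟩
    · rw [letters_two_mul, parity_two_mul]
      exact fun h => (hne j).1 (Monoid.Coprod.inl_injective (h.trans (map_one _).symm))
    · rw [letters_two_mul_add_one, parity_succ, parity_two_mul]
      exact fun h => (hne j).2 (Monoid.Coprod.inr_injective (h.trans (map_one _).symm))
  · rcases hcases k with ⟨j, rfl⟩ | ⟨j, rfl⟩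
    · rw [letters_two_mul, parity_two_mul]
      exact map_one Monoid.Coprod.inr
    · rw [letters_two_mul_add_one, parity_succ, parity_two_mul]
      exact map_one Monoid.Coprod.inl
  · rcases hcases d with ⟨e, rfl⟩ | ⟨e, rfl⟩
    · obtain ⟨j, hj⟩ := hprim e (by omega) (by omega)
      by_contra! h
      have h1 := h (2 * j)
      have h2 := h (2 * j + 1)
      rw [← mul_add, letters_two_mul, letters_two_mul, Prod.mk.injEq] at h1
      rw [show 2 * j + 1 + 2 * e = 2 * (j + e) + 1 by ring, letters_two_mul_add_one,
        letters_two_mul_add_one, Prod.mk.injEq] at h2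
      exact hj (Prod.ext h1.1 h2.2)
    · refine ⟨2 * 0, fun h => (hne 0).1 ?_⟩
      rw [show 2 * 0 + (2 * e + 1) = 2 * e + 1 by ring, letters_two_mul, letters_two_mul_add_one,
        Prod.mk.injEq] at h
      exact h.1.symm
  · rwa [← hn, prefixProd_letters]

theorem eq_one_of_inl_mem_normalClosure_of_not_conj (hA : IsLeftOrderable A)
    (hB : IsLeftOrderable B) {w : Monoid.Coprod A B}
    (hw : ∀ g : Monoid.Coprod A B,
      g * w * g⁻¹ ∉ (Monoid.Coprod.inl : A →* Monoid.Coprod A B).range)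
    {a : A} (ha : Monoid.Coprod.inl a ∈ Subgroup.normalClosure {w}) : a = 1 := by
  obtain ⟨q, ⟨g, k, hgk⟩, hmin⟩ : ∃ q : List (A × B), (∃ g k, g * w * g⁻¹ = pairProd q ^ k) ∧
      ∀ q' : List (A × B), (∃ (g : Monoid.Coprod A B) (k : ℕ), g * w * g⁻¹ = pairProd q' ^ k) →
        q.length ≤ q'.length := by
    obtain ⟨q, hq⟩ := exists_eq_pairProd w
    obtain ⟨l, ⟨q, rfl, hq⟩, hl⟩ := exists_minimal_of_wellFoundedLT
      (fun l => ∃ q : List (A × B), q.length = l ∧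
        ∃ (g : Monoid.Coprod A B) (k : ℕ), g * w * g⁻¹ = pairProd q ^ k)
      ⟨_, q, rfl, 1, 1, by simpa using hq⟩
    exact ⟨q, hq, fun q' hq' => (le_total _ _).elim id fun h => hl ⟨q', rfl, hq'⟩ h⟩
  have hq : q ≠ [] := by
    rintro rfl
    exact hw g ⟨1, by simp [hgk, pairProd]⟩
  by_cases htriv : ∃ z ∈ q, z.1 = 1 ∨ z.2 = 1
  · obtain ⟨z, hzq, hz⟩ := htriv
    obtain ⟨X, Y, rfl⟩ := List.append_of_mem hzq
    by_cases hXY : Y ++ X = []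
    · obtain ⟨rfl, rfl⟩ := List.append_eq_nil_iff.mp hXY
      rcases hz with hz | hz
      · have hker : Subgroup.normalClosure {w} ≤
            (Monoid.Coprod.fst : Monoid.Coprod A B →* A).ker := by
          refine Subgroup.normalClosure_le_normal (Set.singleton_subset_iff.mpr ?_)
          have h := congrArg (Monoid.Coprod.fst : Monoid.Coprod A B →* A) hgk
          simp only [map_mul, map_inv, map_pow] at h
          simp [pairProd, evalLetter, hz] at h
          exact h
        simpa using hker ha
      · exact absurd ⟨z.1 ^ k, by simp [hgk, pairProd, evalLetter, hz]⟩ (hw g)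
    · obtain ⟨h, q', hlen, hq'⟩ := exists_shorter_of_trivial hXY hz
      refine absurd (hmin q' ⟨h⁻¹ * g, k, ?_⟩) hlen.not_ge
      rw [hq', conj_pow] at hgk
      calc h⁻¹ * g * w * (h⁻¹ * g)⁻¹ = h⁻¹ * (g * w * g⁻¹) * h := by group
        _ = pairProd q' ^ k := by rw [hgk]; group
  · push Not at htriv
    set s := q.length with hs
    have hs0 : 0 < s := List.length_pos_of_ne_nil hq
    let y : ℕ → A × B := fun j => q.getD (j % s) 1
    have hlt : ∀ j, j % s < q.length := fun j => Nat.mod_lt j hs0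
    have hy : ∀ j, y (j + s) = y j := fun j => by simp [y]
    have hmap : (List.range s).map y = q := by
      refine List.ext_getElem (by simp [hs]) fun i h1 h2 => ?_
      have h3 : i % s = i := Nat.mod_eq_of_lt h2
      simp [y, h3, h2]
    have hyq : ∀ j, y j ∈ q := fun j => by
      simp only [y, List.getD_eq_getElem _ _ (hlt j)]
      exact List.getElem_mem _
    refine eq_one_of_inl_mem_normalClosure_pairProd hA hB hs0 hy (fun j => htriv _ (hyq j))
      (fun e he0 hes => ?_) ?_
    · by_contra! he
      obtain ⟨d, m, hds, hdm, hd⟩ := exists_dvd_period hy he0 hes he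
      have h := hmin ((List.range d).map y) ⟨g, m * k, by
        rw [pow_mul, ← pairProd_map_range_mul hd, hdm, hmap, hgk]⟩
      simp at h
      omega
    · rw [hmap]
      refine Subgroup.normalClosure_le_normal (Set.singleton_subset_iff.mpr ?_) ha
      have h := Subgroup.pow_mem _
        (Subgroup.subset_normalClosure (Set.mem_singleton (pairProd q))) k
      rw [← hgk] at h
      have := Subgroup.normalClosure_normal.conj_mem _ h g⁻¹
      simpa [mul_assoc] using this

end Reduction

end AuxiliaryResults

/-- If `A` and `B` are nontrivial left-orderable groups, `G = A ∗ B`, and no conjugate of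
`w ∈ G` lies in the image of `A → G`, then `A → G → G/⟪w⟫` is injective. -/
theorem injective_of_not_conjugate_into_factor
    {A B : Type*} [Group A] [Group B] [Nontrivial A] [Nontrivial B]
    (hA : IsLeftOrderable A) (hB : IsLeftOrderable B)
    (w : Monoid.Coprod A B)
    (hw : ∀ g : Monoid.Coprod A B,
      g * w * g⁻¹ ∉ (Monoid.Coprod.inl : A →* Monoid.Coprod A B).range) :
    Function.Injective fun a : A =>
      (QuotientGroup.mk (Monoid.Coprod.inl a) :
        Monoid.Coprod A B ⧸ Subgroup.normalClosure {w}) := by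
  intro a₁ a₂ h
  have h1 := QuotientGroup.eq.mp h
  rw [← map_inv, ← map_mul] at h1
  exact inv_mul_eq_one.mp (eq_one_of_inl_mem_normalClosure_of_not_conj hA hB hw h1)
end

section
/- Let H be a countable group and let m ≥ 1. For each 1 ≤ i ≤ m, let Eᵢ and Nᵢ be finite subsets of H, and suppose that for each i there exist a right action τᵢ of H on ℝ by orientation-preserving homeomorphisms and a point xᵢ ∈ ℝ such that xᵢ·τᵢ(α) = xᵢ for every α ∈ Eᵢ and xᵢ·τᵢ(β) ≠ xᵢ for every β ∈ Nᵢ. Then there exist a right action τ of H on ℝ by orientation-preserving homeomorphisms and a point x ∈ ℝ such that x·τ(α) = x for every α ∈ E₁ ∩ ⋯ ∩ E_m and x·τ(β) ≠ x for every β ∈ N₁ ∪ ⋯ ∪ N_m. -/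
/-- A right action of `H` on `ℝ` by orientation-preserving homeomorphisms, i.e. a map
to order-preserving bijections of `ℝ` satisfying `x·τ(gh) = (x·τ(g))·τ(h)`. -/
def IsRightAction {H : Type*} [Group H] (τ : H → (ℝ ≃o ℝ)) : Prop :=
  ∀ g h : H, τ (g * h) = (τ g).trans (τ h)

/-- A right action of `H` on `α` by monotone maps. -/
structure IsMonotoneRightAction {H α : Type*} [Group H] [LinearOrder α] (σ : H → α → α) :
    Prop where
  monotone : ∀ h, Monotone (σ h)
  map_one : ∀ a, σ 1 a = a
  map_mul : ∀ g h a, σ (g * h) a = σ h (σ g a)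

namespace IsMonotoneRightAction

variable {H α β : Type*} [Group H] [LinearOrder α] [LinearOrder β] {σ : H → α → α}

theorem inv_apply (hσ : IsMonotoneRightAction σ) (h : H) (a : α) : σ h⁻¹ (σ h a) = a := by
  rw [← hσ.map_mul, mul_inv_cancel, hσ.map_one]

theorem apply_inv (hσ : IsMonotoneRightAction σ) (h : H) (a : α) : σ h (σ h⁻¹ a) = a := by
  rw [← hσ.map_mul, inv_mul_cancel, hσ.map_one]

theorem strictMono (hσ : IsMonotoneRightAction σ) (h : H) : StrictMono (σ h) :=
  (hσ.monotone h).strictMono_of_injective (Function.LeftInverse.injective (hσ.inv_apply h))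

theorem exists_isRightAction {σ : H → ℝ → ℝ} (hσ : IsMonotoneRightAction σ) :
    ∃ τ : H → (ℝ ≃o ℝ), IsRightAction τ ∧ ∀ h a, τ h a = σ h a := by
  refine ⟨fun h => (hσ.strictMono h).orderIsoOfRightInverse (σ h) (σ h⁻¹) (hσ.apply_inv h),
    fun g h => ?_, fun h a => rfl⟩
  ext a
  exact hσ.map_mul g h a

theorem conj (hσ : IsMonotoneRightAction σ) (e : α ≃o β) :
    IsMonotoneRightAction fun h b => e (σ h (e.symm b)) where
  monotone h := e.monotone.comp ((hσ.monotone h).comp e.symm.monotone)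
  map_one b := by simp [hσ.map_one]
  map_mul g h b := by simp [hσ.map_mul]

theorem prodLex (hσ : IsMonotoneRightAction σ) :
    IsMonotoneRightAction fun h (p : α ×ₗ β) => toLex (σ h (ofLex p).1, (ofLex p).2) where
  monotone h p q hpq := by
    rw [Prod.Lex.le_iff] at hpq ⊢
    rcases hpq with hpq | ⟨h₁, h₂⟩
    · exact Or.inl (hσ.strictMono h hpq)
    · exact Or.inr ⟨congrArg (σ h) h₁, h₂⟩
  map_one p := by simp [hσ.map_one]
  map_mul g h p := by simp [hσ.map_mul]

theorem orbit (hσ : IsMonotoneRightAction σ) (a : α) :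
    IsMonotoneRightAction fun h (p : Set.range fun g => σ g a) =>
      (⟨σ h p, by
        obtain ⟨_, g, rfl⟩ := p
        exact ⟨g * h, hσ.map_mul g h a⟩⟩ : Set.range fun g => σ g a) where
  monotone h _ _ hpq := hσ.monotone h hpq
  map_one p := Subtype.ext (hσ.map_one p)
  map_mul g h p := Subtype.ext (hσ.map_mul g h p)

theorem piLex {ι : Type*} [LinearOrder ι] [WellFoundedLT ι] {σ : ι → H → α → α}
    (hσ : ∀ i, IsMonotoneRightAction (σ i)) :
    IsMonotoneRightAction fun h (p : Lex (ι → α)) => toLex fun i => σ i h (ofLex p i) where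
  monotone h := by
    refine StrictMono.monotone fun p q hpq => ?_
    obtain ⟨i, hlt, hi⟩ := hpq
    exact ⟨i, fun j hj => congrArg (σ j h) (hlt j hj), (hσ i).strictMono h hi⟩
  map_one p := by
    apply ofLex.injective
    funext i
    exact (hσ i).map_one _
  map_mul g h p := by
    apply ofLex.injective
    funext i
    exact (hσ i).map_mul g h _

end IsMonotoneRightAction

/-- The left-continuous extension to `ℝ` of a function on `ℚ`. -/
noncomputable def leftExtension (f : ℚ → ℚ) (x : ℝ) : ℝ :=
  sSup ((fun q : ℚ => (f q : ℝ)) '' {q | (q : ℝ) < x})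

theorem leftExtension_nonempty (f : ℚ → ℚ) (x : ℝ) :
    ((fun q : ℚ => (f q : ℝ)) '' {q | (q : ℝ) < x}).Nonempty :=
  Set.Nonempty.image _ ((exists_rat_lt x).imp fun _ => Set.mem_ofPred.2)

theorem leftExtension_bddAbove {f : ℚ → ℚ} (hf : Monotone f) (x : ℝ) :
    BddAbove ((fun q : ℚ => (f q : ℝ)) '' {q | (q : ℝ) < x}) := by
  obtain ⟨r, hr⟩ := exists_rat_gt x
  refine ⟨f r, ?_⟩
  rintro _ ⟨q, hq, rfl⟩
  exact Rat.cast_le.2 (hf (Rat.cast_le.1 ((Set.mem_ofPred.1 hq).trans hr).le))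

theorem leftExtension_monotone {f : ℚ → ℚ} (hf : Monotone f) : Monotone (leftExtension f) :=
  fun x y hxy => csSup_le_csSup (leftExtension_bddAbove hf y) (leftExtension_nonempty f x)
    (Set.image_mono fun _ hq => Set.mem_ofPred.2 (lt_of_lt_of_le (Set.mem_ofPred.1 hq) hxy))

theorem leftExtension_ratCast {f : ℚ → ℚ} (hf : Monotone f) (hs : Function.Surjective f) (q : ℚ) :
    leftExtension f q = f q := by
  refine csSup_eq_of_forall_le_of_forall_lt_exists_gt (leftExtension_nonempty f q) ?_ ?_
  · rintro _ ⟨r, hr, rfl⟩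
    exact Rat.cast_le.2 (hf (Rat.cast_le.1 (le_of_lt (Set.mem_ofPred.1 hr))))
  · intro w hw
    obtain ⟨r, hwr, hrq⟩ := exists_rat_btwn hw
    obtain ⟨s, rfl⟩ := hs r
    exact ⟨f s, ⟨s, Set.mem_ofPred.2 (Rat.cast_lt.2 (hf.reflect_lt (Rat.cast_lt.1 hrq))), rfl⟩, hwr⟩

/-- Two monotone real functions which extend the same surjection `ℚ → ℚ` are equal. -/
theorem Monotone.eq_of_eq_ratCast {F G : ℝ → ℝ} (hF : Monotone F) (hG : Monotone G) {f : ℚ → ℚ}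
    (hs : Function.Surjective f) (hFf : ∀ q : ℚ, F q = f q) (hGf : ∀ q : ℚ, G q = f q) : F = G := by
  have le {F G : ℝ → ℝ} (hF : Monotone F) (hG : Monotone G) (hFf : ∀ q : ℚ, F q = f q)
      (hGf : ∀ q : ℚ, G q = f q) (x : ℝ) : F x ≤ G x := by
    by_contra! hlt
    obtain ⟨r, hGr, hrF⟩ := exists_rat_btwn hlt
    obtain ⟨q, rfl⟩ := hs r
    rw [← hGf] at hGr
    rw [← hFf] at hrF
    exact lt_asymm (hG.reflect_lt hGr) (hF.reflect_lt hrF)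
  exact funext fun x => le_antisymm (le hF hG hFf hGf x) (le hG hF hGf hFf x)

namespace IsMonotoneRightAction

variable {H α : Type*} [Group H] [LinearOrder α]

theorem leftExtension {σ : H → ℚ → ℚ} (hσ : IsMonotoneRightAction σ) :
    IsMonotoneRightAction fun h => leftExtension (σ h) := by
  have hs (h : H) : Function.Surjective (σ h) := fun q => ⟨_, hσ.apply_inv h q⟩
  have hm (h : H) := leftExtension_monotone (hσ.monotone h)
  have hq (h : H) := leftExtension_ratCast (hσ.monotone h) (hs h)
  refine ⟨hm, congrFun ?_, fun g h => congrFun ?_⟩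
  · exact (hm 1).eq_of_eq_ratCast monotone_id (hs 1) (hq 1) fun q => by simp [hσ.map_one]
  · exact (hm (g * h)).eq_of_eq_ratCast ((hm h).comp (hm g)) (hs (g * h)) (hq (g * h))
      fun q => by simp [hq, hσ.map_mul]

/-- Every point stabilizer of an action of a countable group on a linear order is a point
stabilizer of an action on the real line. -/
theorem exists_real_stabilizer [Countable H] {σ : H → α → α} (hσ : IsMonotoneRightAction σ)
    (a : α) : ∃ (τ : H → (ℝ ≃o ℝ)) (x : ℝ), IsRightAction τ ∧ ∀ h, τ h x = x ↔ σ h a = a := by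
  let Ω := Set.range fun g => σ g a
  let ω : Ω := ⟨a, 1, hσ.map_one a⟩
  have : Nonempty Ω := ⟨ω⟩
  have : Countable Ω := (Set.countable_range _).to_subtype
  have : Countable (Ω ×ₗ ℚ) := inferInstanceAs (Countable (Ω × ℚ))
  have : Nonempty (Ω ×ₗ ℚ) := ⟨toLex (ω, 0)⟩
  obtain ⟨e⟩ := Order.iso_of_countable_dense (Ω ×ₗ ℚ) ℚ
  have hQ := ((hσ.orbit a).prodLex (β := ℚ)).conj e
  obtain ⟨τ, hτ, hτσ⟩ := hQ.leftExtension.exists_isRightAction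
  refine ⟨τ, (e (toLex (ω, 0)) : ℚ), hτ, fun h => ?_⟩
  rw [hτσ, leftExtension_ratCast (hQ.monotone h) fun q => ⟨_, hQ.apply_inv h q⟩]
  simp [Subtype.ext_iff, ω]

end IsMonotoneRightAction

theorem IsRightAction.isMonotoneRightAction {H : Type*} [Group H] {τ : H → (ℝ ≃o ℝ)}
    (hτ : IsRightAction τ) : IsMonotoneRightAction fun h x => τ h x where
  monotone h := (τ h).monotone
  map_one x := (τ 1).injective (by
    have h := DFunLike.congr_fun (hτ 1 1) x
    rw [mul_one] at h
    exact h.symm)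
  map_mul g h x := DFunLike.congr_fun (hτ g h) x

/-- If each of finitely many finite systems `(Eᵢ, Nᵢ)` of equations and inequations over
a countable group `H` is solvable by a right action of `H` on `ℝ` and a point of `ℝ`,
then so is the combined system `(E₁ ∩ ⋯ ∩ E_m, N₁ ∪ ⋯ ∪ N_m)`. -/
theorem combined_system_solvable
    {H : Type*} [Group H] [Countable H] {m : ℕ} (hm : 1 ≤ m)
    (E N : Fin m → Finset H)
    (hsol : ∀ i : Fin m, ∃ (τ : H → (ℝ ≃o ℝ)) (x : ℝ),
      IsRightAction τ ∧ (∀ α ∈ E i, τ α x = x) ∧ (∀ β ∈ N i, τ β x ≠ x)) :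
    ∃ (τ : H → (ℝ ≃o ℝ)) (x : ℝ),
      IsRightAction τ ∧
      (∀ α : H, (∀ i : Fin m, α ∈ E i) → τ α x = x) ∧
      (∀ β : H, (∃ i : Fin m, β ∈ N i) → τ β x ≠ x) := by
  choose τ x hτ hE hN using hsol
  obtain ⟨ρ, y, hρ, hy⟩ := (IsMonotoneRightAction.piLex fun i =>
    (hτ i).isMonotoneRightAction).exists_real_stabilizer (toLex x)
  have hstab (h : H) : ρ h y = y ↔ ∀ i, τ i h (x i) = x i :=
    (hy h).trans (toLex.injective.eq_iff.trans funext_iff)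
  refine ⟨ρ, y, hρ, fun α hα => (hstab α).2 fun i => hE i α (hα i), ?_⟩
  rintro β ⟨i, hβ⟩ hfix
  exact hN i β hβ ((hstab β).1 hfix i)
end
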